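/- arXiv:0804.3134 — 4 statements merged into one kernel-verified Lean document; each statement's English description precedes it below -/
import Mathlib

section
/- Let G be a perfect group (G equals its own commutator subgroup) and let C be an abelian group regarded as a trivial G-module. Then there is a group isomorphism H²(G, C) ≅ Hom(H₂(G, ℤ), C), where H₂(G, ℤ) is the second integral group homology of G. -/
/-- The degree-2 differential of the bar complex computing group homology of `G` with trivial
coefficients `ℤ`: on a generator `[g|h]` it is `[h] − [g·h] + [g]`. -/
noncomputable def barD2 (G : Type*) [Group G] : (G × G →₀ ℤ) →+ (G →₀ ℤ) :=
  Finsupp.liftAddHom fun p => zmultiplesHom _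
    (Finsupp.single p.2 1 - Finsupp.single (p.1 * p.2) 1 + Finsupp.single p.1 1)

/-- The degree-3 differential of the bar complex computing group homology of `G` with trivial
coefficients `ℤ`: on a generator `[g|h|k]` it is `[h|k] − [g·h|k] + [g|h·k] − [g|h]`. -/
noncomputable def barD3 (G : Type*) [Group G] : (G × G × G →₀ ℤ) →+ (G × G →₀ ℤ) :=
  Finsupp.liftAddHom fun p => zmultiplesHom _
    (Finsupp.single (p.2.1, p.2.2) 1 - Finsupp.single (p.1 * p.2.1, p.2.2) 1
      + Finsupp.single (p.1, p.2.1 * p.2.2) 1 - Finsupp.single (p.1, p.2.1) 1)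

/-- The second integral group homology `H₂(G, ℤ)` of `G` (with trivial `G`-action on `ℤ`),
computed by the bar complex: 2-cycles modulo boundaries of 3-chains. -/
abbrev groupHomology2 (G : Type*) [Group G] :=
  (barD2 G).ker ⧸ ((barD3 G).range.addSubgroupOf (barD2 G).ker)

open groupCohomology

section

variable {G : Type*} [Group G] {C : Type*} [AddCommGroup C]

@[simp]
lemma barD2_single (p : G × G) :
    barD2 G (Finsupp.single p 1) =
      Finsupp.single p.2 1 - Finsupp.single (p.1 * p.2) 1 + Finsupp.single p.1 1 := by
  simp [barD2]

@[simp]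
lemma barD3_single (p : G × G × G) :
    barD3 G (Finsupp.single p 1) =
      Finsupp.single (p.2.1, p.2.2) 1 - Finsupp.single (p.1 * p.2.1, p.2.2) 1
        + Finsupp.single (p.1, p.2.1 * p.2.2) 1 - Finsupp.single (p.1, p.2.1) 1 := by
  simp [barD3]

lemma barD2_barD3 (x : G × G × G →₀ ℤ) : barD2 G (barD3 G x) = 0 := by
  suffices h : (barD2 G).comp (barD3 G) = 0 from DFunLike.congr_fun h x
  ext p : 2
  ext
  simp [mul_assoc]
  abel

/-- The class of a group element modulo the boundaries of 2-chains, as a homomorphism. -/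
noncomputable def barD2CokerHom (G : Type*) [Group G] :
    G →* Multiplicative ((G →₀ ℤ) ⧸ (barD2 G).range) :=
  MonoidHom.mk' (fun g => .ofAdd (QuotientAddGroup.mk (Finsupp.single g 1))) fun g h => by
    rw [← ofAdd_add, ← QuotientAddGroup.mk_add]
    congr 1
    rw [QuotientAddGroup.eq]
    exact ⟨Finsupp.single (g, h) 1, by rw [barD2_single]; abel⟩

lemma barD2_surjective (hG : commutator G = ⊤) : Function.Surjective (barD2 G) := by
  rw [← AddMonoidHom.range_eq_top, eq_top_iff]
  have hker : (barD2CokerHom G).ker = ⊤ :=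
    top_le_iff.1 (hG ▸ Abelianization.commutator_subset_ker (barD2CokerHom G))
  have hmk : QuotientAddGroup.mk' (barD2 G).range = 0 := by
    ext g
    exact MonoidHom.mem_ker.1 (hker ▸ Subgroup.mem_top g : g ∈ (barD2CokerHom G).ker)
  rw [← QuotientAddGroup.ker_mk' (barD2 G).range, hmk]
  exact fun _ _ => rfl

lemma exists_barD2_section (hG : commutator G = ⊤) :
    ∃ s : (G →₀ ℤ) →+ (G × G →₀ ℤ), ∀ x, barD2 G (s x) = x := by
  choose t ht using fun g : G => barD2_surjective hG (Finsupp.single g 1)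
  refine ⟨Finsupp.liftAddHom fun g => zmultiplesHom _ (t g), fun x => ?_⟩
  suffices h : (barD2 G).comp (Finsupp.liftAddHom fun g => zmultiplesHom _ (t g)) =
      AddMonoidHom.id _ from DFunLike.congr_fun h x
  ext g : 2
  ext
  simp [ht]

/-- Evaluation of a function on a basis, extended to integral chains. -/
noncomputable def evalChain (X C : Type*) [AddCommGroup C] : (X → C) →+ (X →₀ ℤ) →+ C where
  toFun f := Finsupp.liftAddHom fun p => zmultiplesHom _ (f p)
  map_zero' := by ext; simp
  map_add' f g := by ext; simp

@[simp]
lemma evalChain_single {X : Type*} (f : X → C) (p : X) :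
    evalChain X C f (Finsupp.single p 1) = f p := by
  simp [evalChain]

lemma evalChain_comp_single {X : Type*} (φ : (X →₀ ℤ) →+ C) :
    evalChain X C (fun p => φ (Finsupp.single p 1)) = φ := by
  ext; simp

end

section

variable {G C : Type} [Group G] [AddCommGroup C]

lemma mem_cocycles₂_trivial_iff (f : G × G → C) :
    f ∈ cocycles₂ (Rep.trivial ℤ G C) ↔ (evalChain _ C f).comp (barD3 G) = 0 := by
  rw [mem_cocycles₂_iff]
  constructor
  · intro hf
    ext ⟨g, h, j⟩
    have : f (g * h, j) + f (g, h) = f (h, j) + f (g, h * j) := hf g h j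
    simp only [AddMonoidHom.comp_apply, Finsupp.singleAddHom_apply, barD3_single, map_add,
      map_sub, evalChain_single, AddMonoidHom.zero_apply]
    rw [sub_add_eq_add_sub, ← this, sub_sub, sub_self]
  · intro hf g h j
    have := DFunLike.congr_fun hf (Finsupp.single (g, h, j) 1)
    simp only [AddMonoidHom.comp_apply, barD3_single, map_add,
      map_sub, evalChain_single, AddMonoidHom.zero_apply] at this
    rw [sub_add_eq_add_sub, sub_sub, sub_eq_zero] at this
    exact this.symm

/-- Evaluation of 2-cocycles with trivial coefficients on second integral homology. -/
noncomputable def cocycles₂EvalHomology (G C : Type) [Group G] [AddCommGroup C] :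
    cocycles₂ (Rep.trivial ℤ G C) →+ (groupHomology2 G →+ C) where
  toFun f := QuotientAddGroup.lift _ ((evalChain _ C f.1).comp (barD2 G).ker.subtype) <| by
    rintro ⟨_, _⟩ ⟨y, rfl⟩
    exact DFunLike.congr_fun ((mem_cocycles₂_trivial_iff f.1).1 f.2) y
  map_zero' := by
    ext x
    exact DFunLike.congr_fun (map_zero (evalChain (G × G) C)) x.1
  map_add' f g := by
    ext x
    exact DFunLike.congr_fun (map_add (evalChain (G × G) C) f.1 g.1) x.1

lemma cocycles₂EvalHomology_mk (f : cocycles₂ (Rep.trivial ℤ G C)) (x : (barD2 G).ker) :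
    cocycles₂EvalHomology G C f (QuotientAddGroup.mk x) = evalChain _ C f.1 x.1 :=
  rfl

lemma cocycles₂EvalHomology_surjective (hG : commutator G = ⊤) :
    Function.Surjective (cocycles₂EvalHomology G C) := by
  obtain ⟨s, hs⟩ := exists_barD2_section hG
  intro φ
  let r : (G × G →₀ ℤ) →+ (barD2 G).ker :=
    (AddMonoidHom.id _ - s.comp (barD2 G)).codRestrict _ fun x => by
      simp [AddMonoidHom.mem_ker, hs]
  have hr (x : G × G →₀ ℤ) (hx : barD2 G x = 0) : r x = ⟨x, hx⟩ :=
    Subtype.ext (by simp [r, hx])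
  let ψ : (G × G →₀ ℤ) →+ C := φ.comp ((QuotientAddGroup.mk' _).comp r)
  refine ⟨⟨fun p => ψ (Finsupp.single p 1), ?_⟩, ?_⟩
  · rw [mem_cocycles₂_trivial_iff, evalChain_comp_single]
    refine AddMonoidHom.ext fun y => ?_
    change φ (QuotientAddGroup.mk (r (barD3 G y))) = 0
    rw [hr _ (barD2_barD3 y), (QuotientAddGroup.eq_zero_iff _).2, map_zero]
    exact ⟨y, rfl⟩
  · ext x
    change evalChain _ C (fun p => ψ (Finsupp.single p 1)) x.1 = φ (QuotientAddGroup.mk x)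
    rw [evalChain_comp_single]
    exact congrArg (fun z => φ (QuotientAddGroup.mk z)) (hr x.1 x.2)

lemma mem_coboundaries₂_trivial_iff (f : G × G → C) :
    f ∈ coboundaries₂ (Rep.trivial ℤ G C) ↔
      ∃ u : (G →₀ ℤ) →+ C, u.comp (barD2 G) = evalChain _ C f := by
  constructor
  · rintro ⟨v, rfl⟩
    refine ⟨evalChain G C v, ?_⟩
    ext ⟨g, h⟩
    simp [d₁₂]
  · rintro ⟨u, hu⟩
    refine ⟨fun g => u (Finsupp.single g 1), funext fun p => ?_⟩
    have := DFunLike.congr_fun hu (Finsupp.single p 1)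
    simpa [d₁₂] using this

lemma cocycles₂EvalHomology_eq_zero_iff (hG : commutator G = ⊤)
    (f : cocycles₂ (Rep.trivial ℤ G C)) :
    cocycles₂EvalHomology G C f = 0 ↔ f.1 ∈ coboundaries₂ (Rep.trivial ℤ G C) := by
  rw [mem_coboundaries₂_trivial_iff]
  constructor
  · intro hf
    obtain ⟨s, hs⟩ := exists_barD2_section hG
    refine ⟨(evalChain _ C f.1).comp s, AddMonoidHom.ext fun x => ?_⟩
    have hx : s (barD2 G x) - x ∈ (barD2 G).ker := by simp [AddMonoidHom.mem_ker, hs]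
    have := DFunLike.congr_fun hf (QuotientAddGroup.mk ⟨_, hx⟩)
    rw [cocycles₂EvalHomology_mk, map_sub] at this
    exact sub_eq_zero.1 this
  · rintro ⟨u, hu⟩
    ext x
    change evalChain _ C f.1 x.1 = 0
    rw [← hu, AddMonoidHom.comp_apply, AddMonoidHom.mem_ker.1 x.2, map_zero]

end

/-- Let `G` be a perfect group and `C` an abelian group regarded as a trivial
`G`-module.  Then `H²(G, C) ≅ Hom(H₂(G, ℤ), C)` as groups. -/
theorem h2_iso_hom_schurMultiplier (G : Type) [Group G] (hG : commutator G = ⊤)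
    (C : Type) [AddCommGroup C] :
    Nonempty ((groupCohomology (Rep.trivial ℤ G C) 2) ≃+ (groupHomology2 G →+ C)) := by
  let π : cocycles₂ (Rep.trivial ℤ G C) →+ groupCohomology (Rep.trivial ℤ G C) 2 :=
    (H2π (Rep.trivial ℤ G C)).hom.toAddMonoidHom
  have hπ : Function.Surjective π :=
    (ModuleCat.epi_iff_surjective (H2π (Rep.trivial ℤ G C))).1 inferInstance
  have hker : π.ker = (cocycles₂EvalHomology G C).ker := by
    ext f
    rw [AddMonoidHom.mem_ker, AddMonoidHom.mem_ker, cocycles₂EvalHomology_eq_zero_iff hG]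
    exact H2π_eq_zero_iff f
  exact ⟨(QuotientAddGroup.quotientKerEquivOfSurjective π hπ).symm.trans
    ((QuotientAddGroup.quotientAddEquivOfEq hker).trans
      (QuotientAddGroup.quotientKerEquivOfSurjective _ (cocycles₂EvalHomology_surjective hG)))⟩
end

section
/- Let G and H be perfect groups (each equal to its own commutator subgroup). Then the Schur multiplier is additive: there is a group isomorphism H₂(G × H, ℤ) ≅ H₂(G, ℤ) × H₂(H, ℤ). -/
namespace BarComplex

section Functoriality

variable {G H K : Type*} [Group G] [Group H] [Group K]

@[simp]
theorem barD2_single (p : G × G) (n : ℤ) :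
    barD2 G (Finsupp.single p n) =
      n • (Finsupp.single p.2 1 - Finsupp.single (p.1 * p.2) 1 + Finsupp.single p.1 1) := by
  simp [barD2]

@[simp]
theorem barD3_single (p : G × G × G) (n : ℤ) :
    barD3 G (Finsupp.single p n) =
      n • (Finsupp.single (p.2.1, p.2.2) 1 - Finsupp.single (p.1 * p.2.1, p.2.2) 1
        + Finsupp.single (p.1, p.2.1 * p.2.2) 1 - Finsupp.single (p.1, p.2.1) 1) := by
  simp [barD3]

/-- The additive extension of a function on generators to integral chains. -/
noncomputable def extendChains {α A : Type*} [AddCommGroup A] (s : α → A) : (α →₀ ℤ) →+ A :=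
  Finsupp.liftAddHom fun a => zmultiplesHom _ (s a)

@[simp]
theorem extendChains_single {α A : Type*} [AddCommGroup A] (s : α → A) (a : α) (n : ℤ) :
    extendChains s (Finsupp.single a n) = n • s a := by
  simp [extendChains]

/-- The map induced by a group homomorphism on bar 2-chains. -/
noncomputable def chainMap (f : G →* H) : (G × G →₀ ℤ) →+ (H × H →₀ ℤ) :=
  Finsupp.mapDomain.addMonoidHom (Prod.map f f)

@[simp]
theorem chainMap_single (f : G →* H) (p : G × G) (n : ℤ) :
    chainMap f (Finsupp.single p n) = Finsupp.single (f p.1, f p.2) n := by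
  simp [chainMap, Finsupp.mapDomain_single, Prod.map]

theorem barD2_chainMap (f : G →* H) (z : G × G →₀ ℤ) :
    barD2 H (chainMap f z) = Finsupp.mapDomain.addMonoidHom f (barD2 G z) := by
  suffices h : (barD2 H).comp (chainMap f) =
      (Finsupp.mapDomain.addMonoidHom f).comp (barD2 G) from DFunLike.congr_fun h z
  ext p
  simp [Finsupp.mapDomain_add, Finsupp.mapDomain_sub, Finsupp.mapDomain_single]

theorem chainMap_barD3 (f : G →* H) (z : G × G × G →₀ ℤ) :
    chainMap f (barD3 G z) =
      barD3 H (Finsupp.mapDomain.addMonoidHom (Prod.map f (Prod.map f f)) z) := by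
  suffices h : (chainMap f).comp (barD3 G) = (barD3 H).comp
      (Finsupp.mapDomain.addMonoidHom (Prod.map f (Prod.map f f))) from DFunLike.congr_fun h z
  ext p
  simp [Finsupp.mapDomain_single]

/-- The map induced by a group homomorphism on bar 2-cycles. -/
noncomputable def cycleMap (f : G →* H) : (barD2 G).ker →+ (barD2 H).ker :=
  ((chainMap f).comp (barD2 G).ker.subtype).codRestrict _ fun z => by
    have hz : barD2 G z = 0 := z.2
    simp [AddMonoidHom.mem_ker, barD2_chainMap, hz]

@[simp]
theorem coe_cycleMap (f : G →* H) (z : (barD2 G).ker) :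
    (cycleMap f z : H × H →₀ ℤ) = chainMap f z := rfl

/-- The map induced by a group homomorphism on second homology. -/
noncomputable def homologyMap (f : G →* H) : groupHomology2 G →+ groupHomology2 H :=
  QuotientAddGroup.map _ _ (cycleMap f) <| by
    rintro z ⟨w, hw⟩
    exact ⟨_, (chainMap_barD3 f w).symm.trans (congrArg (chainMap f) hw)⟩

@[simp]
theorem homologyMap_mk (f : G →* H) (z : (barD2 G).ker) :
    homologyMap f (QuotientAddGroup.mk z) = QuotientAddGroup.mk (cycleMap f z) := rfl

theorem homologyMap_id : homologyMap (MonoidHom.id G) = AddMonoidHom.id _ := by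
  ext z
  have h : cycleMap (MonoidHom.id G) z = z := by
    ext1
    suffices h : chainMap (MonoidHom.id G) = AddMonoidHom.id _ from DFunLike.congr_fun h _
    ext p : 2
    simp
  simp [h]

theorem homologyMap_comp (f : H →* K) (g : G →* H) :
    homologyMap (f.comp g) = (homologyMap f).comp (homologyMap g) := by
  ext z
  have h : cycleMap (f.comp g) z = cycleMap f (cycleMap g z) := by
    ext1
    suffices h : chainMap (f.comp g) = (chainMap f).comp (chainMap g) from
      DFunLike.congr_fun h _
    ext p : 2
    simp
  simp [h]

theorem homologyMap_one : homologyMap (1 : G →* H) = 0 := by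
  ext z
  have h : cycleMap (1 : G →* H) z = 0 := by
    ext1
    have key : chainMap (1 : G →* H) =
        (extendChains fun _ : G => Finsupp.single (1, 1) 1).comp (barD2 G) := by
      ext p : 2
      simp
    have hz : barD2 G z = 0 := z.2
    simp [key, hz]
  simp [h]

end Functoriality

section Cocycle

variable {G : Type*} [Group G]

variable (G) in
/-- The bar 2-chains modulo boundaries. -/
abbrev ChainsModBoundaries := (G × G →₀ ℤ) ⧸ (barD3 G).range

/-- The universal 2-cocycle: the class of `[g|h]` modulo boundaries. -/
noncomputable def universalCocycle (g h : G) : ChainsModBoundaries G :=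
  QuotientAddGroup.mk (Finsupp.single (g, h) 1)

theorem universalCocycle_cocycle (g h k : G) :
    universalCocycle h k - universalCocycle (g * h) k + universalCocycle g (h * k)
      - universalCocycle g h = 0 :=
  (QuotientAddGroup.eq_zero_iff _).2 ⟨Finsupp.single (g, h, k) 1, by simp⟩

end Cocycle

section Product

variable {G H : Type*} [Group G] [Group H]

/-- For fixed `h`, the commutator pairing `g ↦ c(h, g) - c(g, h)` is a homomorphism in `g`. -/
noncomputable def commutatorPairing (h : H) :
    G →* Multiplicative (ChainsModBoundaries (G × H)) :=
  MonoidHom.mk' (fun g => Multiplicative.ofAdd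
    (universalCocycle (1, h) (g, 1) - universalCocycle (g, 1) (1, h))) fun g g' => by
    rw [← ofAdd_add]
    congr 1
    have h₁ := universalCocycle_cocycle ((1, h) : G × H) (g, 1) (g', 1)
    have h₂ := universalCocycle_cocycle ((g, 1) : G × H) (g', 1) (1, h)
    have h₃ := universalCocycle_cocycle ((g, 1) : G × H) (1, h) (g', 1)
    simp only [Prod.mk_mul_mk, mul_one, one_mul] at h₁ h₂ h₃
    linear_combination (norm := abel) h₁ + h₂ - h₃

theorem universalCocycle_comm (hG : commutator G = ⊤) (g : G) (h : H) :
    universalCocycle ((1, h) : G × H) (g, 1) = universalCocycle (g, 1) (1, h) := by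
  have hg : g ∈ (commutatorPairing (G := G) h).ker :=
    Abelianization.commutator_subset_ker _ (hG ▸ Subgroup.mem_top g)
  exact sub_eq_zero.1 (congrArg Multiplicative.toAdd (MonoidHom.mem_ker.1 hg))

theorem universalCocycle_prod (hG : commutator G = ⊤) (g g' : G) (h h' : H) :
    universalCocycle ((g, 1) : G × H) (g', 1) + universalCocycle (1, h) (1, h') =
      universalCocycle (g, h) (g', h') +
        (universalCocycle (g', 1) (1, h') - universalCocycle (g * g', 1) (1, h * h')
          + universalCocycle (g, 1) (1, h)) := by
  have h₁ := universalCocycle_cocycle ((g, 1) : G × H) (1, h) (g', h')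
  have h₂ := universalCocycle_cocycle ((1, h) : G × H) (g', 1) (1, h')
  have h₃ := universalCocycle_cocycle ((g', 1) : G × H) (1, h) (1, h')
  have h₄ := universalCocycle_cocycle ((g, 1) : G × H) (g', 1) (1, h * h')
  have h₅ := universalCocycle_comm hG g' h
  simp only [Prod.mk_mul_mk, mul_one, one_mul] at h₁ h₂ h₃ h₄
  linear_combination (norm := abel) h₁ - h₂ + h₃ - h₄ - h₅

theorem homologyMap_inl_fst_add_inr_snd (hG : commutator G = ⊤) :
    homologyMap ((MonoidHom.inl G H).comp (MonoidHom.fst G H)) +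
      homologyMap ((MonoidHom.inr G H).comp (MonoidHom.snd G H)) =
        AddMonoidHom.id (groupHomology2 (G × H)) := by
  ext z
  have key : (QuotientAddGroup.mk' (barD3 (G × H)).range).comp
      (chainMap ((MonoidHom.inl G H).comp (MonoidHom.fst G H)) +
        chainMap ((MonoidHom.inr G H).comp (MonoidHom.snd G H))) =
      QuotientAddGroup.mk' (barD3 (G × H)).range +
        (extendChains fun p : G × H => universalCocycle ((p.1, 1) : G × H) (1, p.2)).comp
          (barD2 (G × H)) := by
    ext ⟨⟨g, h⟩, g', h'⟩
    simpa [universalCocycle] using universalCocycle_prod hG g g' h h'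
  have hz : barD2 (G × H) z = 0 := z.2
  have hkey := DFunLike.congr_fun key (z : (G × H) × (G × H) →₀ ℤ)
  simp only [AddMonoidHom.comp_apply, AddMonoidHom.add_apply, hz, map_zero, add_zero] at hkey
  have hmem := QuotientAddGroup.eq.1 hkey
  exact QuotientAddGroup.eq.2 hmem

end Product

end BarComplex

open BarComplex in
/-- For perfect groups `G` and `H` the Schur multiplier is additive:
`H₂(G × H, ℤ) ≅ H₂(G, ℤ) × H₂(H, ℤ)`. -/
theorem schurMultiplier_prod (G H : Type) [Group G] [Group H]
    (hG : commutator G = ⊤) (hH : commutator H = ⊤) :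
    Nonempty (groupHomology2 (G × H) ≃+ groupHomology2 G × groupHomology2 H) := by
  refine ⟨AddMonoidHom.toAddEquiv
    ((homologyMap (MonoidHom.fst G H)).prod (homologyMap (MonoidHom.snd G H)))
    ((homologyMap (MonoidHom.inl G H)).coprod (homologyMap (MonoidHom.inr G H))) ?_ ?_⟩
  · rw [← homologyMap_inl_fst_add_inr_snd hG, homologyMap_comp, homologyMap_comp]
    rfl
  · have h₁ (x) : homologyMap (MonoidHom.fst G H) (homologyMap (MonoidHom.inl G H) x) = x := by
      rw [← AddMonoidHom.comp_apply, ← homologyMap_comp, MonoidHom.fst_comp_inl, homologyMap_id,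
        AddMonoidHom.id_apply]
    have h₂ (x) : homologyMap (MonoidHom.snd G H) (homologyMap (MonoidHom.inr G H) x) = x := by
      rw [← AddMonoidHom.comp_apply, ← homologyMap_comp, MonoidHom.snd_comp_inr, homologyMap_id,
        AddMonoidHom.id_apply]
    have h₃ (x) : homologyMap (MonoidHom.fst G H) (homologyMap (MonoidHom.inr G H) x) = 0 := by
      rw [← AddMonoidHom.comp_apply, ← homologyMap_comp, MonoidHom.fst_comp_inr, homologyMap_one,
        AddMonoidHom.zero_apply]
    have h₄ (x) : homologyMap (MonoidHom.snd G H) (homologyMap (MonoidHom.inl G H) x) = 0 := by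
      rw [← AddMonoidHom.comp_apply, ← homologyMap_comp, MonoidHom.snd_comp_inl, homologyMap_one,
        AddMonoidHom.zero_apply]
    refine AddMonoidHom.ext fun ⟨x, y⟩ => Prod.ext ?_ ?_
    · simp only [AddMonoidHom.comp_apply, AddMonoidHom.coprod_apply, AddMonoidHom.prod_apply,
        Prod.fst_add, map_add, h₁, h₃, add_zero, AddMonoidHom.id_apply]
    · simp only [AddMonoidHom.comp_apply, AddMonoidHom.coprod_apply, AddMonoidHom.prod_apply,
        Prod.snd_add, map_add, h₂, h₄, zero_add, AddMonoidHom.id_apply]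
end

section
/- For every integer g ≥ 3, every odd integer N ≥ 1, and every odd prime l, the l-torsion of H³(Sp_{2g}(ℤ/Nℤ), ℤ) vanishes: every element x of H³(Sp_{2g}(ℤ/Nℤ), ℤ) (with trivial coefficients ℤ) satisfying l·x = 0 is zero. -/
open Matrix

/-- The paper's standard symplectic form matrix `J = [[0, 1_g], [-1_g, 0]]`. -/
def paperJ (l R : Type*) [DecidableEq l] [CommRing R] : Matrix (l ⊕ l) (l ⊕ l) R :=
  Matrix.fromBlocks 0 1 (-1) 0

/-- The paper's symplectic condition `ᵀM·J·M = J` (with `J = [[0, 1_g], [-1_g, 0]]`)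
characterizes membership in Mathlib's `Matrix.symplecticGroup`; hence the latter *is* the
symplectic group `Sp_{2g}(R)` of the paper. -/
theorem mem_symplecticGroup_iff_paper {l R : Type*} [DecidableEq l] [Fintype l] [CommRing R]
    (M : Matrix (l ⊕ l) (l ⊕ l) R) :
    M ∈ Matrix.symplecticGroup l R ↔ Mᵀ * paperJ l R * M = paperJ l R := by
  have hJ : paperJ l R = -(Matrix.J l R) := by
    rw [paperJ, Matrix.J, Matrix.fromBlocks_neg]; norm_num
  rw [SymplecticGroup.mem_iff', hJ]
  constructor
  · intro h; rw [Matrix.mul_neg, Matrix.neg_mul, h]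
  · intro h
    have := congrArg Neg.neg h
    simpa [Matrix.mul_neg, Matrix.neg_mul] using this

set_option linter.unusedSectionVars false

/-!
The proof shows that every central extension of `Sp_{2g}(ℤ/Nℤ)` by a group of odd exponent splits.
For `N` a prime power, root elements are lifted using the involutions which invert them, and their
lifts are shown to generate a complement of the kernel by means of a big cell decomposition.
The Chinese remainder theorem gives general odd `N`, and a Bockstein argument gives the statement
on `H³`.
-/

/-- A central extension `π : E → G` whose kernel has odd exponent dividing `l`. -/
structure IsOddCentralExt {E G : Type*} [Group E] [Group G] (l : ℕ) (π : E →* G) : Prop where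
  surj : Function.Surjective π
  odd : Odd l
  comm : ∀ a ∈ π.ker, ∀ x, a * x = x * a
  pow : ∀ a ∈ π.ker, a ^ l = 1

lemma MonoidHom.exists_mem_ker_eq_mul {E G : Type*} [Group E] [Group G] (π : E →* G) {x y : E}
    (hxy : π x = π y) : ∃ a ∈ π.ker, x = a * y :=
  ⟨x * y⁻¹, by simp [MonoidHom.mem_ker, hxy], by simp⟩

namespace IsOddCentralExt

variable {E G : Type*} [Group E] [Group G] {l : ℕ} {π : E →* G}

/-- The conjugation action of the quotient on a central extension. -/
noncomputable def cj (h : IsOddCentralExt l π) : G →* MulAut E :=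
  π.liftOfSurjective h.surj ⟨MulAut.conj, fun a ha => by
    rw [MonoidHom.mem_ker]
    ext x
    simp [MulAut.conj_apply, h.comm a ha x]⟩

variable (h : IsOddCentralExt l π)

lemma cj_map (x y : E) : h.cj (π x) y = x * y * x⁻¹ := by
  have : h.cj (π x) = MulAut.conj x :=
    MonoidHom.liftOfRightInverse_comp_apply _ _ _ _ x
  rw [this, MulAut.conj_apply]

lemma map_cj (g : G) (x : E) : π (h.cj g x) = g * π x * g⁻¹ := by
  obtain ⟨y, rfl⟩ := h.surj g
  simp [cj_map]

lemma cj_mul (g k : G) (x : E) : h.cj (g * k) x = h.cj g (h.cj k x) := by simp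

lemma cj_of_mem_ker (g : G) {a : E} (ha : a ∈ π.ker) : h.cj g a = a := by
  obtain ⟨y, rfl⟩ := h.surj g
  rw [cj_map, ← h.comm a ha, mul_inv_cancel_right]

lemma eq_one_of_sq (h : IsOddCentralExt l π) {a : E} (ha : a ∈ π.ker) (h2 : a * a = 1) :
    a = 1 := by
  obtain ⟨k, hk⟩ := h.odd
  have := h.pow a ha
  rw [hk, pow_add, pow_mul, pow_two, h2, one_pow, one_mul, pow_one] at this
  exact this

/-- A lift of `g` which is inverted by `d` is unique. -/
lemma eq_of_inverted {d : G} {x y : E} (hxy : π x = π y) (hx : h.cj d x = x⁻¹)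
    (hy : h.cj d y = y⁻¹) : x = y := by
  obtain ⟨a, ha, rfl⟩ := π.exists_mem_ker_eq_mul hxy
  rw [map_mul, h.cj_of_mem_ker _ ha, hy, h.comm a ha, _root_.mul_inv_rev, mul_right_inj] at hx
  rw [h.eq_one_of_sq ha (by nth_rewrite 1 [hx]; simp), one_mul]

/-- If `d` inverts `g`, then `g` has a lift inverted by `d`. -/
lemma exists_inverted {d g : G} (hd : d * g * d⁻¹ = g⁻¹) : ∃ x, π x = g ∧ h.cj d x = x⁻¹ := by
  obtain ⟨y, rfl⟩ := h.surj g
  obtain ⟨a, ha, hay⟩ := π.exists_mem_ker_eq_mul (x := h.cj d y) (y := y⁻¹)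
    (by rw [map_cj, hd, map_inv])
  obtain ⟨k, hk⟩ := h.odd
  have hk' : a ^ k * a = (a ^ k)⁻¹ := by
    rw [eq_inv_iff_mul_eq_one, ← h.pow a ha, hk, ← pow_succ, ← pow_add]
    congr 1
    ring
  refine ⟨a ^ k * y, ?_, ?_⟩
  · rw [map_mul, MonoidHom.mem_ker.1 (pow_mem ha k), one_mul]
  · rw [map_mul, hay, h.cj_of_mem_ker _ (pow_mem ha k), ← mul_assoc, hk', _root_.mul_inv_rev,
      h.comm _ (inv_mem (pow_mem ha k))]

/-- If the images of two elements commute, the commutator is detected by the conjugation action. -/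
lemma cj_eq_self_of_inverted {d g : G} {x : E} (hx : h.cj d x = x⁻¹) (hg : g * π x = π x * g)
    (hd : d * g = g * d) : h.cj g x = x := by
  refine h.eq_of_inverted (d := d) ?_ ?_ hx
  · rw [map_cj, hg, mul_inv_cancel_right]
  · rw [← h.cj_mul, hd, h.cj_mul, hx, map_inv]

end IsOddCentralExt

namespace SpLift

section Symplectic

variable {ι R : Type*} [Fintype ι] [DecidableEq ι] [CommRing R]

/-- The standard symplectic form. -/
def om (u v : ι ⊕ ι → R) : R := u ⬝ᵥ (J ι R *ᵥ v)

/-- The action of a symplectic matrix on column vectors. -/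
def act (g : symplecticGroup ι R) (v : ι ⊕ ι → R) : ι ⊕ ι → R := (g : Matrix _ _ R) *ᵥ v

/-- The standard basis vectors. -/
def e (c : ι ⊕ ι) : ι ⊕ ι → R := Pi.single c 1

/-- The sign `ω(e_{c̄}, e_c)`. -/
def ep (c : ι ⊕ ι) : R := Sum.elim (fun _ => 1) (fun _ => -1) c

@[simp] lemma ep_inl (i : ι) : ep (Sum.inl i) = (1 : R) := rfl
@[simp] lemma ep_inr (i : ι) : ep (Sum.inr i) = (-1 : R) := rfl

lemma ep_mul_self (c : ι ⊕ ι) : ep c * ep c = (1 : R) := by cases c <;> simp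
lemma ep_swap (c : ι ⊕ ι) : ep c.swap = -(ep c : R) := by cases c <;> simp

lemma om_eq (u v : ι ⊕ ι → R) :
    om u v = ∑ i, (u (Sum.inr i) * v (Sum.inl i) - u (Sum.inl i) * v (Sum.inr i)) := by
  simp [om, J, dotProduct, Matrix.mulVec, Fintype.sum_sum_type, fromBlocks, Matrix.one_apply,
    Finset.sum_sub_distrib]
  ring

lemma om_add_left (u v w : ι ⊕ ι → R) : om (u + v) w = om u w + om v w := by
  simp [om, add_dotProduct]
lemma om_add_right (u v w : ι ⊕ ι → R) : om u (v + w) = om u v + om u w := by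
  simp [om, mulVec_add]
lemma om_smul_left (t : R) (u v : ι ⊕ ι → R) : om (t • u) v = t * om u v := by
  simp [om]
lemma om_smul_right (t : R) (u v : ι ⊕ ι → R) : om u (t • v) = t * om u v := by
  simp [om, mulVec_smul]
lemma om_antisymm (u v : ι ⊕ ι → R) : om u v = -om v u := by
  rw [om_eq, om_eq, ← Finset.sum_neg_distrib]
  exact Finset.sum_congr rfl fun i _ => by ring
lemma om_self (u : ι ⊕ ι → R) : om u u = 0 := by
  rw [om_eq]
  exact Finset.sum_eq_zero fun i _ => by ring

lemma om_e_right (x : ι ⊕ ι → R) (a : ι ⊕ ι) : om x (e a) = ep a * x a.swap := by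
  cases a <;> simp [om_eq, e, Pi.single_apply]

lemma e_apply (a c : ι ⊕ ι) : (e a : ι ⊕ ι → R) c = if c = a then 1 else 0 := by
  simp [e, Pi.single_apply]

lemma om_e_e (b a : ι ⊕ ι) : om (e b) (e a) = if b = a.swap then (ep a : R) else 0 := by
  rw [om_e_right, e_apply]
  by_cases hb : b = a.swap <;> simp [hb, eq_comm]

lemma act_mul (g k : symplecticGroup ι R) (v : ι ⊕ ι → R) : act (g * k) v = act g (act k v) := by
  simp [act, mulVec_mulVec]
@[simp] lemma act_one (v : ι ⊕ ι → R) : act (1 : symplecticGroup ι R) v = v := by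
  simp [act]
lemma act_add (g : symplecticGroup ι R) (u v : ι ⊕ ι → R) : act g (u + v) = act g u + act g v := by
  simp [act, mulVec_add]
lemma act_smul (g : symplecticGroup ι R) (t : R) (v : ι ⊕ ι → R) :
    act g (t • v) = t • act g v := by
  simp [act, mulVec_smul]

lemma om_act (g : symplecticGroup ι R) (u v : ι ⊕ ι → R) : om (act g u) (act g v) = om u v := by
  have := SymplecticGroup.mem_iff'.1 g.2
  rw [om, act, act, om, ← vecMul_transpose, ← dotProduct_mulVec, mulVec_mulVec, mulVec_mulVec, this]

lemma ext_act {g k : symplecticGroup ι R} (hgk : ∀ c, act g (e c) = act k (e c)) : g = k := by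
  apply Subtype.ext
  apply Matrix.ext_of_mulVec_single
  exact hgk

/-- The nilpotent matrix `x ↦ ω(x, u) v + ω(x, v) u`. -/
def nil (u v : ι ⊕ ι → R) : Matrix (ι ⊕ ι) (ι ⊕ ι) R :=
  vecMulVec v (J ι R *ᵥ u) + vecMulVec u (J ι R *ᵥ v)

lemma nil_mulVec (u v x : ι ⊕ ι → R) : nil u v *ᵥ x = om x u • v + om x v • u := by
  simp [nil, add_mulVec, vecMulVec_mulVec, om, dotProduct_comm]

lemma mem_symplecticGroup_iff_om (M : Matrix (ι ⊕ ι) (ι ⊕ ι) R) :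
    M ∈ symplecticGroup ι R ↔ ∀ u v, om (M *ᵥ u) (M *ᵥ v) = om u v := by
  rw [SymplecticGroup.mem_iff']
  have key (u v : ι ⊕ ι → R) : om (M *ᵥ u) (M *ᵥ v) = u ⬝ᵥ ((Mᵀ * J ι R * M) *ᵥ v) := by
    rw [om, ← vecMul_transpose, ← dotProduct_mulVec, mulVec_mulVec, mulVec_mulVec]
  refine ⟨fun hM u v => by rw [key, hM, om], fun hM => ?_⟩
  ext i j
  have hij := hM (Pi.single i 1) (Pi.single j 1)
  rw [key] at hij
  simpa [om] using hij

/-- The transvection-like element `x ↦ x + ω(x, u) v + ω(x, v) u`, for `ω(u, v) = 0`. -/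
noncomputable def tau (u v : ι ⊕ ι → R) : symplecticGroup ι R :=
  open Classical in
  if huv : om u v = 0 then ⟨1 + nil u v, by
    rw [mem_symplecticGroup_iff_om]
    intro x y
    have hvu : om v u = 0 := by rw [om_antisymm, huv, neg_zero]
    simp only [add_mulVec, one_mulVec, nil_mulVec, om_add_left, om_add_right, om_smul_left,
      om_smul_right, om_self, huv, hvu]
    rw [om_antisymm v y, om_antisymm u y]
    ring⟩ else 1

lemma act_tau {u v : ι ⊕ ι → R} (huv : om u v = 0) (x : ι ⊕ ι → R) :
    act (tau u v) x = x + om x u • v + om x v • u := by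
  simp [tau, huv, act, add_mulVec, nil_mulVec, add_assoc]

lemma tau_symm (u v : ι ⊕ ι → R) : tau u v = tau v u := by
  by_cases huv : om u v = 0
  · have hvu : om v u = 0 := by rw [om_antisymm, huv, neg_zero]
    refine ext_act fun c => ?_
    rw [act_tau huv, act_tau hvu, add_right_comm]
  · have hvu : ¬ om v u = 0 := by rwa [om_antisymm, neg_eq_zero]
    simp [tau, huv, hvu]

lemma conj_tau (g : symplecticGroup ι R) (u v : ι ⊕ ι → R) :
    g * tau u v * g⁻¹ = tau (act g u) (act g v) := by
  rw [mul_inv_eq_iff_eq_mul]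
  by_cases huv : om u v = 0
  · have huv' : om (act g u) (act g v) = 0 := by rwa [om_act]
    refine ext_act fun c => ?_
    rw [act_mul, act_mul, act_tau huv, act_tau huv', act_add, act_add, act_smul, act_smul, om_act,
      om_act]
  · have huv' : ¬ om (act g u) (act g v) = 0 := by rwa [om_act]
    simp [tau, huv, huv']

lemma tau_mul_tau {u v w : ι ⊕ ι → R} (huv : om u v = 0) (huw : om u w = 0) (hvw : om v w = 0) :
    tau u v * tau u w = tau u (v + w) := by
  have huvw : om u (v + w) = 0 := by rw [om_add_right, huv, huw, add_zero]
  have hwv : om w v = 0 := by rw [om_antisymm, hvw, neg_zero]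
  have hwu : om w u = 0 := by rw [om_antisymm, huw, neg_zero]
  refine ext_act fun c => ?_
  rw [act_mul, act_tau huv, act_tau huw, act_tau huvw]
  simp only [om_add_left, om_add_right, om_smul_left, huv, hwu, hwv, om_self]
  ext i
  simp
  ring

lemma tau_smul_left (t : R) (u v : ι ⊕ ι → R) (huv : om u v = 0) :
    tau (t • u) v = tau u (t • v) := by
  refine ext_act fun c => ?_
  rw [act_tau (by simp [om_smul_left, huv]), act_tau (by simp [om_smul_right, huv])]
  simp only [om_smul_right, smul_smul]
  ext i
  simp
  ring

lemma tau_zero_left (v : ι ⊕ ι → R) : tau 0 v = 1 := by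
  have h0 (x : ι ⊕ ι → R) : om x 0 = 0 := by simp [om]
  have h1 (x : ι ⊕ ι → R) : om 0 x = 0 := by simp [om]
  refine ext_act fun c => ?_
  rw [act_tau (h1 v)]
  simp [h0]

end Symplectic

section Roots

variable {ι R : Type*} [Fintype ι] [DecidableEq ι] [CommRing R]

/-- The absolute value of an index. -/
def ix : ι ⊕ ι → ι := Sum.elim id id

@[simp, grind =] lemma ix_swap (a : ι ⊕ ι) : ix a.swap = ix a := by cases a <;> rfl
@[simp] lemma ix_inl (i : ι) : ix (Sum.inl i) = i := rfl
@[simp] lemma ix_inr (i : ι) : ix (Sum.inr i) = i := rfl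

lemma ix_eq_iff {a b : ι ⊕ ι} : ix a = ix b ↔ a = b ∨ a = b.swap := by
  cases a <;> cases b <;> simp

lemma ne_of_ix {a b : ι ⊕ ι} (hab : ix a ≠ ix b) : a ≠ b := fun hc => hab (by rw [hc])

lemma ne_swap_of_ix {a b : ι ⊕ ι} (hab : ix a ≠ ix b) : a ≠ b.swap :=
  fun hc => hab (by rw [hc, ix_swap])

@[grind .] lemma swap_ne (a : ι ⊕ ι) : a.swap ≠ a := by cases a <;> simp

attribute [grind =] Sum.swap_swap

lemma ne_swap_comm {a b : ι ⊕ ι} : a ≠ b.swap ↔ b ≠ a.swap := by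
  constructor <;> (rintro h1 rfl; exact h1 (by simp))

lemma eq_or_short {a b : ι ⊕ ι} (hab : b ≠ a.swap) : b = a ∨ ix a ≠ ix b := by
  by_contra! hc
  rcases ix_eq_iff.1 hc.2.symm with h1 | h1
  exacts [hc.1 h1, hab h1]

lemma om_e_zero {a b : ι ⊕ ι} (hab : b ≠ a.swap) : om (e a) (e b) = (0 : R) := by
  rw [om_e_e, if_neg (ne_swap_comm.1 hab)]

lemma om_swap_self (a : ι ⊕ ι) : om (e a.swap) (e a) = (ep a : R) := by
  rw [om_e_e, if_pos rfl]

/-- The root element attached to the root `{a, b}` with `b ≠ a.swap`. -/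
noncomputable def T (a b : ι ⊕ ι) (t : R) : symplecticGroup ι R := tau (t • e a) (e b)

lemma tau_smul_e (a b : ι ⊕ ι) (s t : R) (hab : b ≠ a.swap) :
    tau (s • e a) (t • e b) = T a b (s * t) := by
  rw [← tau_smul_left _ _ _ (by simp [om_smul_left, om_e_zero hab]), smul_smul, mul_comm, T]

lemma T_symm {a b : ι ⊕ ι} (hab : b ≠ a.swap) (t : R) : T a b t = T b a t := by
  rw [T, tau_smul_left _ _ _ (om_e_zero hab), tau_symm, T]

lemma T_zero (a b : ι ⊕ ι) : T a b (0 : R) = 1 := by rw [T, zero_smul, tau_zero_left]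

lemma T_add {a b : ι ⊕ ι} (hab : b ≠ a.swap) (s t : R) : T a b (s + t) = T a b s * T a b t := by
  have h2 := om_e_zero (R := R) (ne_swap_comm.1 hab)
  rw [T, T, T, tau_symm (s • _), tau_symm (t • _), tau_mul_tau, ← add_smul, tau_symm]
  all_goals simp [om_smul_left, om_smul_right, om_self, h2]

lemma T_neg {a b : ι ⊕ ι} (hab : b ≠ a.swap) (t : R) : T a b (-t) = (T a b t)⁻¹ := by
  rw [eq_inv_iff_mul_eq_one, ← T_add hab, neg_add_cancel, T_zero]

lemma act_T {a b : ι ⊕ ι} (hab : b ≠ a.swap) (t : R) (x : ι ⊕ ι → R) :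
    act (T a b t) x = x + (t * (ep a * x a.swap)) • e b + (t * (ep b * x b.swap)) • e a := by
  rw [T, act_tau (by simp [om_smul_left, om_e_zero hab]), om_smul_right, om_e_right, om_e_right,
    smul_smul, mul_comm t (ep b * _)]

lemma act_T_of_ne {a b c : ι ⊕ ι} (hab : b ≠ a.swap) (hca : c ≠ a.swap) (hcb : c ≠ b.swap)
    (t : R) : act (T a b t) (e c) = e c := by
  simp [act_T hab, e_apply, hca.symm, hcb.symm]

lemma act_T_swap {a b : ι ⊕ ι} (hab : ix a ≠ ix b) (t : R) :
    act (T a b t) (e b.swap) = e b.swap + (t * ep b) • e a := by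
  have h1 : a.swap ≠ b.swap := ne_of_ix (by simpa using hab)
  simp [act_T (ne_swap_of_ix hab.symm), e_apply, h1]

lemma act_T_swap' {a b : ι ⊕ ι} (hab : ix a ≠ ix b) (t : R) :
    act (T a b t) (e a.swap) = e a.swap + (t * ep a) • e b := by
  rw [T_symm (ne_swap_of_ix hab.symm), act_T_swap hab.symm]

lemma act_T_long (a : ι ⊕ ι) (t : R) :
    act (T a a t) (e a.swap) = e a.swap + (2 * t * ep a) • e a := by
  simp only [act_T (swap_ne a).symm, e_apply, if_true, mul_one, add_assoc, ← add_smul]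
  ring_nf

lemma conj_T (g : symplecticGroup ι R) (a b : ι ⊕ ι) (t : R) :
    g * T a b t * g⁻¹ = tau (t • act g (e a)) (act g (e b)) := by
  rw [T, conj_tau, act_smul]

/-- A monomial symplectic matrix. -/
structure Mono (g : symplecticGroup ι R) (η : ι ⊕ ι → R) (σ : ι ⊕ ι → ι ⊕ ι) : Prop where
  act_e : ∀ c, act g (e c) = η c • e (σ c)
  inj : ∀ c d, σ c = σ d → c = d
  swap : ∀ c, σ c.swap = (σ c).swap

lemma Mono.conj_T {g : symplecticGroup ι R} {η : ι ⊕ ι → R} {σ : ι ⊕ ι → ι ⊕ ι}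
    (hg : Mono g η σ) {a b : ι ⊕ ι} (hab : b ≠ a.swap) (t : R) :
    g * T a b t * g⁻¹ = T (σ a) (σ b) (η a * η b * t) := by
  rw [SpLift.conj_T, hg.act_e, hg.act_e, smul_smul, tau_smul_e]
  · ring_nf
  · rw [← hg.swap]
    exact fun hc => hab (hg.inj _ _ hc)

lemma Mono.ix_eq_iff {g : symplecticGroup ι R} {η : ι ⊕ ι → R} {σ : ι ⊕ ι → ι ⊕ ι}
    (hg : Mono g η σ) {a b : ι ⊕ ι} : ix (σ a) = ix (σ b) ↔ ix a = ix b := by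
  rw [SpLift.ix_eq_iff, SpLift.ix_eq_iff, ← hg.swap]
  constructor
  · rintro (hc | hc)
    exacts [.inl (hg.inj _ _ hc), .inr (hg.inj _ _ hc)]
  · rintro (rfl | rfl) <;> simp

lemma Mono.ep_mul {g : symplecticGroup ι R} {η : ι ⊕ ι → R} {σ : ι ⊕ ι → ι ⊕ ι}
    (hg : Mono g η σ) (a : ι ⊕ ι) : η a * η a.swap * ep (σ a) = ep a := by
  have := om_act g (e a.swap) (e a)
  rw [hg.act_e, hg.act_e, om_smul_left, om_smul_right, hg.swap, om_swap_self, om_swap_self] at this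
  rw [← this]
  ring

/-- The diagonal symplectic matrix with entries `z`. -/
noncomputable def dg (z : ι ⊕ ι → R) : symplecticGroup ι R :=
  open Classical in
  if hz : ∀ c, z c * z c.swap = 1 then ⟨diagonal z, by
    rw [mem_symplecticGroup_iff_om]
    intro x y
    rw [om_eq, om_eq]
    refine Finset.sum_congr rfl fun i _ => ?_
    have := hz (Sum.inl i)
    simp only [Sum.swap_inl] at this
    simp only [mulVec_diagonal]
    linear_combination
      (x (Sum.inr i) * y (Sum.inl i) - x (Sum.inl i) * y (Sum.inr i)) * this⟩ else 1

lemma act_dg {z : ι ⊕ ι → R} (hz : ∀ c, z c * z c.swap = 1) (c : ι ⊕ ι) :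
    act (dg z) (e c) = z c • e c := by
  ext d
  simp only [dg, dif_pos hz, act, mulVec_diagonal, e_apply, Pi.smul_apply, smul_eq_mul]
  by_cases hd : d = c <;> simp [hd]

lemma mono_dg {z : ι ⊕ ι → R} (hz : ∀ c, z c * z c.swap = 1) : Mono (dg z) z id :=
  ⟨act_dg hz, fun _ _ => id, fun _ => rfl⟩

lemma dg_mul {z y : ι ⊕ ι → R} (hz : ∀ c, z c * z c.swap = 1) (hy : ∀ c, y c * y c.swap = 1) :
    dg z * dg y = dg (z * y) := by
  refine ext_act fun c => ?_
  have hzy : ∀ c, (z * y) c * (z * y) c.swap = 1 := fun c => by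
    simp only [Pi.mul_apply]
    linear_combination hz c + z c * z c.swap * hy c
  rw [act_mul, act_dg hy, act_smul, act_dg hz, act_dg hzy, smul_smul, Pi.mul_apply, mul_comm]

/-- The diagonal entries of the involution which is `-1` on the `i`-th hyperbolic plane. -/
def dz (i : ι) (c : ι ⊕ ι) : R := if ix c = i then -1 else 1

lemma dz_mul (i : ι) (c : ι ⊕ ι) : dz i c * dz i c.swap = (1 : R) := by
  by_cases hc : ix c = i <;> simp [dz, hc]

/-- The involution which is `-1` on the `i`-th hyperbolic plane. -/
noncomputable def dd (i : ι) : symplecticGroup ι R := dg (dz i)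

lemma act_dd (i : ι) (c : ι ⊕ ι) : act (dd i) (e c : _ → R) = (dz i c : R) • e c :=
  act_dg (dz_mul i) c

lemma mono_dd (i : ι) : Mono (dd i : symplecticGroup ι R) (dz i) id := mono_dg (dz_mul i)

lemma Mono.mul_dd {g : symplecticGroup ι R} {η : ι ⊕ ι → R} {σ : ι ⊕ ι → ι ⊕ ι}
    (hg : Mono g η σ) (a : ι ⊕ ι) : dd (ix (σ a)) * g = g * dd (ix a) := by
  refine ext_act fun c => ?_
  rw [act_mul, act_mul, hg.act_e, act_smul, act_dd, act_dd, act_smul, hg.act_e, smul_smul,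
    smul_smul, mul_comm]
  simp only [dz, hg.ix_eq_iff]

lemma dd_comm (i j : ι) : (dd i * dd j : symplecticGroup ι R) = dd j * dd i :=
  (mono_dd j).mul_dd (Sum.inl i)

lemma dd_conj_T {a b : ι ⊕ ι} (hab : b ≠ a.swap) (i : ι) (t : R) :
    dd i * T a b t * (dd i)⁻¹ = T a b (dz i a * dz i b * t) := (mono_dd i).conj_T hab t

lemma dd_inv_T {a b : ι ⊕ ι} (hab : ix a ≠ ix b) (t : R) :
    dd (ix a) * T a b t * (dd (ix a))⁻¹ = (T a b t)⁻¹ := by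
  rw [dd_conj_T (ne_swap_of_ix hab.symm), ← T_neg (ne_swap_of_ix hab.symm)]
  simp [dz, hab.symm]

lemma dd_comm_T {a b : ι ⊕ ι} (hab : b ≠ a.swap) {i : ι} (ha : ix a ≠ i) (hb : ix b ≠ i) (t : R) :
    dd i * T a b t = T a b t * dd i := by
  rw [← mul_inv_eq_iff_eq_mul, dd_conj_T hab]
  simp [dz, ha, hb]

lemma T_comm {a b c d : ι ⊕ ι} (hab : b ≠ a.swap) (hca : c ≠ a.swap)
    (hcb : c ≠ b.swap) (hda : d ≠ a.swap) (hdb : d ≠ b.swap) (t u : R) :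
    T a b t * T c d u = T c d u * T a b t := by
  rw [← mul_inv_eq_iff_eq_mul, conj_T, act_T_of_ne hab hca hcb, act_T_of_ne hab hda hdb, T]

end Roots

/-- Rings whose elements are all natural numbers. -/
class IsCyclicRing (R : Type*) [CommRing R] : Prop where
  exists_natCast : ∀ t : R, ∃ n : ℕ, (n : R) = t

section Short

variable {ι R : Type*} [Fintype ι] [DecidableEq ι] [CommRing R] [IsCyclicRing R]
  {E : Type*} [Group E] {l : ℕ} {π : E →* symplecticGroup ι R} (h : IsOddCentralExt l π)

/-- The canonical lift of a short root element. -/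
noncomputable def S (a b : ι ⊕ ι) (t : R) : E :=
  open Classical in
  if hab : ix a ≠ ix b then (h.exists_inverted (dd_inv_T hab t)).choose else 1

lemma pi_S {a b : ι ⊕ ι} (hab : ix a ≠ ix b) (t : R) : π (S h a b t) = T a b t := by
  rw [S, dif_pos hab]
  exact (h.exists_inverted (dd_inv_T hab t)).choose_spec.1

lemma dd_S {a b : ι ⊕ ι} (hab : ix a ≠ ix b) (t : R) :
    h.cj (dd (ix a)) (S h a b t) = (S h a b t)⁻¹ := by
  rw [S, dif_pos hab]
  exact (h.exists_inverted (dd_inv_T hab t)).choose_spec.2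

lemma S_unique {a b : ι ⊕ ι} (hab : ix a ≠ ix b) {t : R} {x : E} (hx : π x = T a b t)
    (hd : h.cj (dd (ix a)) x = x⁻¹) : x = S h a b t :=
  h.eq_of_inverted (by rw [hx, pi_S h hab]) hd (dd_S h hab t)

lemma dd_S' {a b : ι ⊕ ι} (hab : ix a ≠ ix b) (t : R) :
    h.cj (dd (ix b)) (S h a b t) = (S h a b t)⁻¹ := by
  have h1 : h.cj (dd (ix a) * dd (ix b)) (S h a b t) = S h a b t := by
    refine h.cj_eq_self_of_inverted (dd_S h hab t) ?_ ?_
    · rw [pi_S h hab, ← mul_inv_eq_iff_eq_mul, _root_.mul_inv_rev,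
        show dd (ix a) * dd (ix b) * T a b t * ((dd (ix b))⁻¹ * (dd (ix a))⁻¹) =
          dd (ix a) * (dd (ix b) * T a b t * (dd (ix b))⁻¹) * (dd (ix a))⁻¹ by group,
        dd_conj_T (ne_swap_of_ix hab.symm), dd_conj_T (ne_swap_of_ix hab.symm)]
      simp [dz, hab, hab.symm]
    · rw [mul_assoc, ← dd_comm]
  rw [dd_comm, h.cj_mul, dd_S h hab, map_inv] at h1
  rw [← h1, inv_inv, h1]

lemma S_symm {a b : ι ⊕ ι} (hab : ix a ≠ ix b) (t : R) : S h a b t = S h b a t :=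
  S_unique h hab.symm (by rw [pi_S h hab, T_symm (ne_swap_of_ix hab.symm)]) (dd_S' h hab t)

/-- The canonical lifts are powers of the lift of the parameter `1`. -/
lemma S_natCast {a b : ι ⊕ ι} (hab : ix a ≠ ix b) (n : ℕ) :
    S h a b (n : R) = S h a b 1 ^ n := by
  symm
  refine S_unique h hab ?_ ?_
  · induction n with
    | zero => simp [T_zero]
    | succ n ih =>
      rw [pow_succ, map_mul, ih, pi_S h hab, ← T_add (ne_swap_of_ix hab.symm), Nat.cast_succ]
  · rw [map_pow, dd_S h hab, inv_pow]

lemma S_add {a b : ι ⊕ ι} (hab : ix a ≠ ix b) (s t : R) :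
    S h a b (s + t) = S h a b s * S h a b t := by
  obtain ⟨m, rfl⟩ := IsCyclicRing.exists_natCast s
  obtain ⟨n, rfl⟩ := IsCyclicRing.exists_natCast t
  rw [← Nat.cast_add, S_natCast h hab, S_natCast h hab, S_natCast h hab, pow_add]

lemma S_zero {a b : ι ⊕ ι} (hab : ix a ≠ ix b) : S h a b (0 : R) = 1 := by
  simpa using S_natCast h hab 0

lemma Mono.cj_S {g : symplecticGroup ι R} {η : ι ⊕ ι → R} {σ : ι ⊕ ι → ι ⊕ ι}
    (hg : Mono g η σ) {a b : ι ⊕ ι} (hab : ix a ≠ ix b) (t : R) :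
    h.cj g (S h a b t) = S h (σ a) (σ b) (η a * η b * t) := by
  refine S_unique h (by rwa [Ne, hg.ix_eq_iff]) ?_ ?_
  · rw [h.map_cj, pi_S h hab, hg.conj_T (ne_swap_of_ix hab.symm)]
  · rw [← h.cj_mul, hg.mul_dd, h.cj_mul, dd_S h hab, map_inv]

/-- Commutation of a root element with a short one when no root is a sum of them. -/
lemma T_comm_S {a b c d : ι ⊕ ι} (hab : b ≠ a.swap) (hcd : ix c ≠ ix d) (hca : c ≠ a.swap)
    (hcb : c ≠ b.swap) (hda : d ≠ a.swap) (hdb : d ≠ b.swap) (t u : R) :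
    h.cj (T a b t) (S h c d u) = S h c d u := by
  have hT : T a b t * π (S h c d u) = π (S h c d u) * T a b t := by
    rw [pi_S h hcd, T_comm hab hca hcb hda hdb]
  by_cases hc : ix a ≠ ix c ∧ ix b ≠ ix c
  · exact h.cj_eq_self_of_inverted (dd_S h hcd u) hT (dd_comm_T hab hc.1 hc.2 t)
  by_cases hd : ix a ≠ ix d ∧ ix b ≠ ix d
  · exact h.cj_eq_self_of_inverted (dd_S' h hcd u) hT (dd_comm_T hab hd.1 hd.2 t)
  have hab' : ix a ≠ ix b := by grind
  have key : S h a b t * S h a b u * (S h a b t)⁻¹ = S h a b u := by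
    rw [mul_inv_eq_iff_eq_mul, ← S_add h hab', ← S_add h hab', add_comm]
  have : (c = a ∧ d = b) ∨ (c = b ∧ d = a) := by
    have := @ix_eq_iff ι _ _ c a
    have := @ix_eq_iff ι _ _ c b
    have := @ix_eq_iff ι _ _ d a
    have := @ix_eq_iff ι _ _ d b
    grind
  rw [← pi_S h hab', h.cj_map]
  rcases this with ⟨rfl, rfl⟩ | ⟨rfl, rfl⟩
  · exact key
  · rwa [S_symm h hcd]

lemma S_comm {a b c d : ι ⊕ ι} (hab : ix a ≠ ix b) (hcd : ix c ≠ ix d) (hca : c ≠ a.swap)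
    (hcb : c ≠ b.swap) (hda : d ≠ a.swap) (hdb : d ≠ b.swap) (t u : R) :
    S h a b t * S h c d u = S h c d u * S h a b t := by
  rw [← mul_inv_eq_iff_eq_mul, ← h.cj_map, pi_S h hab,
    T_comm_S h (ne_swap_of_ix hab.symm) hcd hca hcb hda hdb]

lemma S_sss {a b c : ι ⊕ ι} (hab : ix a ≠ ix b) (hac : ix a ≠ ix c) (hbc : ix b ≠ ix c)
    (t u : R) :
    h.cj (T a b t) (S h b.swap c u) = S h b.swap c u * S h a c (t * u * ep b) := by
  have hbc' : ix b.swap ≠ ix c := by rwa [ix_swap]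
  refine h.eq_of_inverted (d := dd (ix c)) ?_ ?_ ?_
  · rw [h.map_cj, map_mul, pi_S h hbc', pi_S h hac, conj_T, act_T_swap hab,
      act_T_of_ne (by grind) (by grind) (by grind), smul_add, smul_smul, T, T, tau_symm (u • _),
      tau_symm (_ • e a), tau_mul_tau, tau_symm]
    · ring_nf
    all_goals simp only [om_smul_right, om_smul_left]
    all_goals rw [om_e_zero (by grind)]; simp
  · rw [← h.cj_mul, dd_comm_T (ne_swap_of_ix hab.symm) hac hbc, h.cj_mul, dd_S' h hbc', map_inv]
  · rw [map_mul, dd_S' h hbc', dd_S' h hac, S_comm h hbc' hac (by grind) (by grind) (by grind)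
      (by grind), _root_.mul_inv_rev]

end Short

section Long

variable {ι R : Type*} [Fintype ι] [DecidableEq ι] [CommRing R] [IsCyclicRing R]
  {E : Type*} [Group E] {l : ℕ} {π : E →* symplecticGroup ι R} (h : IsOddCentralExt l π)

/-- The commutator of two short root elements whose roots sum to a long root. -/
noncomputable def lam (a b : ι ⊕ ι) (t u : R) : E :=
  h.cj (T a b t) (S h a b.swap u) * (S h a b.swap u)⁻¹

lemma cj_T_S_swap (a b : ι ⊕ ι) (t u : R) :
    h.cj (T a b t) (S h a b.swap u) = lam h a b t u * S h a b.swap u := by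
  rw [lam, inv_mul_cancel_right]

variable {a b : ι ⊕ ι} (hab : ix a ≠ ix b)

lemma pi_lam (hab : ix a ≠ ix b) (t u : R) : π (lam h a b t u) = T a a (t * u * ep b) := by
  rw [lam, map_mul, map_inv, h.map_cj, pi_S h (by simpa using hab), conj_T, act_T_swap hab,
    act_T_of_ne (by grind) (by grind) (by grind), mul_inv_eq_iff_eq_mul, T, T,
    tau_smul_left _ _ _ (om_self _), tau_smul_left _ (e a) (e b.swap) (om_e_zero (by grind)),
    tau_mul_tau, tau_smul_left, smul_add, add_comm, smul_smul]
  · ring_nf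
  · rw [om_add_right, om_smul_right, om_self, om_e_zero (by grind), mul_zero, add_zero]
  all_goals simp only [om_smul_right, om_smul_left]
  all_goals rw [om_e_zero (by grind)]; simp

lemma lam_comm_S (hab : ix a ≠ ix b) {c d : ι ⊕ ι} (hcd : ix c ≠ ix d) (hca : c ≠ a.swap)
    (hda : d ≠ a.swap) (t u v : R) : lam h a b t u * S h c d v = S h c d v * lam h a b t u := by
  rw [← mul_inv_eq_iff_eq_mul, ← h.cj_map, pi_lam h hab,
    T_comm_S h (by grind) hcd hca hca hda hda]

lemma T_lam_comm (hab : ix a ≠ ix b) {c d : ι ⊕ ι} (hcd : ix c ≠ ix d) (hca : c ≠ a.swap)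
    (hda : d ≠ a.swap) (t u v : R) : h.cj (T c d v) (lam h a b t u) = lam h a b t u := by
  rw [← pi_S h hcd, h.cj_map, ← lam_comm_S h hab hcd hca hda, mul_inv_cancel_right]

lemma lam_add_right (hab : ix a ≠ ix b) (t u v : R) :
    lam h a b t (u + v) = lam h a b t u * lam h a b t v := by
  have hab' : ix a ≠ ix b.swap := by simpa using hab
  have h1 := cj_T_S_swap h a b t (u + v)
  rw [S_add h hab', map_mul, cj_T_S_swap, cj_T_S_swap,
    show lam h a b t u * S h a b.swap u * (lam h a b t v * S h a b.swap v) =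
      lam h a b t u * (S h a b.swap u * lam h a b t v) * S h a b.swap v by group,
    ← lam_comm_S h hab hab' (by grind) (by grind), ← mul_assoc, ← mul_assoc, mul_left_inj,
    mul_left_inj] at h1
  exact h1.symm

lemma lam_add_left (hab : ix a ≠ ix b) (s t u : R) :
    lam h a b (s + t) u = lam h a b t u * lam h a b s u := by
  have h1 := cj_T_S_swap h a b (s + t) u
  rw [T_add (by grind), h.cj_mul, cj_T_S_swap, map_mul, cj_T_S_swap, ← mul_assoc, mul_left_inj,
    T_lam_comm h hab hab (by grind) (by grind)] at h1
  exact h1.symm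

lemma lam_zero_left (a b : ι ⊕ ι) (u : R) : lam h a b 0 u = 1 := by
  simp [lam, T_zero]

lemma lam_zero_right (hab : ix a ≠ ix b) (t : R) : lam h a b t 0 = 1 := by
  rw [lam, S_zero h (by simpa using hab)]; simp

lemma lam_natCast (hab : ix a ≠ ix b) (n : ℕ) (u : R) : lam h a b n u = lam h a b 1 (n * u) := by
  induction n with
  | zero => simp [lam_zero_left, lam_zero_right h hab]
  | succ n ih =>
    rw [Nat.cast_succ, lam_add_left h hab, ih, add_mul, add_comm, lam_add_right h hab, one_mul]

lemma lam_eq (hab : ix a ≠ ix b) (t u : R) : lam h a b t u = lam h a b 1 (t * u) := by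
  obtain ⟨n, rfl⟩ := IsCyclicRing.exists_natCast t
  exact lam_natCast h hab n u

lemma lam_indep_aux (hab : ix a ≠ ix b) {c : ι ⊕ ι} (hac : ix a ≠ ix c) (hbc : ix b ≠ ix c)
    (s : R) : lam h a b 1 (ep b * s) = lam h a c 1 (ep c * s) := by
  have hac' : ix a ≠ ix c.swap := by simpa using hac
  have hab' : ix a ≠ ix b.swap := by simpa using hab
  have hbc' : ix b.swap ≠ ix c := by simpa using hbc
  have key (u : R) : lam h a c (-ep b) u * lam h a b 1 (ep c * u) = 1 := by
    have h1 : h.cj (T a b 1) (S h a c.swap u) = S h a c.swap u :=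
      T_comm_S h (by grind) hac' (by grind) (by grind) (by grind) (by grind) _ _
    have h2 : h.cj (T b.swap c 1) (S h a c.swap u) = S h a c.swap u * S h a b.swap (ep c * u) := by
      rw [S_symm h hac', S_sss h hbc' (by grind) (by grind), S_symm h (by grind), ← S_symm h hab']
      ring_nf
    have h3 : T b.swap c (1 : R) * T a b 1 * (T b.swap c 1)⁻¹ = T a b 1 * T a c (-ep b) := by
      have := act_T_swap' (R := R) hbc' 1
      rw [Sum.swap_swap] at this
      rw [conj_T, this, act_T_of_ne (by grind) (by grind) (by grind), one_smul, T, T, one_smul,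
        tau_smul_left _ _ _ (om_e_zero (by grind)), tau_mul_tau, ep_swap, one_mul]
      · exact om_e_zero (by grind)
      all_goals rw [om_smul_right, om_e_zero (by grind), mul_zero]
    have h4 := congrArg (h.cj (T b.swap c 1)) h1
    rw [← h.cj_mul, mul_inv_eq_iff_eq_mul.1 h3, h.cj_mul, h2, h.cj_mul, map_mul,
      cj_T_S_swap, T_comm_S h (by grind) hab' (by grind) (by grind) (by grind) (by grind),
      map_mul, map_mul, cj_T_S_swap, T_comm_S h (by grind) hac' (by grind) (by grind) (by grind)
        (by grind), T_lam_comm h hac hab (by grind) (by grind)] at h4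
    rw [← mul_assoc, mul_left_inj, mul_assoc, ← lam_comm_S h hab hac' (by grind) (by grind),
      ← mul_assoc, mul_eq_right] at h4
    exact h4
  have h5 := key (ep b * ep c * s)
  have h6 : lam h a c (-ep b) (ep b * ep c * s) * lam h a c 1 (ep c * s) = 1 := by
    rw [lam_eq h hac (-ep b), ← lam_add_right h hac, ← lam_zero_right h hac 1]
    congr 1
    linear_combination (-(ep c * s)) * ep_mul_self (R := R) b
  rw [← h6, mul_right_inj] at h5
  rw [← h5]
  congr 1
  linear_combination (-(ep b * s)) * ep_mul_self (R := R) c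

variable [Fact (2 < Fintype.card ι)]

lemma exists_third (a b : ι ⊕ ι) : ∃ c : ι ⊕ ι, ix a ≠ ix c ∧ ix b ≠ ix c := by
  have h2 : ({ix a, ix b} : Finset ι).card < Fintype.card ι :=
    (Finset.card_le_two).trans_lt Fact.out
  obtain ⟨k, hk⟩ := Finset.exists_mem_notMem_of_card_lt_card
    (s := ({ix a, ix b} : Finset ι)) (t := Finset.univ) (by simpa using h2)
  refine ⟨Sum.inl k, ?_⟩
  simp at hk ⊢
  tauto

lemma lam_indep (hab : ix a ≠ ix b) {c : ι ⊕ ι} (hac : ix a ≠ ix c) (s : R) :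
    lam h a b 1 (ep b * s) = lam h a c 1 (ep c * s) := by
  by_cases hbc : ix b = ix c
  · obtain ⟨d, hd⟩ := exists_third a b
    rw [lam_indep_aux h hab hd.1 hd.2, ← lam_indep_aux h hac hd.1 (hbc ▸ hd.2)]
  · exact lam_indep_aux h hab hac hbc s

/-- The canonical lift of a root element. -/
noncomputable def X (a b : ι ⊕ ι) (t : R) : E :=
  open Classical in
  if ix a ≠ ix b then S h a b t else
    lam h a (exists_third a a).choose 1 (ep (exists_third a a).choose * t)

lemma X_short {a b : ι ⊕ ι} (hab : ix a ≠ ix b) (t : R) : X h a b t = S h a b t := if_pos hab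

lemma X_long {a b : ι ⊕ ι} (hab : ix a ≠ ix b) (t : R) : X h a a t = lam h a b 1 (ep b * t) := by
  rw [X, if_neg (by simp)]
  exact lam_indep h (exists_third a a).choose_spec.1 hab t

lemma lam_eq_X {a b : ι ⊕ ι} (hab : ix a ≠ ix b) (t u : R) :
    lam h a b t u = X h a a (ep b * t * u) := by
  rw [lam_eq h hab, X_long h hab]
  congr 1
  linear_combination (-(t * u)) * ep_mul_self (R := R) b

lemma pi_X {a b : ι ⊕ ι} (hab : b ≠ a.swap) (t : R) : π (X h a b t) = T a b t := by
  rcases eq_or_short hab with rfl | hab'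
  · obtain ⟨c, hc, -⟩ := exists_third b b
    rw [X_long h hc, pi_lam h hc]
    congr 1
    linear_combination t * ep_mul_self (R := R) c
  · rw [X_short h hab', pi_S h hab']

lemma X_symm {a b : ι ⊕ ι} (hab : b ≠ a.swap) (t : R) : X h a b t = X h b a t := by
  rcases eq_or_short hab with rfl | hab'
  · rfl
  · rw [X_short h hab', X_short h hab'.symm, S_symm h hab']

lemma X_add {a b : ι ⊕ ι} (hab : b ≠ a.swap) (s t : R) :
    X h a b (s + t) = X h a b s * X h a b t := by
  rcases eq_or_short hab with rfl | hab'
  · obtain ⟨c, hc, -⟩ := exists_third b b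
    rw [X_long h hc, X_long h hc, X_long h hc, mul_add, lam_add_right h hc]
  · rw [X_short h hab', X_short h hab', X_short h hab', S_add h hab']

lemma X_zero {a b : ι ⊕ ι} (hab : b ≠ a.swap) : X h a b (0 : R) = 1 := by
  simpa using X_add h hab 0 0

lemma X_neg {a b : ι ⊕ ι} (hab : b ≠ a.swap) (t : R) : X h a b (-t) = (X h a b t)⁻¹ := by
  rw [eq_inv_iff_mul_eq_one, ← X_add h hab, neg_add_cancel, X_zero h hab]

lemma Mono.cj_X {g : symplecticGroup ι R} {η : ι ⊕ ι → R} {σ : ι ⊕ ι → ι ⊕ ι}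
    (hg : Mono g η σ) {a b : ι ⊕ ι} (hab : b ≠ a.swap) (t : R) :
    h.cj g (X h a b t) = X h (σ a) (σ b) (η a * η b * t) := by
  rcases eq_or_short hab with rfl | hab'
  · obtain ⟨c, hc, -⟩ := exists_third b b
    have hσ : ix (σ b) ≠ ix (σ c) := by rwa [Ne, hg.ix_eq_iff]
    have hc' : ix b ≠ ix c.swap := by simpa using hc
    rw [X_long h hc, lam, map_mul, map_inv, ← h.cj_mul, ← inv_mul_cancel_right (g * T b c 1) g,
      h.cj_mul, hg.conj_T (by grind), hg.cj_S h hc', hg.swap, cj_T_S_swap, mul_inv_cancel_right,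
      lam_eq_X h hσ]
    congr 1
    have h1 := hg.ep_mul c
    have h2 := ep_mul_self (R := R) c
    linear_combination (η b * η b * t * ep c) * h1 + η b * η b * t * h2
  · rw [X_short h hab', hg.cj_S h hab', X_short h (by rwa [Ne, hg.ix_eq_iff])]

end Long

section Relations

variable {ι R : Type*} [Fintype ι] [DecidableEq ι] [CommRing R] [IsCyclicRing R]
  {E : Type*} [Group E] {l : ℕ} {π : E →* symplecticGroup ι R} (h : IsOddCentralExt l π)
  [Fact (2 < Fintype.card ι)]

lemma cj_T {a b : ι ⊕ ι} (hab : b ≠ a.swap) (t : R) (x : E) :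
    h.cj (T a b t) x = X h a b t * x * (X h a b t)⁻¹ := by
  rw [← pi_X h hab, h.cj_map]

lemma T_comm_X {a b c d : ι ⊕ ι} (hab : b ≠ a.swap) (hcd : d ≠ c.swap) (hca : c ≠ a.swap)
    (hcb : c ≠ b.swap) (hda : d ≠ a.swap) (hdb : d ≠ b.swap) (t u : R) :
    h.cj (T a b t) (X h c d u) = X h c d u := by
  rcases eq_or_short hcd with rfl | hcd'
  · rcases eq_or_short hab with rfl | hab'
    · by_cases had : ix b = ix d
      · obtain rfl : d = b := (ix_eq_iff.1 had.symm).resolve_right hca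
        rw [cj_T h hcd, mul_inv_eq_iff_eq_mul, ← X_add h hcd, ← X_add h hcd, add_comm]
      · obtain ⟨c, hbc, hdc⟩ := exists_third b d
        rw [X_long h hdc, lam, map_mul, map_inv, T_comm_S h hab (by grind) (by grind) (by grind)
          (by grind) (by grind), ← h.cj_mul, T_comm hab (by grind) (by grind) (by grind)
          (by grind), h.cj_mul, T_comm_S h hab (by grind) (by grind) (by grind)
          (by grind) (by grind)]
    · have h1 := T_comm_S h hcd hab' (by grind) (by grind) (by grind) (by grind) u t
      rw [← X_short h hab', cj_T h hcd, mul_inv_eq_iff_eq_mul] at h1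
      rw [cj_T h hab, mul_inv_eq_iff_eq_mul, h1]
  · rw [X_short h hcd', T_comm_S h hab hcd' hca hcb hda hdb]

lemma X_comm {a b c d : ι ⊕ ι} (hab : b ≠ a.swap) (hcd : d ≠ c.swap) (hca : c ≠ a.swap)
    (hcb : c ≠ b.swap) (hda : d ≠ a.swap) (hdb : d ≠ b.swap) (t u : R) :
    X h a b t * X h c d u = X h c d u * X h a b t := by
  rw [← mul_inv_eq_iff_eq_mul, ← cj_T h hab, T_comm_X h hab hcd hca hcb hda hdb]

lemma X_sss {a b c : ι ⊕ ι} (hab : ix a ≠ ix b) (hac : ix a ≠ ix c) (hbc : ix b ≠ ix c)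
    (t u : R) :
    h.cj (T a b t) (X h b.swap c u) = X h b.swap c u * X h a c (t * u * ep b) := by
  rw [X_short h (by simpa using hbc), X_short h hac, S_sss h hab hac hbc]

lemma X_ssl {a b : ι ⊕ ι} (hab : ix a ≠ ix b) (t u : R) :
    h.cj (T a b t) (X h a b.swap u) = X h a a (ep b * t * u) * X h a b.swap u := by
  rw [X_short h (by simpa using hab), cj_T_S_swap, lam_eq_X h hab]

lemma group_aux {P M M' W Q Z : E} (e1 : P * M = M * P) (e2 : P * M' = M' * P)
    (e3 : P * W = W * P) (e4 : Q * M' = M' * Q) (e5 : W * M' = M' * W) :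
    Z * P * M * (W * (Q * M')) = Z * (M * M') * W * (P * Q) :=
  calc Z * P * M * (W * (Q * M')) = Z * (P * M) * W * (Q * M') := by group
    _ = Z * M * (P * W) * M' * Q := by rw [e1, e4]; group
    _ = Z * M * W * (P * M') * Q := by rw [e3]; group
    _ = Z * M * (W * M') * P * Q := by rw [e2]; group
    _ = Z * (M * M') * W * (P * Q) := by rw [e5]; group

lemma X_short_long {a b : ι ⊕ ι} (hab : ix a ≠ ix b) (r t : R) :
    ∃ v w, h.cj (T a b r) (X h b.swap b.swap t) =
      X h b.swap b.swap t * X h a b.swap v * X h a a w := by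
  obtain ⟨c, hac, hbc⟩ := exists_third a b
  have hbc1 : ix b.swap ≠ ix c := by simpa using hbc
  have hbc2 : ix b ≠ ix c.swap := by simpa using hbc
  have hbc3 : ix b.swap ≠ ix c.swap := by simpa using hbc
  have hac1 : ix a ≠ ix c.swap := by simpa using hac
  have hab1 : ix a ≠ ix b.swap := by simpa using hab
  have n1 (m : R) : h.cj (T b.swap c (1 : R)) (X h a b.swap m) = X h a b.swap m :=
    T_comm_X h (by grind) (by grind) (by grind) (by grind) (by grind) (by grind) _ _
  have n2 (m : R) : h.cj (T b.swap c (1 : R)) (X h a a m) = X h a a m :=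
    T_comm_X h (by grind) (by grind) (by grind) (by grind) (by grind) (by grind) _ _
  have e1 (p m : R) : X h b.swap c.swap p * X h a b.swap m = X h a b.swap m * X h b.swap c.swap p :=
    X_comm h (by grind) (by grind) (by grind) (by grind) (by grind) (by grind) _ _
  have e3 (p m : R) : X h b.swap c.swap p * X h a a m = X h a a m * X h b.swap c.swap p :=
    X_comm h (by grind) (by grind) (by grind) (by grind) (by grind) (by grind) _ _
  have e4 (p m : R) : X h a c.swap p * X h a b.swap m = X h a b.swap m * X h a c.swap p :=
    X_comm h (by grind) (by grind) (by grind) (by grind) (by grind) (by grind) _ _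
  have e5 (p m : R) : X h a a p * X h a b.swap m = X h a b.swap m * X h a a p :=
    X_comm h (by grind) (by grind) (by grind) (by grind) (by grind) (by grind) _ _
  have hG := congrArg π (X_sss h hab hac hbc r 1)
  rw [h.map_cj, map_mul, pi_X h (by grind), pi_X h (by grind), mul_inv_eq_iff_eq_mul] at hG
  have hP := cj_T_S_swap h b.swap c 1 (ep c * t)
  rw [← X_long h hbc1, ← X_short h hbc3] at hP
  have hX := eq_mul_inv_of_mul_eq hP.symm
  set P := X h b.swap c.swap (ep c * t)
  obtain ⟨y, hy⟩ : ∃ y, h.cj (T a b r) P = P * X h a c.swap y := ⟨_, X_sss h hab hac1 hbc2 _ _⟩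
  obtain ⟨m, hm⟩ : ∃ m, h.cj (T a c (r * 1 * ep b)) P = P * X h a b.swap m := by
    have := X_sss h hac hab1 hbc1.symm (r * 1 * ep b) (ep c * t)
    rw [X_symm h (ne_swap_of_ix hbc3)] at this
    exact ⟨_, this⟩
  obtain ⟨w, hw⟩ : ∃ w, h.cj (T a c (r * 1 * ep b)) (X h a c.swap y) =
    X h a a w * X h a c.swap y := ⟨_, X_ssl h hac _ _⟩
  obtain ⟨m', hm'⟩ : ∃ m, h.cj (T b.swap c 1) (X h a c.swap y) =
      X h a c.swap y * X h a b.swap m := by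
    have := X_sss h hbc1 hab1.symm hac.symm 1 y
    rw [X_symm h (ne_swap_of_ix hac1), X_symm h (ne_swap_of_ix hab1)] at this
    exact ⟨_, this⟩
  refine ⟨m + m', w, ?_⟩
  rw [hX, map_mul, map_inv, ← h.cj_mul, hG, hy, h.cj_mul, h.cj_mul, hy, map_mul (h.cj (T a c _)),
    hm, hw, map_mul, map_mul, map_mul, hP, hm',
    n1, n2, mul_inv_eq_iff_eq_mul, X_add h (ne_swap_of_ix hab1.symm), mul_inv_cancel_right]
  exact group_aux (e1 _ m) (e1 _ m') (e3 _ w) (e4 y m') (e5 w m')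

lemma X_long_short {a d : ι ⊕ ι} (had : ix a ≠ ix d) (t u : R) :
    ∃ v w, h.cj (T a a t) (X h a.swap d u) = X h a.swap d u * X h a d v * X h d d w := by
  obtain ⟨v, w, hvw⟩ := X_short_long h (b := a.swap) (by simpa using had.symm) (-u) t
  refine ⟨v, w, ?_⟩
  rw [Sum.swap_swap, cj_T h (by grind), X_neg h (by grind), X_symm h (a := d) (b := a) (by grind),
    inv_inv,
    X_symm h (a := d) (b := a.swap) (by grind)] at hvw
  have e1 : X h a a t * X h a d v = X h a d v * X h a a t :=
    X_comm h (by grind) (by grind) (by grind) (by grind) (by grind) (by grind) _ _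
  have e2 : X h a a t * X h d d w = X h d d w * X h a a t :=
    X_comm h (by grind) (by grind) (by grind) (by grind) (by grind) (by grind) _ _
  rw [cj_T h (by grind), mul_inv_eq_iff_eq_mul, mul_assoc, mul_assoc, ← e2,
    ← mul_assoc (X h a d v), ← e1, ← hvw]
  group

/-- `c'` is `c`, or is obtained from `c` by adding the root `{a, b}`. -/
def St (a b c c' : ι ⊕ ι) : Prop := c' = c ∨ (c = a.swap ∧ c' = b) ∨ (c = b.swap ∧ c' = a)

/-- The roots occurring when conjugating the root `{c, d}` by the root `{a, b}`. -/
def RT (a b c d c' d' : ι ⊕ ι) : Prop :=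
  (St a b c c' ∧ St a b d d') ∨ (a = b ∧ c = a.swap ∧ c' = d ∧ d' = d) ∨
    (a = b ∧ d = a.swap ∧ c' = c ∧ d' = c)

lemma cj_T_X_mem_aux {a b d : ι ⊕ ι} (hab : b ≠ a.swap) (hda : d ≠ a) (hdb : d ≠ b.swap)
    (H : Subgroup E) (hH : ∀ c' d' v, d' ≠ c'.swap → RT a b a.swap d c' d' → X h c' d' v ∈ H)
    (t u : R) : h.cj (T a b t) (X h a.swap d u) ∈ H := by
  rcases eq_or_short hab with rfl | hab'
  · have had : ix b ≠ ix d := fun hc => by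
      rcases ix_eq_iff.1 hc.symm with h1 | h1 <;> contradiction
    obtain ⟨v, w, hvw⟩ := X_long_short h had t u
    rw [hvw]
    refine mul_mem (mul_mem (hH _ _ _ (by grind) ?_) (hH _ _ _ (by grind) ?_))
      (hH _ _ _ (by grind) ?_) <;> simp [RT, St]
  · rw [T_symm hab]
    by_cases hd1 : d = a.swap
    · subst hd1
      obtain ⟨v, w, hvw⟩ := X_short_long h hab'.symm t u
      rw [hvw]
      refine mul_mem (mul_mem (hH _ _ _ (by grind) ?_) (hH _ _ _ (by grind) ?_))
        (hH _ _ _ (by grind) ?_) <;> simp [RT, St]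
    by_cases hd2 : d = b
    · subst hd2
      rw [X_symm h (by grind), X_ssl h hab'.symm]
      refine mul_mem (hH _ _ _ (by grind) ?_) ?_
      · simp [RT, St]
      · rw [X_symm h (by grind)]
        exact hH _ _ _ (by grind) (by simp [RT, St])
    have had : ix a ≠ ix d := fun hc => by
      rcases ix_eq_iff.1 hc.symm with h1 | h1 <;> contradiction
    have hbd : ix b ≠ ix d := fun hc => by
      rcases ix_eq_iff.1 hc.symm with h1 | h1 <;> contradiction
    rw [X_sss h hab'.symm hbd had]
    refine mul_mem (hH _ _ _ (by grind) ?_) (hH _ _ _ (by grind) ?_) <;> simp [RT, St]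

/-- The commutator formula, as a statement about subgroups. -/
lemma cj_T_X_mem {a b c d : ι ⊕ ι} (hab : b ≠ a.swap) (hcd : d ≠ c.swap)
    (h1 : ¬ (c = a.swap ∧ d = b.swap)) (h2 : ¬ (c = b.swap ∧ d = a.swap))
    (H : Subgroup E) (hH : ∀ c' d' v, d' ≠ c'.swap → RT a b c d c' d' → X h c' d' v ∈ H)
    (t u : R) : h.cj (T a b t) (X h c d u) ∈ H := by
  have hRT1 {a b c d c' d' : ι ⊕ ι} (hr : RT a b c d c' d') : RT b a c d c' d' := by
    unfold RT St at *; grind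
  have hRT2 {a b c d c' d' : ι ⊕ ι} (hr : RT a b c d c' d') : RT a b d c d' c' := by
    unfold RT St at *; grind
  have hH' : ∀ d' c' v, c' ≠ d'.swap → RT a b d c d' c' → X h d' c' v ∈ H := fun d' c' v hc hr => by
    rw [X_symm h hc]
    exact hH _ _ _ (by grind) (hRT2 hr)
  by_cases c1 : c = a.swap
  · subst c1
    exact cj_T_X_mem_aux h hab (by grind) (by grind) H hH t u
  by_cases c2 : c = b.swap
  · subst c2
    rw [T_symm hab]
    exact cj_T_X_mem_aux h (by grind) (by grind) (by grind) H
      (fun _ _ _ hc hr => hH _ _ _ hc (hRT1 hr)) t u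
  rw [X_symm h hcd]
  by_cases c3 : d = a.swap
  · subst c3
    exact cj_T_X_mem_aux h hab (by grind) (by grind) H hH' t u
  by_cases c4 : d = b.swap
  · subst c4
    rw [T_symm hab]
    exact cj_T_X_mem_aux h (by grind) (by grind) (by grind) H
      (fun _ _ _ hc hr => hH' _ _ _ hc (hRT1 hr)) t u
  rw [T_comm_X h hab (by grind) c3 c4 c1 c2]
  exact hH' _ _ _ (by grind) (by simp [RT, St])

end Relations

/-- A pair of opposite root subgroups, with their Weyl elements. -/
structure RankOne {R E : Type*} [CommRing R] [Group E] (x y : R → E) (w : Rˣ → E) : Prop where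
  x_add : ∀ s t, x (s + t) = x s * x t
  y_add : ∀ s t, y (s + t) = y s * y t
  w_def : ∀ u : Rˣ, w u = x u * y (-(u⁻¹ : Rˣ)) * x u
  w_x : ∀ (u : Rˣ) s, w u * x s * (w u)⁻¹ = y (-((u⁻¹ : Rˣ) : R) ^ 2 * s)
  w_y : ∀ (u : Rˣ) s, w u * y s * (w u)⁻¹ = x (-(u : R) ^ 2 * s)

namespace RankOne

variable {R E : Type*} [CommRing R] [Group E] {x y : R → E} {w : Rˣ → E} (h : RankOne x y w)

lemma x_zero (h : RankOne x y w) : x 0 = 1 := by simpa using h.x_add 0 0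
lemma y_zero (h : RankOne x y w) : y 0 = 1 := by simpa using h.y_add 0 0
lemma x_neg (h : RankOne x y w) (s : R) : x (-s) = (x s)⁻¹ := by
  rw [eq_inv_iff_mul_eq_one, ← h.x_add, neg_add_cancel, h.x_zero]
lemma y_neg (h : RankOne x y w) (s : R) : y (-s) = (y s)⁻¹ := by
  rw [eq_inv_iff_mul_eq_one, ← h.y_add, neg_add_cancel, h.y_zero]

lemma w_neg (h : RankOne x y w) (u : Rˣ) : w (-u) = (w u)⁻¹ := by
  rw [h.w_def, h.w_def]
  simp only [inv_neg, Units.val_neg, neg_neg, h.x_neg, h.y_neg]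
  group

lemma w_mul_x (h : RankOne x y w) (u : Rˣ) (s : R) :
    w u * x s = y (-((u⁻¹ : Rˣ) : R) ^ 2 * s) * w u := mul_inv_eq_iff_eq_mul.1 (h.w_x u s)

lemma w_mul_y (h : RankOne x y w) (u : Rˣ) (s : R) :
    w u * y s = x (-(u : R) ^ 2 * s) * w u := mul_inv_eq_iff_eq_mul.1 (h.w_y u s)

lemma x_mul_w (h : RankOne x y w) (u : Rˣ) (s : R) :
    x s * w u = w u * y (-((u⁻¹ : Rˣ) : R) ^ 2 * s) := by
  rw [h.w_mul_y]
  congr 2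
  have : (u : R) * (u⁻¹ : Rˣ) = 1 := by simp
  linear_combination (-(s * (u * (u⁻¹ : Rˣ)) + s)) * this

lemma y_mul_w (h : RankOne x y w) (u : Rˣ) (s : R) :
    y s * w u = w u * x (-(u : R) ^ 2 * s) := by
  rw [h.w_mul_x]
  congr 2
  have : (u : R) * (u⁻¹ : Rˣ) = 1 := by simp
  linear_combination (-(s * (u * (u⁻¹ : Rˣ)) + s)) * this

lemma w_eq (h : RankOne x y w) (u : Rˣ) : w u = y (-(u⁻¹ : Rˣ)) * x u * y (-(u⁻¹ : Rˣ)) := by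
  have h1 : w u * w u = w u * (x u * y (-(u⁻¹ : Rˣ)) * x u) := by rw [← h.w_def]
  rw [← mul_assoc, ← mul_assoc, h.w_mul_x, mul_assoc _ (w u), h.w_mul_y, mul_assoc, mul_assoc,
    h.w_mul_x, ← mul_assoc, ← mul_assoc, mul_left_inj] at h1
  have : (u : R) * (u⁻¹ : Rˣ) = 1 := by simp
  rw [h1]
  congr 2
  · congr 1
    linear_combination (-(u⁻¹ : Rˣ) : R) * this
  · congr 1
    linear_combination (u : R) * this
  · linear_combination (-(u⁻¹ : Rˣ) : R) * this

lemma x_eq (h : RankOne x y w) (u : Rˣ) : x u = y (u⁻¹ : Rˣ) * w u * y (u⁻¹ : Rˣ) := by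
  rw [h.w_eq, h.y_neg]
  group

lemma y_eq (h : RankOne x y w) (u : Rˣ) : y u = x (u⁻¹ : Rˣ) * w (-u⁻¹) * x (u⁻¹ : Rˣ) := by
  rw [h.w_def]
  simp only [inv_neg, Units.val_neg, neg_neg, h.x_neg, inv_inv]
  group

lemma w_rel (h : RankOne x y w) (s t : Rˣ) (hst : (s + t : R) = 1) :
    w (-(s * t⁻¹)) * w s * w t = w 1 := by
  have hs : (s : R) * (s⁻¹ : Rˣ) = 1 := by simp
  have ht : (t : R) * (t⁻¹ : Rˣ) = 1 := by simp
  generalize hs' : ((s⁻¹ : Rˣ) : R) = s' at *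
  generalize ht' : ((t⁻¹ : Rˣ) : R) = t' at *
  have e1 : x 1 = y 1 * w 1 * y 1 := by simpa using h.x_eq 1
  have e2 : x 1 = y s' * w s * y (s' + t') * w t * y t' := by
    rw [← hst, h.x_add, h.x_eq s, h.x_eq t, h.y_add, hs', ht']
    simp only [mul_assoc]
  have e3 : w s * y (s' + t') = x (-(s * t')) * w s := by
    rw [h.w_mul_y]
    congr 2
    linear_combination (-(s : R)) * hs + s * ht - s * t' * hst
  have e4 : w t * y (s * t') = x (-(s * t)) * w t := by
    rw [h.w_mul_y]
    congr 2
    linear_combination (-(s * t : R)) * ht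
  have e5 : w s * x (-(s * t)) = y (s' * t) * w s := by
    rw [h.w_mul_x, hs']
    congr 2
    linear_combination s' * t * hs
  have e6 : y s' = y 1 * y (s' * t) := by
    rw [← h.y_add]
    congr 1
    linear_combination hs - s' * hst
  have e7 : y t' = y (s * t') * y 1 := by
    rw [← h.y_add]
    congr 1
    linear_combination ht - t' * hst
  have e8 : w (-(s * t⁻¹)) = y (s' * t) * x (-(s * t')) * y (s' * t) := by
    rw [h.w_eq]
    simp [← hs', ← ht', mul_comm]
  have e9 : y 1 * w 1 * y 1 = y 1 * (w (-(s * t⁻¹)) * w s * w t) * y 1 := by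
    rw [← e1, e2, e8, e6, e7]
    calc y 1 * y (s' * t) * w s * y (s' + t') * w t * (y (s * t') * y 1)
        = y 1 * y (s' * t) * (w s * y (s' + t')) * (w t * y (s * t')) * y 1 := by group
      _ = y 1 * y (s' * t) * x (-(s * t')) * (w s * x (-(s * t))) * w t * y 1 := by
        rw [e3, e4]; group
      _ = _ := by rw [e5]; group
  rw [mul_left_inj, mul_right_inj] at e9
  exact e9.symm

variable [IsLocalRing R] [Invertible (2 : R)] {H : Subgroup E}

/-- The big cell `Y H X Y`. -/
def Cell (x y : R → E) (H : Subgroup E) (z : E) : Prop :=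
  ∃ p q r, ∃ k ∈ H, z = y p * k * x q * y r

lemma exists_unit_sub (t : R) : ∃ v m : Rˣ, (v - m : R) = t := by
  by_cases ht : IsUnit t
  · obtain ⟨t, rfl⟩ := ht
    refine ⟨-t, -(t * unitOfInvertible 2), ?_⟩
    push_cast
    simp
    ring
  · obtain ⟨m, hm⟩ := (IsLocalRing.isUnit_or_isUnit_one_sub_self t).resolve_left ht
    exact ⟨1, m, by rw [hm]; simp⟩

lemma Cell.y_mul (h : RankOne x y w) {z : E} (hz : Cell x y H z) (t : R) :
    Cell x y H (y t * z) := by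
  obtain ⟨p, q, r, k, hk, rfl⟩ := hz
  exact ⟨t + p, q, r, k, hk, by rw [h.y_add]; group⟩

lemma Cell.mem_mul (hHy : ∀ k ∈ H, ∀ s, ∃ s', k * y s = y s' * k) {z : E}
    (hz : Cell x y H z) {k : E} (hk : k ∈ H) : Cell x y H (k * z) := by
  obtain ⟨p, q, r, k', hk', rfl⟩ := hz
  obtain ⟨s', hs'⟩ := hHy k hk p
  exact ⟨s', q, r, k * k', mul_mem hk hk', by
    rw [← mul_assoc, ← mul_assoc, ← mul_assoc, hs']; group⟩

lemma cell_x_y_w (h : RankOne x y w) (hw : ∀ u v, w u * w v ∈ H)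
    (hHx : ∀ k ∈ H, ∀ s, ∃ s', x s * k = k * x s') (s t : R) (u : Rˣ) :
    Cell x y H (x s * y t * w u) := by
  by_cases hs : IsUnit s
  · obtain ⟨s, rfl⟩ := hs
    refine ⟨(s⁻¹ : Rˣ), -(u : R) ^ 2 * (s⁻¹ : Rˣ) + -(u : R) ^ 2 * t, 0, w s * w u, hw _ _, ?_⟩
    have e1 := h.y_mul_w u (s⁻¹ : Rˣ)
    rw [mul_assoc, h.y_mul_w u t, h.x_eq s, h.y_zero, mul_one, h.x_add]
    calc _ = y (s⁻¹ : Rˣ) * w s * (y (s⁻¹ : Rˣ) * w u) * x (-(u : R) ^ 2 * t) := by group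
      _ = _ := by rw [e1]; group
  · obtain ⟨v, m, rfl⟩ := exists_unit_sub t
    obtain ⟨s', hs'⟩ : IsUnit (s + (v⁻¹ : Rˣ)) := by
      by_contra hc
      have : IsUnit ((s + (v⁻¹ : Rˣ)) + -s) := by simp
      rcases IsLocalRing.isUnit_or_isUnit_of_isUnit_add this with h1 | h1
      · exact hc h1
      · exact hs (by simpa using h1)
    have e1 : x s * y v = y (s'⁻¹ : Rˣ) * (w s' * w (-v⁻¹)) *
        x (-((-v⁻¹ : Rˣ) : R) ^ 2 * (s'⁻¹ : Rˣ) + (v⁻¹ : Rˣ)) := by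
      have e1 := h.y_mul_w (-v⁻¹) (s'⁻¹ : Rˣ)
      calc x s * y v = x (s + (v⁻¹ : Rˣ)) * w (-v⁻¹) * x (v⁻¹ : Rˣ) := by
            rw [h.y_eq v, h.x_add]; group
        _ = y (s'⁻¹ : Rˣ) * w s' * (y (s'⁻¹ : Rˣ) * w (-v⁻¹)) * x (v⁻¹ : Rˣ) := by
            rw [← hs', h.x_eq s']; group
        _ = _ := by rw [e1, h.x_add]; group
    have e2 : y (-m) * w u = x (-(m⁻¹ : Rˣ)) * (w m⁻¹ * w u) *
        y (-((u⁻¹ : Rˣ) : R) ^ 2 * -(m⁻¹ : Rˣ)) := by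
      have := h.y_eq (-m)
      simp only [inv_neg, Units.val_neg, neg_neg] at this
      rw [this, mul_assoc, h.x_mul_w u]
      group
    rw [sub_eq_add_neg, h.y_add, ← mul_assoc, e1, mul_assoc _ (y (-m)) (w u), e2]
    set q := -((-v⁻¹ : Rˣ) : R) ^ 2 * (s'⁻¹ : Rˣ) + (v⁻¹ : Rˣ)
    obtain ⟨q', hq'⟩ := hHx _ (hw m⁻¹ u) (q + -(m⁻¹ : Rˣ))
    refine ⟨(s'⁻¹ : Rˣ), q', -((u⁻¹ : Rˣ) : R) ^ 2 * -(m⁻¹ : Rˣ),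
      (w s' * w (-v⁻¹)) * (w m⁻¹ * w u), mul_mem (hw _ _) (hw _ _), ?_⟩
    calc _ = y (s'⁻¹ : Rˣ) * (w s' * w (-v⁻¹)) * (x q * x (-(m⁻¹ : Rˣ)) * (w m⁻¹ * w u)) *
          y (-((u⁻¹ : Rˣ) : R) ^ 2 * -(m⁻¹ : Rˣ)) := by group
      _ = _ := by rw [← h.x_add, hq']; group

/-- The product `X Y X` is contained in the big cell. -/
lemma cell_x_y_x (h : RankOne x y w) (hw : ∀ u v, w u * w v ∈ H)
    (hHx : ∀ k ∈ H, ∀ s, ∃ s', x s * k = k * x s')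
    (hHy : ∀ k ∈ H, ∀ s, ∃ s', k * y s = y s' * k) (s t r : R) :
    Cell x y H (x s * y t * x r) := by
  obtain ⟨p, q, r', k, hk, e1⟩ := cell_x_y_w h hw hHx s t 1
  have e2 : x s * y t * x r = y p * (k * (x q * y (r' + -r) * w (-1))) := by
    rw [h.w_neg, ← mul_assoc, ← mul_assoc, eq_mul_inv_iff_mul_eq, h.y_add, mul_assoc, h.x_mul_w,
      ← mul_assoc, e1]
    simp [mul_assoc]
  rw [e2]
  exact (Cell.mem_mul hHy (cell_x_y_w h hw hHx _ _ _) hk).y_mul h _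

end RankOne

section WeylG

variable {ι R : Type*} [Fintype ι] [DecidableEq ι] [CommRing R] [Invertible (2 : R)]

/-- The normalization of root elements: `1 / 2` for long roots, `1` for short ones. -/
def nu (a b : ι ⊕ ι) : R := if a = b then ⅟2 else 1

lemma nu_swap (a b : ι ⊕ ι) : (nu a.swap b.swap : R) = nu a b := by
  unfold nu
  congr 1
  grind

/-- Root elements, normalized so that `e b.swap ↦ e b.swap + s • e a`. -/
noncomputable def xG (a b : ι ⊕ ι) (s : R) : symplecticGroup ι R := T a b (nu a b * ep b * s)

lemma act_xG {a b : ι ⊕ ι} (hab : b ≠ a.swap) (s : R) :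
    act (xG a b s) (e b.swap) = e b.swap + s • e a := by
  rw [xG]
  rcases eq_or_short hab with rfl | hab'
  · rw [act_T_long]
    congr 2
    simp only [nu, if_true]
    linear_combination s * mul_invOf_self (2 : R) + 2 * ⅟2 * s * ep_mul_self (R := R) b
  · rw [act_T_swap hab', nu, if_neg (ne_of_ix hab')]
    congr 2
    linear_combination s * ep_mul_self (R := R) b

lemma act_xG' {a b : ι ⊕ ι} (hab : b ≠ a.swap) (s : R) :
    act (xG a b s) (e a.swap) = e a.swap + (ep a * ep b * s) • e b := by
  rw [xG]
  rcases eq_or_short hab with rfl | hab'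
  · rw [act_T_long]
    congr 2
    simp only [nu, if_true]
    linear_combination ep b * ep b * s * mul_invOf_self (2 : R)
  · rw [act_T_swap' hab', nu, if_neg (ne_of_ix hab')]
    congr 2
    ring

lemma act_xG_of_ne {a b c : ι ⊕ ι} (hab : b ≠ a.swap) (hca : c ≠ a.swap) (hcb : c ≠ b.swap)
    (s : R) : act (xG a b s) (e c) = e c := act_T_of_ne hab hca hcb _

/-- The Weyl element of the root `{a, b}`. -/
noncomputable def wG (a b : ι ⊕ ι) (u : Rˣ) : symplecticGroup ι R :=
  xG a b (u : R) * xG a.swap b.swap (ep a * ep b * -((u⁻¹ : Rˣ) : R)) * xG a b (u : R)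

/-- The permutation underlying the reflection in the root `{a, b}`. -/
def ws (a b c : ι ⊕ ι) : ι ⊕ ι :=
  if c = a then b.swap else if c = b.swap then a else if c = b then a.swap else
    if c = a.swap then b else c

/-- The scalars of the Weyl element of the root `{a, b}`. -/
def we (a b : ι ⊕ ι) (u : Rˣ) (c : ι ⊕ ι) : R :=
  if c = a then -(u⁻¹ : Rˣ) else if c = b.swap then u else
    if c = b then -(ep a * ep b * (u⁻¹ : Rˣ)) else if c = a.swap then ep a * ep b * u else 1

lemma act_wG_a {a b : ι ⊕ ι} (hab : b ≠ a.swap) (u : Rˣ) :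
    act (wG a b u) (e a : _ → R) = (-(u⁻¹ : Rˣ) : R) • e b.swap := by
  have h1 := act_xG' (R := R) (a := a.swap) (b := b.swap) (by grind)
    (ep a * ep b * -((u⁻¹ : Rˣ) : R))
  have hu : (u : R) * (u⁻¹ : Rˣ) = 1 := by simp
  have ha := ep_mul_self (R := R) a
  have hb := ep_mul_self (R := R) b
  rw [Sum.swap_swap] at h1
  rw [wG, act_mul, act_mul, act_xG_of_ne hab (by grind) (by grind), h1, act_add, act_smul,
    act_xG_of_ne hab (by grind) (by grind), act_xG hab, ep_swap, ep_swap, smul_add, smul_smul]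
  have : -ep a * -ep b * (ep a * ep b * -((u⁻¹ : Rˣ) : R)) = -(u⁻¹ : Rˣ) := by
    linear_combination (-((u⁻¹ : Rˣ) : R)) * ha * ep b ^ 2 - (u⁻¹ : Rˣ) * hb
  rw [this, neg_mul, Units.inv_mul, neg_one_smul]
  abel

lemma act_wG_bswap {a b : ι ⊕ ι} (hab : b ≠ a.swap) (u : Rˣ) :
    act (wG a b u) (e b.swap : _ → R) = (u : R) • e a := by
  have h1 := act_xG' (R := R) (a := a.swap) (b := b.swap) (by grind)
    (ep a * ep b * -((u⁻¹ : Rˣ) : R))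
  have hu : (u : R) * (u⁻¹ : Rˣ) = 1 := by simp
  have ha := ep_mul_self (R := R) a
  have hb := ep_mul_self (R := R) b
  rw [Sum.swap_swap] at h1
  have h2 : act (xG a.swap b.swap (ep a * ep b * -((u⁻¹ : Rˣ) : R)))
      (e b.swap : _ → R) = e b.swap :=
    act_xG_of_ne (by grind) (by grind) (by grind) _
  rw [wG, act_mul, act_mul, act_xG hab, act_add, act_smul, h1, h2, ep_swap, ep_swap, smul_add,
    smul_smul]
  have : (u : R) * (-ep a * -ep b * (ep a * ep b * -((u⁻¹ : Rˣ) : R))) = -1 := by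
    linear_combination (-ep a * ep a * ep b * ep b) * hu - ha * ep b ^ 2 - hb
  rw [this, neg_one_smul, add_comm, neg_add_cancel_right, act_smul,
    act_xG_of_ne hab (by grind) (by grind)]

lemma xG_symm {a b : ι ⊕ ι} (hab : b ≠ a.swap) (s : R) :
    xG a b s = xG b a (ep a * ep b * s) := by
  rw [xG, xG, T_symm hab]
  congr 1
  have : (nu a b : R) = nu b a := by unfold nu; congr 1; grind
  rw [this]
  linear_combination (-nu b a * ep b * s) * ep_mul_self (R := R) a

lemma ep_units (a : ι ⊕ ι) : ∃ κ : Rˣ, (κ : R) = ep a ∧ κ⁻¹ = κ := by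
  cases a
  · exact ⟨1, by simp, by simp⟩
  · exact ⟨-1, by simp, by simp⟩

lemma wG_symm {a b : ι ⊕ ι} (hab : b ≠ a.swap) (u κ : Rˣ) (hκ : (κ : R) = ep a * ep b)
    (hκ' : κ⁻¹ = κ) : wG a b u = wG b a (κ * u) := by
  rw [wG, wG, xG_symm hab, xG_symm (a := a.swap) (b := b.swap) (by grind)]
  simp only [ep_swap, Units.val_mul, _root_.mul_inv_rev, hκ, hκ']
  ring_nf

lemma mono_wG {a b : ι ⊕ ι} (hab : b ≠ a.swap) (u : Rˣ) :
    Mono (wG a b u : symplecticGroup ι R) (we a b u) (ws a b) where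
  act_e c := by
    obtain ⟨κ₁, hκ₁, hκ₁'⟩ := ep_units (R := R) a
    obtain ⟨κ₂, hκ₂, hκ₂'⟩ := ep_units (R := R) b
    have hκ : ((κ₁ * κ₂ : Rˣ) : R) = ep a * ep b := by simp [hκ₁, hκ₂]
    have hκ' : (κ₁ * κ₂)⁻¹ = κ₁ * κ₂ := by rw [_root_.mul_inv_rev, hκ₁', hκ₂', mul_comm]
    have hw := wG_symm hab u _ hκ hκ'
    unfold we ws
    split_ifs with h1 h2 h3 h4
    · rw [h1, act_wG_a hab]
    · rw [h2, act_wG_bswap hab]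
    · rw [h3, hw, act_wG_a (by grind), _root_.mul_inv_rev, hκ', Units.val_mul, hκ, mul_comm]
    · rw [h4, hw, act_wG_bswap (by grind), Units.val_mul, hκ]
    · rw [wG, act_mul, act_mul, act_xG_of_ne hab (by grind) (by grind),
        act_xG_of_ne (by grind) (by grind) (by grind),
        act_xG_of_ne hab (by grind) (by grind), one_smul]
  inj c d hcd := by unfold ws at hcd; grind
  swap c := by
    have hs (d : ι ⊕ ι) : c.swap = d ↔ c = d.swap := by grind
    simp only [ws, hs, Sum.swap_swap]
    split_ifs <;> grind

end WeylG

section Weyl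

variable {ι R : Type*} [Fintype ι] [DecidableEq ι] [CommRing R] [IsCyclicRing R]
  {E : Type*} [Group E] {l : ℕ} {π : E →* symplecticGroup ι R} (h : IsOddCentralExt l π)
  [Fact (2 < Fintype.card ι)] [Invertible (2 : R)]

/-- The lift of `xG`. -/
noncomputable def xE (a b : ι ⊕ ι) (s : R) : E := X h a b (nu a b * ep b * s)

/-- The lift of the opposite of `xG`. -/
noncomputable def yE (a b : ι ⊕ ι) (s : R) : E := xE h a.swap b.swap (ep a * ep b * s)

/-- The lift of `wG`. -/
noncomputable def wE (a b : ι ⊕ ι) (u : Rˣ) : E :=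
  xE h a b u * yE h a b (-(u⁻¹ : Rˣ)) * xE h a b u

lemma pi_xE {a b : ι ⊕ ι} (hab : b ≠ a.swap) (s : R) : π (xE h a b s) = xG a b s := pi_X h hab _

lemma pi_wE {a b : ι ⊕ ι} (hab : b ≠ a.swap) (u : Rˣ) : π (wE h a b u) = wG a b u := by
  rw [wE, wG, map_mul, map_mul, pi_xE h hab, yE, pi_xE h (by grind)]

lemma xE_add {a b : ι ⊕ ι} (hab : b ≠ a.swap) (s t : R) :
    xE h a b (s + t) = xE h a b s * xE h a b t := by
  rw [xE, mul_add, X_add h hab, xE, xE]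

lemma X_eq_xE (a b : ι ⊕ ι) (s : R) : ∃ t, X h a b s = xE h a b t := by
  refine ⟨(if a = b then 2 else 1) * ep b * s, ?_⟩
  rw [xE]
  congr 1
  unfold nu
  split_ifs
  · linear_combination (-s * ep b * ep b) * mul_invOf_self (2 : R) - s * ep_mul_self (R := R) b
  · linear_combination - s * ep_mul_self (R := R) b

lemma rankOne {a b : ι ⊕ ι} (hab : b ≠ a.swap) :
    RankOne (xE h a b) (yE h a b) (wE h a b) where
  x_add := xE_add h hab
  y_add s t := by rw [yE, mul_add, xE_add h (by grind), yE, yE]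
  w_def u := rfl
  w_x u s := by
    rw [← h.cj_map, pi_wE h hab, xE, (mono_wG hab u).cj_X h hab, yE, xE, nu_swap]
    have h1 : ws a b a = b.swap := by grind [ws]
    have h2 : ws a b b = a.swap := by grind [ws]
    rw [h1, h2, X_symm h (by grind)]
    congr 1
    have ha := ep_mul_self (R := R) a
    have hb := ep_mul_self (R := R) b
    rcases eq_or_short hab with rfl | hab'
    · simp only [we, if_true, ep_swap]
      linear_combination (-nu b b * s * ((u⁻¹ : Rˣ) : R)^2 * ep b) * hb
    · have h3 := ne_of_ix hab'
      have h4 := swap_ne b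
      have h5 := ne_swap_of_ix hab'
      simp only [we, if_true, ep_swap, if_neg h3.symm, if_neg h4.symm]
      ring
  w_y u s := by
    rw [← h.cj_map, pi_wE h hab, yE, xE, (mono_wG hab u).cj_X h (by grind), xE, nu_swap]
    have h1 : ws a b a.swap = b := by grind [ws]
    have h2 : ws a b b.swap = a := by grind [ws]
    rw [h1, h2, X_symm h (by grind)]
    congr 1
    have ha := ep_mul_self (R := R) a
    have hb := ep_mul_self (R := R) b
    rcases eq_or_short hab with rfl | hab'
    · have h4 := swap_ne b
      simp only [we, if_true, if_neg h4, ep_swap]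
      linear_combination (-nu b b * s * (u : R)^2 * ep b) * hb
    · have h3 := ne_of_ix hab'
      have h4 := swap_ne a
      have h5 := ne_swap_of_ix hab'
      have h6 : a.swap ≠ b.swap := by grind
      have h7 : b.swap ≠ a := by grind
      have h8 : a.swap ≠ b := by grind
      simp only [we, if_true, ep_swap, if_neg h4, if_neg h6, if_neg h7, if_neg h8]
      linear_combination (-nu a b * s * (u : R)^2 * ep b) * (ha * ep b * ep b + hb)

end Weyl

section TorusG

variable {ι R : Type*} [Fintype ι] [DecidableEq ι] [CommRing R]

/-- A diagonal symplectic matrix from its first half. -/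
noncomputable def dgHom : (ι → Rˣ) →* symplecticGroup ι R where
  toFun f := dg (Sum.elim (fun i => (f i : R)) (fun i => ((f i)⁻¹ : Rˣ)))
  map_one' := by
    refine ext_act fun c => ?_
    rw [act_dg (by rintro (i | i) <;> simp), act_one]
    cases c <;> simp
  map_mul' f k := by
    rw [dg_mul (by rintro (i | i) <;> simp) (by rintro (i | i) <;> simp)]
    congr 1
    ext (i | i) <;> simp [mul_comm]

lemma mono_dgHom (f : ι → Rˣ) :
    Mono (dgHom f) (Sum.elim (fun i => (f i : R)) (fun i => ((f i)⁻¹ : Rˣ))) id :=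
  mono_dg (by rintro (i | i) <;> simp)

lemma dgHom_injective : Function.Injective (dgHom : (ι → Rˣ) →* symplecticGroup ι R) := by
  rw [injective_iff_map_eq_one]
  intro f hf
  ext i
  have := (mono_dgHom f).act_e (Sum.inl i)
  rw [hf, act_one] at this
  simpa [e_apply] using (congrFun this (Sum.inl i)).symm

/-- The scalars of the coroot at `a`. -/
def hz (a : ι ⊕ ι) (u : Rˣ) (c : ι ⊕ ι) : R :=
  if c = a then u else if c = a.swap then (u⁻¹ : Rˣ) else 1

lemma hz_mul (a : ι ⊕ ι) (u : Rˣ) (c : ι ⊕ ι) : hz a u c * hz a u c.swap = (1 : R) := by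
  have hs (d : ι ⊕ ι) : c.swap = d ↔ c = d.swap := by grind
  have h1 := swap_ne a
  simp only [hz, hs, Sum.swap_swap]
  split_ifs <;> first | simp | grind

/-- The coroot of the long root at `a`. -/
noncomputable def hG (a : ι ⊕ ι) (u : Rˣ) : symplecticGroup ι R := dg (hz a u)

lemma mono_hG (a : ι ⊕ ι) (u : Rˣ) : Mono (hG a u : symplecticGroup ι R) (hz a u) id :=
  mono_dg (hz_mul a u)

lemma hG_mul (a : ι ⊕ ι) (u v : Rˣ) :
    (hG a (u * v) : symplecticGroup ι R) = hG a u * hG a v := by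
  rw [hG, hG, hG, dg_mul (hz_mul a u) (hz_mul a v)]
  congr 1
  ext c
  simp only [hz, Pi.mul_apply]
  split_ifs <;> simp [mul_comm]

lemma hG_one (a : ι ⊕ ι) : (hG a 1 : symplecticGroup ι R) = 1 := by
  simpa using hG_mul (R := R) a 1 1

lemma hG_inv (a : ι ⊕ ι) (u : Rˣ) : (hG a u⁻¹ : symplecticGroup ι R) = (hG a u)⁻¹ := by
  rw [eq_inv_iff_mul_eq_one, ← hG_mul, inv_mul_cancel, hG_one]

lemma hG_swap (a : ι ⊕ ι) (u : Rˣ) : (hG a.swap u : symplecticGroup ι R) = hG a u⁻¹ := by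
  rw [hG, hG]
  congr 1
  ext c
  have h1 := swap_ne a
  simp only [hz, Sum.swap_swap, inv_inv]
  split_ifs <;> first | rfl | grind

lemma hG_inl (i : ι) (u : Rˣ) : (hG (Sum.inl i) u : symplecticGroup ι R) =
    dgHom (Pi.mulSingle i u) := by
  refine ext_act fun c => ?_
  rw [(mono_hG _ _).act_e, (mono_dgHom _).act_e]
  congr 1
  rcases c with j | j <;> by_cases hj : j = i
  · subst hj; simp [hz]
  · simp [hz, hj]
  · subst hj; simp [hz]
  · simp [hz, hj]

lemma Mono.conj_hG {g : symplecticGroup ι R} {η : ι ⊕ ι → R} {σ : ι ⊕ ι → ι ⊕ ι}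
    (hg : Mono g η σ) (a : ι ⊕ ι) (u : Rˣ) : g * hG a u * g⁻¹ = hG (σ a) u := by
  rw [mul_inv_eq_iff_eq_mul]
  refine ext_act fun c => ?_
  rw [act_mul, act_mul, hg.act_e, act_smul, (mono_hG _ _).act_e, (mono_hG _ _).act_e, act_smul,
    hg.act_e, smul_smul, smul_smul, mul_comm]
  have h1 : σ c = σ a ↔ c = a := ⟨hg.inj _ _, fun h => h ▸ rfl⟩
  have h2 : σ c = (σ a).swap ↔ c = a.swap := by
    rw [← hg.swap]
    exact ⟨hg.inj _ _, fun h => h ▸ rfl⟩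
  simp only [hz, h1, h2, id]

end TorusG

section Torus

variable {ι R : Type*} [Fintype ι] [DecidableEq ι] [CommRing R] [IsCyclicRing R]
  {E : Type*} [Group E] {l : ℕ} {π : E →* symplecticGroup ι R} (h : IsOddCentralExt l π)
  [Fact (2 < Fintype.card ι)] [Invertible (2 : R)]

lemma ws_self (a : ι ⊕ ι) : ws a a a = a.swap := by grind [ws]

lemma wG_conj_hG (a : ι ⊕ ι) (u v : Rˣ) :
    wG a a v * hG a u * (wG a a v)⁻¹ = (hG a u : symplecticGroup ι R)⁻¹ := by
  rw [(mono_wG (swap_ne a).symm v).conj_hG, ws_self, hG_swap, hG_inv]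

/-- The lift of `hG` inverted by the Weyl element. -/
noncomputable def HE (a : ι ⊕ ι) (u : Rˣ) : E :=
  (h.exists_inverted (wG_conj_hG a u 1)).choose

lemma pi_HE (a : ι ⊕ ι) (u : Rˣ) : π (HE h a u) = hG a u :=
  (h.exists_inverted (wG_conj_hG a u 1)).choose_spec.1

lemma wG_HE_one (a : ι ⊕ ι) (u : Rˣ) : h.cj (wG a a 1) (HE h a u) = (HE h a u)⁻¹ :=
  (h.exists_inverted (wG_conj_hG a u 1)).choose_spec.2

variable [IsCyclic Rˣ]

lemma HE_mul (a : ι ⊕ ι) (u v : Rˣ) : HE h a (u * v) = HE h a u * HE h a v := by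
  obtain ⟨γ, hγ⟩ := IsCyclic.exists_generator (α := Rˣ)
  have hz (n : ℤ) : HE h a (γ ^ n) = HE h a γ ^ n := by
    refine h.eq_of_inverted (d := wG a a 1) ?_ (wG_HE_one h a _) ?_
    · rw [map_zpow, pi_HE, pi_HE]
      let f : Rˣ →* symplecticGroup ι R := ⟨⟨hG a, hG_one a⟩, hG_mul a⟩
      exact map_zpow f γ n
    · rw [map_zpow, wG_HE_one, _root_.inv_zpow]
  obtain ⟨m, rfl⟩ := hγ u
  obtain ⟨n, rfl⟩ := hγ v
  simp only
  rw [← _root_.zpow_add, hz, hz, hz, _root_.zpow_add]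

lemma HE_one (a : ι ⊕ ι) : HE h a (1 : Rˣ) = 1 := by
  simpa using HE_mul h a 1 1

lemma HE_inv (a : ι ⊕ ι) (u : Rˣ) : HE h a u⁻¹ = (HE h a u)⁻¹ := by
  rw [eq_inv_iff_mul_eq_one, ← HE_mul, inv_mul_cancel, HE_one]

lemma wG_eq (a : ι ⊕ ι) (v : Rˣ) : (wG a a v : symplecticGroup ι R) = hG a v * wG a a 1 := by
  refine ext_act fun c => ?_
  have h1 := swap_ne a
  rw [act_mul, (mono_wG (swap_ne a).symm _).act_e, (mono_wG (swap_ne a).symm _).act_e, act_smul,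
    (mono_hG _ _).act_e, smul_smul]
  simp only [we, ws, hz, id]
  congr 1
  by_cases h2 : c = a
  · simp [h2, h1]
  · by_cases h3 : c = a.swap <;> simp [h2, h3, h1]

lemma wG_HE (a : ι ⊕ ι) (u v : Rˣ) : h.cj (wG a a v) (HE h a u) = (HE h a u)⁻¹ := by
  rw [wG_eq, h.cj_mul, wG_HE_one, ← pi_HE h, h.cj_map, ← HE_inv, ← HE_inv, ← HE_mul, ← HE_mul]
  congr 1
  rw [mul_comm, inv_mul_cancel_left]

lemma Mono.conj_wG {g : symplecticGroup ι R} {η : ι ⊕ ι → R} {σ : ι ⊕ ι → ι ⊕ ι}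
    (hg : Mono g η σ) (a : ι ⊕ ι) (v : Rˣ) : ∃ v', g * wG a a v * g⁻¹ = wG (σ a) (σ a) v' := by
  have h1 := hg.ep_mul a
  obtain ⟨κ₁, hκ₁, hκ₁'⟩ := ep_units (R := R) a
  obtain ⟨κ₂, hκ₂, hκ₂'⟩ := ep_units (R := R) (σ a)
  have e1 : (κ₁ : R) * κ₁ = 1 := by rw [hκ₁, ep_mul_self]
  have e2 : (κ₂ : R) * κ₂ = 1 := by rw [hκ₂, ep_mul_self]
  rw [← hκ₁, ← hκ₂] at h1
  let z : Rˣ := ⟨η a, η a.swap * κ₂ * κ₁, by linear_combination κ₁ * h1 + e1, by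
    linear_combination κ₁ * h1 + e1⟩
  refine ⟨κ₁ * κ₂ * z ^ 2 * v, ?_⟩
  have hnu (c : ι ⊕ ι) : (nu c c : R) = ⅟2 := by simp [nu]
  have h3 : g * wG a a v * g⁻¹ = (g * xG a a (v : R) * g⁻¹) *
    (g * xG a.swap a.swap (ep a * ep a * -((v⁻¹ : Rˣ) : R)) * g⁻¹) *
      (g * xG a a (v : R) * g⁻¹) := by
    rw [wG]; group
  rw [h3, wG, xG, xG, hg.conj_T (by grind), hg.conj_T (by grind), xG, xG, hnu, hnu, hnu, hnu,
    hg.swap, ep_swap, ep_swap, ← hκ₁, ← hκ₂]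
  have hz : (z : R) = η a := rfl
  have hz' : ((z⁻¹ : Rˣ) : R) = η a.swap * κ₂ * κ₁ := rfl
  congr 2
  · congr 1
    push_cast
    rw [hz]
    linear_combination (-η a * η a * ⅟2 * κ₁ * v) * e2
  · congr 1
    push_cast [_root_.mul_inv_rev, inv_pow]
    rw [hz', hκ₁', hκ₂']
    have e5 : (κ₂ : R) ^ 6 = 1 := by linear_combination (κ₂ ^ 4 + κ₂^2 + 1) * e2
    linear_combination (η a.swap ^ 2 * ⅟2 * v⁻¹.val * κ₁) * (-e5 * κ₁^2)
  · push_cast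
    rw [hz]
    linear_combination (-η a * η a * ⅟2 * κ₁ * v) * e2

lemma Mono.cj_HE {g : symplecticGroup ι R} {η : ι ⊕ ι → R} {σ : ι ⊕ ι → ι ⊕ ι}
    (hg : Mono g η σ) (a : ι ⊕ ι) (u : Rˣ) : h.cj g (HE h a u) = HE h (σ a) u := by
  obtain ⟨v, hv⟩ := hg.conj_wG a 1
  refine h.eq_of_inverted (d := wG (σ a) (σ a) v) ?_ ?_ (wG_HE h _ _ _)
  · rw [h.map_cj, pi_HE, pi_HE, hg.conj_hG]
  · rw [← h.cj_mul, ← hv, inv_mul_cancel_right, h.cj_mul, wG_HE, map_inv]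

lemma HE_swap (a : ι ⊕ ι) (u : Rˣ) : HE h a.swap u = HE h a u⁻¹ := by
  rw [← ws_self, ← (mono_wG (swap_ne a).symm (1 : Rˣ)).cj_HE h, wG_HE, HE_inv]

lemma HE_comm (a b : ι ⊕ ι) (u v : Rˣ) : HE h a u * HE h b v = HE h b v * HE h a u := by
  rw [← mul_inv_eq_iff_eq_mul, ← h.cj_map, pi_HE, (mono_hG a u).cj_HE h, id]

/-- The lift of the diagonal torus. -/
noncomputable def torusHom : (ι → Rˣ) →* E :=
  MonoidHom.noncommPiCoprod
    (fun i : ι => (⟨⟨HE h (Sum.inl i), HE_one h _⟩, HE_mul h _⟩ : Rˣ →* E))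
    fun _ _ _ _ _ => HE_comm h _ _ _ _

lemma torusHom_single (i : ι) (u : Rˣ) : torusHom h (Pi.mulSingle i u) = HE h (Sum.inl i) u :=
  MonoidHom.noncommPiCoprod_mulSingle _ _ _

lemma pi_torusHom (f : ι → Rˣ) : π (torusHom h f) = dgHom f := by
  have : π.comp (torusHom h) = dgHom := by
    refine MonoidHom.pi_ext fun i u => ?_
    rw [MonoidHom.comp_apply, torusHom_single, pi_HE, hG_inl]
  exact DFunLike.congr_fun this f

/-- The lifted torus. -/
noncomputable def torus : Subgroup E := (torusHom h).range

lemma HE_mem_torus (a : ι ⊕ ι) (u : Rˣ) : HE h a u ∈ torus h := by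
  rcases a with i | i
  · exact ⟨_, torusHom_single h i u⟩
  · have := HE_swap h (Sum.inl i) u
    rw [Sum.swap_inl] at this
    exact this ▸ ⟨_, torusHom_single h i u⁻¹⟩

lemma torus_inf_ker {k : E} (hk : k ∈ torus h) (hk' : π k = 1) : k = 1 := by
  obtain ⟨f, rfl⟩ := hk
  rw [pi_torusHom, ← map_one dgHom] at hk'
  rw [dgHom_injective hk', map_one]

lemma exists_mono_of_mem_torus {k : E} (hk : k ∈ torus h) : ∃ z, Mono (π k) z id := by
  obtain ⟨f, rfl⟩ := hk
  exact ⟨_, pi_torusHom h f ▸ mono_dgHom f⟩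

lemma torus_conj_X {k : E} (hk : k ∈ torus h) {a b : ι ⊕ ι} (hab : b ≠ a.swap) (s : R) :
    ∃ s', k * X h a b s * k⁻¹ = X h a b s' := by
  obtain ⟨z, hz⟩ := exists_mono_of_mem_torus h hk
  exact ⟨_, by rw [← h.cj_map, hz.cj_X h hab, id, id]⟩

lemma torus_mul_xE {k : E} (hk : k ∈ torus h) {a b : ι ⊕ ι} (hab : b ≠ a.swap) (s : R) :
    ∃ s', k * xE h a b s = xE h a b s' * k := by
  obtain ⟨s', hs⟩ := torus_conj_X h hk hab (nu a b * ep b * s)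
  obtain ⟨t, ht⟩ := X_eq_xE h a b s'
  exact ⟨t, by rw [← mul_inv_eq_iff_eq_mul, ← ht, ← hs, xE]⟩

lemma xE_mul_torus {k : E} (hk : k ∈ torus h) {a b : ι ⊕ ι} (hab : b ≠ a.swap) (s : R) :
    ∃ s', xE h a b s * k = k * xE h a b s' := by
  obtain ⟨s', hs⟩ := torus_mul_xE h (inv_mem hk) hab s
  refine ⟨s', ?_⟩
  rw [inv_mul_eq_iff_eq_mul] at hs
  rw [hs]
  group

end Torus

/-- The squares have index at most two in the units, and a representative of the other class
is of the form `s ^ 2 + 1`. -/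
class HasNonsquareSum (R : Type*) [CommRing R] : Prop where
  exists_sq_add_one : ∃ z s : Rˣ, (s ^ 2 + 1 : R) = z ∧
    ∀ u : Rˣ, (∃ r, u = r ^ 2) ∨ (∃ r, u = z * r ^ 2)

section Torus

variable {ι R : Type*} [Fintype ι] [DecidableEq ι] [CommRing R] [IsCyclicRing R]
  {E : Type*} [Group E] {l : ℕ} {π : E →* symplecticGroup ι R} (h : IsOddCentralExt l π)
  [Fact (2 < Fintype.card ι)] [Invertible (2 : R)] [IsCyclic Rˣ]

lemma wE_mul_mem_of {a b : ι ⊕ ι} (hab : b ≠ a.swap)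
    (h1 : ∀ u : Rˣ, wE h a b u * (wE h a b 1)⁻¹ ∈ torus h) (u v : Rˣ) :
    wE h a b u * wE h a b v ∈ torus h := by
  have h2 := mul_mem (h1 u) (inv_mem (h1 (-v)))
  rw [(rankOne h hab).w_neg] at h2
  convert h2 using 1
  group

lemma HE_conj_wE {a b : ι ⊕ ι} (hab : b ≠ a.swap) (u v k : Rˣ)
    (hk : (k : R) = hz a u a * hz a u b) :
    HE h a u * wE h a b v * (HE h a u)⁻¹ = wE h a b (k * v) := by
  have hk1 : hz a u a.swap * hz a u b.swap * (k : R) = 1 := by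
    rw [hk]
    linear_combination hz_mul (R := R) a u a + hz a u a * hz a u a.swap * hz_mul (R := R) a u b
  have hk' : ((k⁻¹ : Rˣ) : R) = hz a u a.swap * hz a u b.swap := by
    rw [Units.inv_eq_of_mul_eq_one_left hk1]
  have hx (s : R) : h.cj (hG a u) (xE h a b s) = xE h a b (k * s) := by
    rw [xE, (mono_hG a u).cj_X h hab, xE, id, id, hk]
    congr 1
    ring
  have hy (s : R) : h.cj (hG a u) (yE h a b s) = yE h a b ((k⁻¹ : Rˣ) * s) := by
    rw [yE, xE, (mono_hG a u).cj_X h (by grind), yE, xE, id, id, hk']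
    congr 1
    ring
  rw [← h.cj_map, pi_HE, wE, map_mul, map_mul, hx, hy, wE]
  simp only [Units.val_mul, _root_.mul_inv_rev, mul_neg, mul_comm]

lemma wE_short {a b : ι ⊕ ι} (hab : ix a ≠ ix b) (u : Rˣ) :
    wE h a b u * (wE h a b 1)⁻¹ ∈ torus h := by
  have hab' : b ≠ a.swap := by grind
  have h1 := HE_conj_wE h hab' u 1 u (by simp [hz, (ne_of_ix hab).symm, hab'])
  rw [mul_one] at h1
  have h2 := (mono_wG hab' (1 : Rˣ)).cj_HE h a u
  rw [← pi_wE h hab', h.cj_map] at h2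
  have h3 : wE h a b u * (wE h a b 1)⁻¹ = HE h a u * (HE h (ws a b a) u)⁻¹ := by
    rw [← h1, ← h2]
    group
  rw [h3]
  exact mul_mem (HE_mem_torus h _ _) (inv_mem (HE_mem_torus h _ _))

lemma wE_conj_HE (a : ι ⊕ ι) (u v : Rˣ) :
    wE h a a v * HE h a u = (HE h a u)⁻¹ * wE h a a v := by
  rw [← mul_inv_eq_iff_eq_mul, ← h.cj_map, pi_wE h (by grind), wG_HE]

lemma wE_long [HasNonsquareSum R] (a : ι ⊕ ι) (u : Rˣ) :
    wE h a a u = HE h a u * wE h a a 1 := by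
  have haa : a ≠ a.swap := (swap_ne a).symm
  have hk (v : Rˣ) : ∃ k ∈ π.ker, wE h a a v = k * (HE h a v * wE h a a 1) :=
    π.exists_mem_ker_eq_mul (by rw [map_mul, pi_HE, pi_wE h haa, pi_wE h haa, wG_eq])
  choose k hkA hk using hk
  have hcomm (v : Rˣ) (x : E) : k v * x = x * k v := h.comm _ (hkA v) x
  have hk1 : k 1 = 1 := by
    have := hk 1
    rwa [HE_one, one_mul, right_eq_mul] at this
  have hH (s v : Rˣ) : wE h a a v * HE h a s = HE h a s⁻¹ * wE h a a v := by
    rw [wE_conj_HE, HE_inv]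
  have hsq (s v : Rˣ) : k (s ^ 2 * v) = k v := by
    have h1 := HE_conj_wE h haa s v (s ^ 2) (by simp [hz, sq])
    rw [← HE_inv, mul_assoc, hH, inv_inv, ← mul_assoc, ← HE_mul, hk v, hk (s ^ 2 * v), ← sq,
      ← mul_assoc, ← hcomm, mul_assoc, ← mul_assoc (HE h a _) (HE h a _), ← HE_mul] at h1
    exact (mul_right_cancel h1).symm
  have hrel (s t : Rˣ) (hst : (s + t : R) = 1) : k (-(s * t⁻¹)) * k s * k t = k (-1) := by
    have h1 := (rankOne h haa).w_rel s t hst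
    set m := -(s * t⁻¹) with hm
    have h2 : wE h a a s * wE h a a t = k t * k s * (HE h a (t⁻¹ * s) * wE h a a 1 * wE h a a 1) :=
      calc wE h a a s * wE h a a t = wE h a a s * k t * HE h a t * wE h a a 1 := by
            rw [hk t]; group
        _ = k t * (wE h a a s * HE h a t) * wE h a a 1 := by rw [← hcomm]; group
        _ = k t * (HE h a t⁻¹ * k s) * (HE h a s * wE h a a 1) * wE h a a 1 := by
            rw [hH, hk s]; group
        _ = _ := by rw [← hcomm, HE_mul]; group
    have h3 : wE h a a m * (wE h a a s * wE h a a t) =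
        k m * k s * k t * (HE h a (-1) * wE h a a 1 * wE h a a 1 * wE h a a 1) :=
      calc _ = wE h a a m * k t * k s * HE h a (t⁻¹ * s) * wE h a a 1 * wE h a a 1 := by
            rw [h2]; group
        _ = k t * (wE h a a m * k s) * HE h a (t⁻¹ * s) * wE h a a 1 * wE h a a 1 := by
            rw [← hcomm t]; group
        _ = k t * k s * (wE h a a m * HE h a (t⁻¹ * s)) * wE h a a 1 * wE h a a 1 := by
            rw [← hcomm]; group
        _ = k t * k s * (HE h a (t⁻¹ * s)⁻¹ * k m) * HE h a m * wE h a a 1 * wE h a a 1 *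
            wE h a a 1 := by rw [hH, hk m]; group
        _ = (k t * k s * k m) * (HE h a (t⁻¹ * s)⁻¹ * HE h a m * wE h a a 1 * wE h a a 1 *
            wE h a a 1) := by rw [← hcomm m]; group
        _ = _ := by
            rw [← HE_mul, hcomm t (k s), mul_assoc (k s), hcomm t, hcomm s, mul_assoc (k m),
              ← hcomm s (k t), hm]
            have : (t⁻¹ * s)⁻¹ * -(s * t⁻¹) = -1 := by
              rw [mul_neg, mul_comm s, inv_mul_cancel]
            rw [this]
            group
    have h4 : k (-1) * (HE h a (-1) * wE h a a 1 * wE h a a 1) = 1 := by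
      rw [← mul_assoc, ← hk, (rankOne h haa).w_neg, inv_mul_cancel]
    rw [mul_assoc, h3, ← mul_assoc, mul_eq_right, ← h4] at h1
    exact mul_right_cancel h1
  obtain ⟨z, p, hz, hzu⟩ := HasNonsquareSum.exists_sq_add_one (R := R)
  have hkz : k z = 1 := by
    have h1 := hrel (p ^ 2 * z⁻¹) z⁻¹ (by
      rw [Units.val_mul, ← add_one_mul, Units.val_pow_eq_pow_val, hz, Units.mul_inv])
    rw [inv_inv, inv_mul_cancel_right, ← mul_neg_one, hsq, hsq, mul_assoc, mul_eq_left] at h1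
    have h2 := hsq z z⁻¹
    rw [sq, mul_inv_cancel_right] at h2
    rw [h2]
    exact h.eq_one_of_sq (hkA _) h1
  have hku : k u = 1 := by
    rcases hzu u with ⟨r, rfl⟩ | ⟨r, rfl⟩
    · rw [← mul_one (r ^ 2), hsq, hk1]
    · rw [mul_comm, hsq, hkz]
  rw [hk u, hku, one_mul]

lemma wE_mul_mem [HasNonsquareSum R] {a b : ι ⊕ ι} (hab : b ≠ a.swap) (u v : Rˣ) :
    wE h a b u * wE h a b v ∈ torus h := by
  refine wE_mul_mem_of h hab (fun u => ?_) u v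
  rcases eq_or_short hab with rfl | hab'
  · rw [wE_long h, mul_inv_cancel_right]
    exact HE_mem_torus h _ _
  · exact wE_short h hab' u

end Torus

/-- An injective odd function on the signed indices. -/
structure Height {ι : Type*} (φ : ι ⊕ ι → ℤ) : Prop where
  swap : ∀ c, φ c.swap = -φ c
  inj : ∀ c d, φ c = φ d → c = d

section Height

variable {ι : Type*} [Fintype ι] [DecidableEq ι] {φ : ι ⊕ ι → ℤ}

lemma Height.neg (hφ : Height φ) : Height (-φ) where
  swap c := by simp [hφ.swap]
  inj c d h := hφ.inj c d (by simpa using h)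

lemma Height.ne_zero (hφ : Height φ) (c : ι ⊕ ι) : φ c ≠ 0 := fun hc =>
  swap_ne c (hφ.inj _ _ (by rw [hφ.swap, hc, neg_zero]))

lemma Height.ne_swap_iff (hφ : Height φ) {c d : ι ⊕ ι} : d ≠ c.swap ↔ φ c + φ d ≠ 0 := by
  refine not_congr ⟨fun h => by rw [h, hφ.swap]; omega,
    fun h => hφ.inj _ _ (by rw [hφ.swap]; omega)⟩

lemma Height.eq_iff (hφ : Height φ) {c d : ι ⊕ ι} : c = d ↔ φ c = φ d :=
  ⟨fun h => h ▸ rfl, hφ.inj _ _⟩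

end Height

section Tri

variable {ι R : Type*} [Fintype ι] [DecidableEq ι] [CommRing R]

/-- Unitriangular matrices, with respect to a height function. -/
def Tri (φ : ι ⊕ ι → ℤ) (n : ℤ) (M : symplecticGroup ι R) : Prop :=
  ∀ x y, φ x - φ y < n → ((M : Matrix _ _ R) - 1) x y = 0

variable {φ : ι ⊕ ι → ℤ} {n : ℤ}

lemma Tri.one : Tri φ n (1 : symplecticGroup ι R) := fun x y _ => by simp

lemma Tri.mul (hn : 0 ≤ n) {M N : symplecticGroup ι R} (hM : Tri φ n M) (hN : Tri φ n N) :
    Tri φ n (M * N) := fun x y hxy => by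
  have h1 : ((M * N : symplecticGroup ι R) : Matrix (ι ⊕ ι) (ι ⊕ ι) R) - 1 =
      ((M : Matrix (ι ⊕ ι) (ι ⊕ ι) R) - 1) + ((N : Matrix (ι ⊕ ι) (ι ⊕ ι) R) - 1) +
      ((M : Matrix (ι ⊕ ι) (ι ⊕ ι) R) - 1) * ((N : Matrix (ι ⊕ ι) (ι ⊕ ι) R) - 1) := by
    simp only [Submonoid.coe_mul]
    noncomm_ring
  rw [h1, Matrix.add_apply, Matrix.add_apply, hM x y hxy, hN x y hxy, Matrix.mul_apply,
    Finset.sum_eq_zero, add_zero,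
    add_zero]
  intro z _
  by_cases h2 : φ x - φ z < n
  · rw [hM x z h2, zero_mul]
  · rw [hN z y (by omega), mul_zero]

lemma coe_apply_eq (M : symplecticGroup ι R) (x y : ι ⊕ ι) :
    (M : Matrix _ _ R) x y = act M (e y) x := by
  simp [act, e]

lemma tri_T (hφ : Height φ) {a b : ι ⊕ ι} (hab : b ≠ a.swap) (hn : n ≤ φ a + φ b) (t : R) :
    Tri φ n (T a b t) := fun x y hxy => by
  rw [Matrix.sub_apply, coe_apply_eq, act_T hab]
  have h1 : ¬ (a.swap = y ∧ x = b) := by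
    rintro ⟨rfl, rfl⟩
    rw [hφ.swap] at hxy
    omega
  have h2 : ¬ (b.swap = y ∧ x = a) := by
    rintro ⟨rfl, rfl⟩
    rw [hφ.swap] at hxy
    omega
  simp only [Pi.add_apply, Pi.smul_apply, e_apply, Matrix.one_apply, smul_eq_mul]
  by_cases h3 : a.swap = y <;> by_cases h4 : b.swap = y <;> simp_all

lemma T_entry {a b : ι ⊕ ι} (hab : b ≠ a.swap) (t : R) :
    (((T a b t : symplecticGroup ι R) : Matrix _ _ R) - 1) a b.swap =
      (if a = b then 2 * t * ep a else t * ep b) := by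
  have h1 : a ≠ b.swap := by grind
  rw [Matrix.sub_apply, coe_apply_eq, Matrix.one_apply_ne h1, sub_zero]
  rcases eq_or_short hab with rfl | hab'
  · rw [act_T_long, if_pos rfl]
    simp [e_apply, h1]
  · rw [act_T_swap hab', if_neg (ne_of_ix hab')]
    simp [e_apply, h1]

end Tri

section Unip

variable {ι R : Type*} [Fintype ι] [DecidableEq ι] [CommRing R] [IsCyclicRing R]
  {E : Type*} [Group E] {l : ℕ} {π : E →* symplecticGroup ι R} (h : IsOddCentralExt l π)
  [Fact (2 < Fintype.card ι)] [Invertible (2 : R)]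

/-- The subgroup generated by a set of lifted root subgroups. -/
def rootGroup (P : ι ⊕ ι → ι ⊕ ι → Prop) : Subgroup E :=
  Subgroup.closure {x | ∃ a b t, b ≠ a.swap ∧ P a b ∧ x = X h a b t}

variable {P Q : ι ⊕ ι → ι ⊕ ι → Prop}

lemma X_mem_rootGroup {a b : ι ⊕ ι} (hab : b ≠ a.swap) (hP : P a b) (t : R) :
    X h a b t ∈ rootGroup h P := Subgroup.subset_closure ⟨a, b, t, hab, hP, rfl⟩

lemma rootGroup_le {H : Subgroup E}
    (hH : ∀ a b t, b ≠ a.swap → P a b → X h a b t ∈ H) : rootGroup h P ≤ H := by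
  rw [rootGroup, Subgroup.closure_le]
  rintro _ ⟨a, b, t, hab, hP, rfl⟩
  exact hH a b t hab hP

lemma rootGroup_induction {p : E → Prop} (h1 : p 1) (hmul : ∀ x y, p x → p y → p (x * y))
    (hX : ∀ a b t, b ≠ a.swap → P a b → p (X h a b t)) {x : E} (hx : x ∈ rootGroup h P) : p x := by
  have h2 : rootGroup h P ≤ ⊤ := le_top
  rw [rootGroup] at hx
  induction hx using Subgroup.closure_induction'' with
  | one => exact h1
  | mem x hx =>
    obtain ⟨a, b, t, hab, hP, rfl⟩ := hx
    exact hX a b t hab hP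
  | inv_mem x hx =>
    obtain ⟨a, b, t, hab, hP, rfl⟩ := hx
    rw [← X_neg h hab]
    exact hX a b _ hab hP
  | mul x y _ _ hx hy => exact hmul x y hx hy

/-- Conjugation by `g` preserves a root group if it maps its generators into it. -/
lemma cj_mem_rootGroup {g : symplecticGroup ι R}
    (hg : ∀ a b t, b ≠ a.swap → P a b → h.cj g (X h a b t) ∈ rootGroup h P) {x : E}
    (hx : x ∈ rootGroup h P) : h.cj g x ∈ rootGroup h P := by
  refine rootGroup_induction h (p := fun x => h.cj g x ∈ rootGroup h P) ?_ ?_ hg hx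
  · simp [one_mem]
  · intro x y hx hy
    rw [map_mul]
    exact mul_mem hx hy

/-- Adjoining a root which normalizes a root group. -/
lemma exists_of_mem_rootGroup {a b : ι ⊕ ι} (hab : b ≠ a.swap)
    (hPQ : ∀ c d, P c d → Q c d ∨ (c = a ∧ d = b) ∨ (c = b ∧ d = a))
    (hn : ∀ t, ∀ x ∈ rootGroup h Q, h.cj (T a b t) x ∈ rootGroup h Q) {x : E}
    (hx : x ∈ rootGroup h P) : ∃ q ∈ rootGroup h Q, ∃ t, x = q * X h a b t := by
  refine rootGroup_induction h
    (p := fun x => ∃ q ∈ rootGroup h Q, ∃ t, x = q * X h a b t) ?_ ?_ ?_ hx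
  · exact ⟨1, one_mem _, 0, by rw [X_zero h hab, one_mul]⟩
  · rintro _ _ ⟨q, hq, t, rfl⟩ ⟨q', hq', t', rfl⟩
    refine ⟨q * h.cj (T a b t) q', mul_mem hq (hn t _ hq'), t + t', ?_⟩
    rw [cj_T h hab, X_add h hab]
    group
  · intro c d t hcd hP
    rcases hPQ c d hP with hQ | ⟨rfl, rfl⟩ | ⟨rfl, rfl⟩
    · exact ⟨_, X_mem_rootGroup h hcd hQ t, 0, by rw [X_zero h hab, mul_one]⟩
    · exact ⟨1, one_mem _, t, by rw [one_mul]⟩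
    · exact ⟨1, one_mem _, t, by rw [one_mul, X_symm h hcd]⟩

lemma tri_of_mem {φ : ι ⊕ ι → ℤ} (hφ : Height φ) {n : ℤ} (hn : 0 ≤ n)
    (hP : ∀ a b, P a b → n ≤ φ a + φ b) {x : E} (hx : x ∈ rootGroup h P) : Tri φ n (π x) := by
  refine rootGroup_induction h (p := fun x => Tri φ n (π x)) ?_ ?_ ?_ hx
  · rw [map_one]; exact Tri.one
  · intro x y hx hy
    rw [map_mul]
    exact hx.mul hn hy
  · intro a b t hab hab'
    rw [pi_X h hab]
    exact tri_T hφ hab (hP a b hab') t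

/-- A height function separating the roots. -/
def Sidon (φ : ι ⊕ ι → ℤ) : Prop := ∀ a b c d : ι ⊕ ι, b ≠ a.swap → d ≠ c.swap →
  φ a + φ b = φ c + φ d → (c = a ∧ d = b) ∨ (c = b ∧ d = a)

lemma unip_inf_ker {φ : ι ⊕ ι → ℤ} (hφ : Height φ) (hS : Sidon φ) {x : E}
    (hx : x ∈ rootGroup h fun a b => 0 < φ a + φ b) (hx1 : π x = 1) : x = 1 := by
  obtain ⟨N, hN0, hN⟩ : ∃ N : ℕ, 1 ≤ N ∧ ∀ a b, φ a + φ b < N := by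
    obtain ⟨N, hN⟩ := (Set.finite_range fun p : (ι ⊕ ι) × (ι ⊕ ι) => φ p.1 + φ p.2).bddAbove
    refine ⟨(N + 1).toNat + 1, by omega, fun a b => ?_⟩
    have := hN ⟨(a, b), rfl⟩
    simp only at this
    omega
  suffices H : ∀ m : ℕ, ∀ n : ℤ, 1 ≤ n → n = N - m →
      ∀ x ∈ rootGroup h fun a b => n ≤ φ a + φ b, π x = 1 → x = 1 from
    H (N - 1) 1 le_rfl (by omega) x hx hx1
  intro m
  induction m with
  | zero =>
    intro n _ hn x hx _
    refine (Subgroup.mem_bot).1 (rootGroup_le h ?_ hx)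
    intro a b t _ hab
    have := hN a b
    omega
  | succ m ih =>
    intro n hn hm x hx hx1
    by_cases hab : ∃ a b, b ≠ a.swap ∧ φ a + φ b = n
    · obtain ⟨a, b, hab, hn'⟩ := hab
      have hPQ : ∀ c d, n ≤ φ c + φ d →
          n + 1 ≤ φ c + φ d ∨ (c = a ∧ d = b) ∨ (c = b ∧ d = a) := by
        intro c d hcd
        rcases hcd.lt_or_eq with hlt | heq
        · exact Or.inl hlt
        · exact Or.inr (hS a b c d hab (hφ.ne_swap_iff.2 (by omega)) (by omega))
      have hnorm : ∀ t, ∀ x ∈ rootGroup h fun a b => n + 1 ≤ φ a + φ b,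
          h.cj (T a b t) x ∈ rootGroup h fun a b => n + 1 ≤ φ a + φ b := by
        refine fun t x hx => cj_mem_rootGroup h (fun c d u hcd hcd' => ?_) hx
        refine cj_T_X_mem h hab hcd ?_ ?_ _ (fun c' d' v hcd'' hR => ?_) t u
        · rintro ⟨rfl, rfl⟩
          simp only [hφ.swap] at hcd'
          omega
        · rintro ⟨rfl, rfl⟩
          simp only [hφ.swap] at hcd'
          omega
        · refine X_mem_rootGroup h hcd'' ?_ v
          simp only [RT, St, hφ.eq_iff, hφ.swap] at hR
          omega
      obtain ⟨q, hq, t, rfl⟩ := exists_of_mem_rootGroup h hab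
        (P := fun a b => n ≤ φ a + φ b) (Q := fun a b => n + 1 ≤ φ a + φ b) hPQ hnorm hx
      have h1 := tri_of_mem h hφ (n := n + 1) (by omega) (fun _ _ => id) hq
      have h2 : π q = T a b (-t) := by
        rw [map_mul, pi_X h hab] at hx1
        rw [T_neg hab]
        exact eq_inv_of_mul_eq_one_left hx1
      have h3 := h1 a b.swap (by rw [hφ.swap]; omega)
      rw [h2, T_entry hab] at h3
      have ht : t = 0 := by
        split_ifs at h3
        · linear_combination (-⅟2 * ep a) * h3 - 2 * ⅟2 * t * ep_mul_self (R := R) a -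
            t * invOf_mul_self (2 : R)
        · linear_combination (- ep b) * h3 - t * ep_mul_self (R := R) b
      subst ht
      rw [X_zero h hab, mul_one] at hx1 ⊢
      exact ih (n + 1) (by omega) (by omega) q hq hx1
    · refine ih (n + 1) (by omega) (by omega) x (rootGroup_le h ?_ hx) hx1
      intro a b t hab' hn'
      refine X_mem_rootGroup h hab' ?_ t
      push Not at hab
      have := hab a b hab'
      omega

end Unip

section BigCell

variable {ι R : Type*} [Fintype ι] [DecidableEq ι] [CommRing R] [IsCyclicRing R]
  {E : Type*} [Group E] {l : ℕ} {π : E →* symplecticGroup ι R} (h : IsOddCentralExt l π)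
  [Fact (2 < Fintype.card ι)] [Invertible (2 : R)]

/-- The lifted unipotent group of the positive roots. -/
def unip (φ : ι ⊕ ι → ℤ) : Subgroup E := rootGroup h fun c d => 0 < φ c + φ d

/-- A separating height with the same positive roots. -/
structure SidonHeight (φ f : ι ⊕ ι → ℤ) : Prop where
  height : Height f
  sidon : Sidon f
  pos_iff : ∀ c d, 0 < f c + f d ↔ 0 < φ c + φ d

lemma SidonHeight.neg {φ f : ι ⊕ ι → ℤ} (hφ : Height φ) (hf : SidonHeight φ f) :
    SidonHeight (-φ) (-f) where
  height := hf.height.neg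
  sidon a b c d hab hcd h1 := hf.sidon a b c d hab hcd (by simp only [Pi.neg_apply] at h1; omega)
  pos_iff c d := by
    have := hf.pos_iff c.swap d.swap
    simpa only [Pi.neg_apply, hφ.swap, hf.height.swap] using this

lemma SidonHeight.unip_inf_ker {φ f : ι ⊕ ι → ℤ} (hf : SidonHeight φ f) {x : E}
    (hx : x ∈ unip h φ) (hx1 : π x = 1) : x = 1 := by
  refine SpLift.unip_inf_ker h hf.height hf.sidon ?_ hx1
  simp only [hf.pos_iff]
  exact hx

variable [IsCyclic Rˣ]

lemma torus_conj_mem {P : ι ⊕ ι → ι ⊕ ι → Prop} {k x : E} (hk : k ∈ torus h)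
    (hx : x ∈ rootGroup h P) : k * x * k⁻¹ ∈ rootGroup h P := by
  rw [← h.cj_map]
  refine cj_mem_rootGroup h (fun a b t hab hP => ?_) hx
  obtain ⟨s, hs⟩ := torus_conj_X h hk hab t
  rw [h.cj_map, hs]
  exact X_mem_rootGroup h hab hP s

lemma triple_eq_one {φ f : ι ⊕ ι → ℤ} (hφ : Height φ) (hf : SidonHeight φ f) {v t u : E}
    (hv : v ∈ unip h (-φ)) (ht : t ∈ torus h) (hu : u ∈ unip h φ) (h1 : π (v * t * u) = 1) :
    v * t * u = 1 := by
  obtain ⟨z, hz⟩ := exists_mono_of_mem_torus h ht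
  have hU : Tri φ 1 (π u) := tri_of_mem h hφ zero_le_one (fun _ _ => id) hu
  have hW : Tri (-φ) 1 (π v⁻¹) :=
    tri_of_mem h hφ.neg zero_le_one (fun _ _ => id) (inv_mem hv)
  have h2 : π t * π u = π v⁻¹ := by
    rw [map_inv, eq_inv_iff_mul_eq_one, ← map_mul, ← map_mul]
    have h3 := congrArg (fun g => (π v)⁻¹ * g * π v) h1
    simpa [mul_assoc] using h3
  have hent : ∀ x y, ((π v⁻¹ : symplecticGroup ι R) : Matrix (ι ⊕ ι) (ι ⊕ ι) R) x y =
      z x * ((π u : symplecticGroup ι R) : Matrix (ι ⊕ ι) (ι ⊕ ι) R) x y := by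
    intro x y
    rw [← h2, Submonoid.coe_mul, Matrix.mul_apply, Finset.sum_eq_single x]
    · rw [coe_apply_eq, hz.act_e]
      simp [e_apply]
    · intro c _ hc
      rw [coe_apply_eq, hz.act_e]
      simp [e_apply, Ne.symm hc]
    · simp
  have hU' : ∀ x y, φ x ≤ φ y →
      ((π u : symplecticGroup ι R) : Matrix (ι ⊕ ι) (ι ⊕ ι) R) x y = (1 : Matrix _ _ R) x y :=
    fun x y hxy => by simpa [sub_eq_zero] using hU x y (by omega)
  have hW' : ∀ x y, φ y ≤ φ x →
      ((π v⁻¹ : symplecticGroup ι R) : Matrix (ι ⊕ ι) (ι ⊕ ι) R) x y = (1 : Matrix _ _ R) x y :=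
    fun x y hxy => by simpa [sub_eq_zero] using hW x y (by simp only [Pi.neg_apply]; omega)
  have hz1 : ∀ x, z x = 1 := fun x => by
    have := hent x x
    rw [hU' x x le_rfl, hW' x x le_rfl] at this
    simpa using this.symm
  have hu1 : π u = 1 := by
    refine Subtype.ext (Matrix.ext fun x y => ?_)
    rcases le_total (φ x) (φ y) with hxy | hxy
    · exact hU' x y hxy
    · have := hent x y
      rw [hz1, one_mul, hW' x y hxy] at this
      exact this.symm
  have ht1 : π t = 1 := ext_act fun c => by rw [hz.act_e, hz1]; simp
  have hv1 : π v = 1 := by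
    rw [hu1, ht1, map_inv] at h2
    simpa using h2.symm
  rw [hf.unip_inf_ker h hu hu1, torus_inf_ker h ht ht1, (hf.neg hφ).unip_inf_ker h hv hv1]
  simp

/-- The simple roots of a height function with consecutive values. -/
def Simple (φ : ι ⊕ ι → ℤ) (a b : ι ⊕ ι) : Prop :=
  (φ a + φ b = 1 ∧ 2 ≤ φ a) ∨ (φ a = 1 ∧ φ b = 1)

lemma Simple.neg {φ : ι ⊕ ι → ℤ} (hφ : Height φ) {a b : ι ⊕ ι} (hab : Simple φ a b) :
    Simple (-φ) a.swap b.swap := by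
  simpa [Simple, hφ.swap] using hab

lemma Simple.pos {φ : ι ⊕ ι → ℤ} {a b : ι ⊕ ι} (hab : Simple φ a b) : 0 < φ a + φ b := by
  rcases hab with hab | hab <;> omega

lemma Simple.ne_swap {φ : ι ⊕ ι → ℤ} (hφ : Height φ) {a b : ι ⊕ ι} (hab : Simple φ a b) :
    b ≠ a.swap := hφ.ne_swap_iff.2 hab.pos.ne'

/-- The unipotent radical of the minimal parabolic of a root. -/
def radical (φ : ι ⊕ ι → ℤ) (a b : ι ⊕ ι) : Subgroup E :=
  rootGroup h fun c d => 0 < φ c + φ d ∧ ¬ (c = a ∧ d = b) ∧ ¬ (c = b ∧ d = a)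

variable {φ : ι ⊕ ι → ℤ} {a b : ι ⊕ ι}

lemma radical_le : radical h φ a b ≤ unip h φ :=
  rootGroup_le h fun _ _ t hab hP => X_mem_rootGroup h hab hP.1 t

lemma cj_T_mem_radical (hφ : Height φ) (hab : Simple φ a b) (t : R) {x : E}
    (hx : x ∈ radical h φ a b) : h.cj (T a b t) x ∈ radical h φ a b := by
  refine cj_mem_rootGroup h (fun c d u hcd hP => ?_) hx
  have hpos := hab.pos
  have hc := hφ.ne_zero c
  have hd := hφ.ne_zero d
  simp only [hφ.eq_iff] at hP
  refine cj_T_X_mem h (hab.ne_swap hφ) hcd ?_ ?_ _ (fun c' d' v hcd'' hR => ?_) t u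
  · rintro ⟨rfl, rfl⟩
    simp only [hφ.swap] at hP
    omega
  · rintro ⟨rfl, rfl⟩
    simp only [hφ.swap] at hP
    omega
  · refine X_mem_rootGroup h hcd'' ?_ v
    have hc' := hφ.ne_zero c'
    have hd' := hφ.ne_zero d'
    simp only [RT, St, hφ.eq_iff, hφ.swap] at hR ⊢
    rcases hab with hab | hab <;> omega

lemma cj_T_swap_mem_radical (hφ : Height φ) (hab : Simple φ a b) (t : R) {x : E}
    (hx : x ∈ radical h φ a b) : h.cj (T a.swap b.swap t) x ∈ radical h φ a b := by
  refine cj_mem_rootGroup h (fun c d u hcd hP => ?_) hx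
  have hpos := hab.pos
  have hc := hφ.ne_zero c
  have hd := hφ.ne_zero d
  have hab' := hab.ne_swap hφ
  simp only [hφ.eq_iff] at hP
  refine cj_T_X_mem h (by grind) hcd ?_ ?_ _ (fun c' d' v hcd'' hR => ?_) t u
  · rintro ⟨rfl, rfl⟩
    simp only [hφ.swap] at hP
    omega
  · rintro ⟨rfl, rfl⟩
    simp only [hφ.swap] at hP
    omega
  · refine X_mem_rootGroup h hcd'' ?_ v
    have hc' := hφ.ne_zero c'
    have hd' := hφ.ne_zero d'
    simp only [RT, St, hφ.eq_iff, hφ.swap] at hR ⊢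
    rcases hab with hab | hab <;> omega

lemma exists_of_mem_unip (hφ : Height φ) (hab : Simple φ a b) {x : E} (hx : x ∈ unip h φ) :
    ∃ q ∈ radical h φ a b, ∃ t, x = q * X h a b t := by
  refine exists_of_mem_rootGroup h (hab.ne_swap hφ) (fun c d hP => ?_)
    (fun t x hx => cj_T_mem_radical h hφ hab t hx) hx
  tauto

/-- The elements of the form `v * t * u * v'` with `v`, `v'` negative unipotent, `t` in the torus
and `u` positive unipotent. -/
def BigCell (φ : ι ⊕ ι → ℤ) (z : E) : Prop :=
  ∃ v ∈ unip h (-φ), ∃ t ∈ torus h, ∃ u ∈ unip h φ, ∃ v' ∈ unip h (-φ), z = v * t * u * v'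

variable [HasNonsquareSum R] [IsLocalRing R]

lemma BigCell.mul_X (hφ : Height φ) (hab : Simple φ a b) {z : E} (hz : BigCell h φ z) (s : R) :
    BigCell h φ (z * X h a b s) := by
  have hab' := hab.ne_swap hφ
  have hab'' : b.swap ≠ a.swap.swap := by grind
  have hneg := hab.neg hφ
  obtain ⟨v, hv, t, ht, u, hu, v', hv', rfl⟩ := hz
  obtain ⟨q, hq, p, rfl⟩ := exists_of_mem_unip h hφ hab hu
  obtain ⟨q', hq', r, hr⟩ := exists_of_mem_unip h hφ.neg hneg (inv_mem hv')
  obtain ⟨p₁, hp₁⟩ := X_eq_xE h a b p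
  obtain ⟨s₁, hs₁⟩ := X_eq_xE h a b s
  have hyE : ∀ r, ∃ r', X h a.swap b.swap r = yE h a b r' := by
    intro r
    obtain ⟨r₁, hr₁⟩ := X_eq_xE h a.swap b.swap r
    refine ⟨ep a * ep b * r₁, ?_⟩
    rw [hr₁, yE]
    congr 1
    linear_combination (-r₁ * ep b * ep b) * ep_mul_self (R := R) a - r₁ * ep_mul_self (R := R) b
  have hyE' : ∀ r, ∃ r', yE h a b r = X h a.swap b.swap r' := fun r => ⟨_, rfl⟩
  obtain ⟨r₁, hr₁⟩ := hyE (-r)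
  have hv'' : v' = yE h a b r₁ * q'⁻¹ := by
    rw [← hr₁, X_neg h hab'', ← _root_.mul_inv_rev, ← hr, inv_inv]
  obtain ⟨p', m, r', k, hk, hcell⟩ := (rankOne h hab').cell_x_y_x (H := torus h)
    (wE_mul_mem h hab') (fun k hk s => xE_mul_torus h hk hab' s)
    (fun k hk s => by
      obtain ⟨s', hs'⟩ := torus_mul_xE h hk hab'' (ep a * ep b * s)
      refine ⟨ep a * ep b * s', ?_⟩
      rw [yE, hs', yE]
      congr 2
      linear_combination (-s' * ep b * ep b) * ep_mul_self (R := R) a - s' * ep_mul_self (R := R) b)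
    p₁ r₁ s₁
  have hq'' : (xE h a b s₁)⁻¹ * q'⁻¹ * xE h a b s₁ ∈ radical h (-φ) a.swap b.swap := by
    have := cj_T_swap_mem_radical h hφ.neg hneg (-s) (inv_mem hq')
    simp only [Sum.swap_swap] at this
    rwa [cj_T h hab', X_neg h hab', inv_inv, hs₁] at this
  obtain ⟨p₂, hp₂⟩ := hyE' p'
  have hq₃ : (yE h a b p')⁻¹ * q * yE h a b p' ∈ radical h φ a b := by
    have := cj_T_swap_mem_radical h hφ hab (-p₂) hq
    rwa [cj_T h hab'', X_neg h hab'', inv_inv, ← hp₂] at this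
  obtain ⟨p₃, hp₃⟩ := torus_conj_X h ht hab'' p₂
  have hq₄ := torus_conj_mem h (inv_mem hk) hq₃
  rw [inv_inv] at hq₄
  have hy : ∀ r, X h a.swap b.swap r ∈ unip h (-φ) := fun r =>
    X_mem_rootGroup h hab'' hneg.pos r
  have hx : ∀ r, xE h a b r ∈ unip h φ := fun r => X_mem_rootGroup h hab' hab.pos _
  obtain ⟨r₂, hr₂⟩ := hyE' r'
  refine ⟨v * X h a.swap b.swap p₃, mul_mem hv (hy _), t * k, mul_mem ht hk,
    k⁻¹ * ((yE h a b p')⁻¹ * q * yE h a b p') * k * xE h a b m, mul_mem (radical_le h hq₄) (hx _),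
    yE h a b r' * ((xE h a b s₁)⁻¹ * q'⁻¹ * xE h a b s₁),
    mul_mem (hr₂ ▸ hy _) (radical_le h hq''), ?_⟩
  calc v * t * (q * X h a b p) * v' * X h a b s
      = v * t * q * (xE h a b p₁ * yE h a b r₁ * xE h a b s₁) *
          ((xE h a b s₁)⁻¹ * q'⁻¹ * xE h a b s₁) := by
        rw [hv'', hp₁, hs₁]; group
    _ = _ := by
        rw [hcell, ← hp₃, ← hp₂]; group

/-- The subgroup generated by the negative unipotent group and the simple root subgroups. -/
def splitting (φ : ι ⊕ ι → ℤ) : Subgroup E :=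
  Subgroup.closure ((unip h (-φ) : Set E) ∪ {x | ∃ a b t, Simple φ a b ∧ x = X h a b t})

lemma unip_neg_le_splitting : unip h (-φ) ≤ splitting h φ :=
  fun _ hx => Subgroup.subset_closure (Or.inl hx)

lemma X_mem_splitting_of_simple (hab : Simple φ a b) (t : R) : X h a b t ∈ splitting h φ :=
  Subgroup.subset_closure (Or.inr ⟨a, b, t, hab, rfl⟩)

lemma bigCell_of_mem_splitting (hφ : Height φ) {x : E} (hx : x ∈ splitting h φ) :
    BigCell h φ x := by
  have hV : ∀ z, BigCell h φ z → ∀ v ∈ unip h (-φ), BigCell h φ (z * v) := by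
    rintro _ ⟨v, hv, t, ht, u, hu, v', hv', rfl⟩ w hw
    exact ⟨v, hv, t, ht, u, hu, v' * w, mul_mem hv' hw, by group⟩
  rw [splitting] at hx
  induction hx using Subgroup.closure_induction_right with
  | one => exact ⟨1, one_mem _, 1, one_mem _, 1, one_mem _, 1, one_mem _, by simp⟩
  | mul_right x _ y hy ih =>
    rcases hy with hy | ⟨a, b, t, hab, rfl⟩
    · exact hV _ ih _ hy
    · exact ih.mul_X h hφ hab t
  | mul_inv_cancel x _ y hy ih =>
    rcases hy with hy | ⟨a, b, t, hab, rfl⟩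
    · exact hV _ ih _ (inv_mem hy)
    · rw [← X_neg h (hab.ne_swap hφ)]
      exact ih.mul_X h hφ hab _

lemma splitting_inf_ker (hφ : Height φ) {f : ι ⊕ ι → ℤ} (hf : SidonHeight φ f) {x : E}
    (hx : x ∈ splitting h φ) (hx1 : π x = 1) : x = 1 := by
  obtain ⟨v, hv, t, ht, u, hu, v', hv', rfl⟩ := bigCell_of_mem_splitting h hφ hx
  have h1 := triple_eq_one h hφ hf (mul_mem hv' hv) ht hu (by
    have h2 := congrArg (fun g => π v' * g * (π v')⁻¹) hx1
    simpa [mul_assoc] using h2)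
  have h2 := congrArg (fun g => v'⁻¹ * g * v') h1
  simpa [mul_assoc] using h2

end BigCell

section FinHeight

variable {g : ℕ}

/-- The standard height function. -/
def ht : Fin g ⊕ Fin g → ℤ := Sum.elim (fun i => (i : ℤ) + 1) fun i => -((i : ℤ) + 1)

lemma height_ht : Height (ht : Fin g ⊕ Fin g → ℤ) where
  swap c := by rcases c with i | i <;> simp [ht]
  inj c d := by
    rcases c with i | i <;> rcases d with j | j <;> simp [ht] <;> omega

/-- The coefficient of a signed index at an index. -/
def cf (c : Fin g ⊕ Fin g) (i : Fin g) : ℤ :=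
  Sum.elim (fun j => if j = i then 1 else 0) (fun j => if j = i then -1 else 0) c

/-- A height function separating all roots. -/
def fht (c : Fin g ⊕ Fin g) : ℤ :=
  Sum.elim (fun i : Fin g => 5 ^ (i : ℕ)) (fun i : Fin g => -5 ^ (i : ℕ)) c

lemma fht_eq_sum (c : Fin g ⊕ Fin g) : fht c = ∑ i : Fin g, cf c i * 5 ^ (i : ℕ) := by
  rcases c with i | i <;> simp [fht, cf]

lemma eq_zero_of_sum_five_pow : ∀ {n : ℕ} (c : Fin n → ℤ), (∀ i, |c i| ≤ 4) →
    ∑ i, c i * 5 ^ (i : ℕ) = 0 → ∀ i, c i = 0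
  | 0, _, _, _, i => i.elim0
  | n + 1, c, hc, hs, i => by
    have h1 : ∑ i : Fin n, c i.succ * 5 ^ ((i.succ : Fin (n + 1)) : ℕ) =
        5 * ∑ i : Fin n, c i.succ * 5 ^ (i : ℕ) := by
      rw [Finset.mul_sum]
      refine Finset.sum_congr rfl fun i _ => ?_
      rw [Fin.val_succ, pow_succ]
      ring
    rw [Fin.sum_univ_succ, h1] at hs
    have h0 := abs_le.1 (hc 0)
    simp only [Fin.val_zero, pow_zero, mul_one] at hs
    have hc0 : c 0 = 0 := by omega
    have ih := eq_zero_of_sum_five_pow (fun i => c i.succ) (fun i => hc _) (by omega)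
    exact Fin.cases hc0 ih i

lemma fht_strictMono {c d : Fin g ⊕ Fin g} (hcd : ht c < ht d) : fht c < fht d := by
  rcases c with i | i <;> rcases d with j | j <;> simp only [ht, fht, Sum.elim_inl, Sum.elim_inr]
    at hcd ⊢
  · exact pow_lt_pow_right₀ (by norm_num) (by omega)
  · omega
  · have h1 : (0 : ℤ) < 5 ^ (i : ℕ) := by positivity
    have h2 : (0 : ℤ) < 5 ^ (j : ℕ) := by positivity
    omega
  · exact neg_lt_neg (pow_lt_pow_right₀ (by norm_num) (by omega))

lemma fht_lt_iff {c d : Fin g ⊕ Fin g} : fht c < fht d ↔ ht c < ht d := by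
  refine ⟨fun h1 => ?_, fht_strictMono⟩
  by_contra h2
  rcases (not_lt.1 h2).lt_or_eq with h3 | h3
  · exact absurd (fht_strictMono h3) (by omega)
  · rw [height_ht.inj _ _ h3] at h1
    exact lt_irrefl _ h1

lemma fht_swap (c : Fin g ⊕ Fin g) : fht c.swap = -fht c := by
  rcases c with i | i <;> simp [fht]

lemma sidonHeight_fht : SidonHeight (ht : Fin g ⊕ Fin g → ℤ) fht where
  height := ⟨fht_swap, fun c d hcd => height_ht.inj _ _ (by
    rcases lt_trichotomy (ht c) (ht d) with h1 | h1 | h1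
    · exact absurd (fht_strictMono h1) (by omega)
    · exact h1
    · exact absurd (fht_strictMono h1) (by omega))⟩
  sidon a b c d hab hcd hs := by
    have h1 : ∀ i, cf a i + cf b i - cf c i - cf d i = 0 := by
      refine eq_zero_of_sum_five_pow _ (fun i => ?_) ?_
      · have hx : ∀ x : Fin g ⊕ Fin g, -1 ≤ cf x i ∧ cf x i ≤ 1 := by
          intro x
          rcases x with j | j <;> simp only [cf, Sum.elim_inl, Sum.elim_inr] <;> split_ifs <;> simp
        have := hx a
        have := hx b
        have := hx c
        have := hx d
        rw [abs_le]
        omega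
      · simp only [sub_mul, add_mul, Finset.sum_sub_distrib, Finset.sum_add_distrib,
          ← fht_eq_sum]
        omega
    have ha := h1 (Sum.elim id id a)
    have hb := h1 (Sum.elim id id b)
    have hc := h1 (Sum.elim id id c)
    have hd := h1 (Sum.elim id id d)
    rcases a with i | i <;> rcases b with j | j <;> rcases c with k | k <;> rcases d with m | m <;>
      simp [cf] at ha hb hc hd hab hcd ⊢ <;> grind
  pos_iff c d := by
    have h1 := @fht_lt_iff g c.swap d
    rw [fht_swap, height_ht.swap] at h1
    omega

end FinHeight

section Split

variable {g : ℕ} {R : Type*} [CommRing R] [IsCyclicRing R]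
  {E : Type*} [Group E] {l : ℕ} {π : E →* symplecticGroup (Fin g) R} (h : IsOddCentralExt l π)
  [Fact (2 < Fintype.card (Fin g))] [Invertible (2 : R)] [IsCyclic Rˣ] [HasNonsquareSum R]
  [IsLocalRing R]

lemma wE_mem {a b : Fin g ⊕ Fin g} {K : Subgroup E} (hX : ∀ t, X h a b t ∈ K)
    (hY : ∀ t, X h a.swap b.swap t ∈ K) (u : Rˣ) : wE h a b u ∈ K :=
  mul_mem (mul_mem (hX _) (hY _)) (hX _)

lemma X_mem_of_ws {a b c d : Fin g ⊕ Fin g} (hab : b ≠ a.swap) (hcd : d ≠ c.swap) {K : Subgroup E}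
    (hw : wE h a b 1 ∈ K) (hX : ∀ t, X h (ws a b c) (ws a b d) t ∈ K) (t : R) : X h c d t ∈ K := by
  have h1 : wE h a b 1 * X h c d t * (wE h a b 1)⁻¹ ∈ K := by
    rw [← h.cj_map, pi_wE h hab, (mono_wG hab 1).cj_X h hcd]
    exact hX _
  exact (K.mul_mem_cancel_left hw).1 ((K.mul_mem_cancel_right (inv_mem hw)).1 h1)

lemma X_mem_splitting {a b : Fin g ⊕ Fin g} (hab : b ≠ a.swap) (t : R) :
    X h a b t ∈ splitting h ht := by
  have hneg : ∀ a b : Fin g ⊕ Fin g, ht a + ht b < 0 → ∀ t, X h a b t ∈ splitting h ht :=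
    fun a b hab t => unip_neg_le_splitting h
      (X_mem_rootGroup h (height_ht.ne_swap_iff.2 hab.ne) (by simp only [Pi.neg_apply]; omega) t)
  have hlong : ∀ n : ℕ, ∀ hn : n < g, ∀ t,
      X h (Sum.inl ⟨n, hn⟩) (Sum.inl ⟨n, hn⟩) t ∈ splitting h ht := by
    intro n
    induction n with
    | zero =>
      intro hn t
      exact X_mem_splitting_of_simple h (Or.inr (by simp [ht])) t
    | succ n ih =>
      intro hn t
      have hs : Simple ht (Sum.inl (⟨n + 1, hn⟩ : Fin g)) (Sum.inr (⟨n, by omega⟩ : Fin g)) := by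
        left
        simp [ht]
        omega
      refine X_mem_of_ws h (hs.ne_swap height_ht) (by simp) (wE_mem h
        (X_mem_splitting_of_simple h hs) (hneg _ _ ?_) 1) ?_ t
      · simp [ht]
        omega
      · simpa [ws] using ih _
  have hw : ∀ i : Fin g, wE h (Sum.inl i) (Sum.inl i) 1 ∈ splitting h ht := fun i =>
    wE_mem h (hlong i i.2) (hneg _ _ (by simp only [ht, Sum.swap_inl, Sum.elim_inr]; omega)) 1
  have hrr : ∀ i j : Fin g, ∀ t, X h (Sum.inr i) (Sum.inr j) t ∈ splitting h ht := fun i j =>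
    hneg _ _ (by simp only [ht, Sum.elim_inr]; omega)
  have hlr : ∀ i j : Fin g, i ≠ j → ∀ t, X h (Sum.inl i) (Sum.inr j) t ∈ splitting h ht := by
    intro i j hij t
    refine X_mem_of_ws h (a := Sum.inl i) (b := Sum.inl i) (by simp) (by simpa using hij.symm)
      (hw i) (fun t => ?_) t
    simpa [ws, hij, hij.symm] using hrr i j t
  rcases a with i | i <;> rcases b with j | j
  · refine X_mem_of_ws h (a := Sum.inl j) (b := Sum.inl j) (by simp) hab (hw j) (fun t => ?_) t
    by_cases hij : i = j
    · subst hij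
      simpa [ws] using hrr i i t
    · simpa [ws, hij] using hlr i j hij t
  · exact hlr i j (by grind) t
  · have hij : j ≠ i := by grind
    rw [X_symm h hab]
    exact hlr j i hij t
  · exact hrr i j t

end Split

section Generation

variable {ι R : Type*} [Fintype ι] [DecidableEq ι] [CommRing R]

variable (R) in
/-- The subgroup generated by the root elements supported on a set of indices. -/
def elem (s : Finset ι) : Subgroup (symplecticGroup ι R) :=
  Subgroup.closure {x | ∃ a b t, b ≠ a.swap ∧ ix a ∈ s ∧ ix b ∈ s ∧ x = T a b t}

lemma T_mem_elem {s : Finset ι} {a b : ι ⊕ ι} (hab : b ≠ a.swap) (ha : ix a ∈ s) (hb : ix b ∈ s)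
    (t : R) : T a b t ∈ elem R s := Subgroup.subset_closure ⟨a, b, t, hab, ha, hb, rfl⟩

lemma elem_mono {s s' : Finset ι} (hs : s ⊆ s') : elem R s ≤ elem R s' := by
  rw [elem, Subgroup.closure_le]
  rintro _ ⟨a, b, t, hab, ha, hb, rfl⟩
  exact T_mem_elem hab (hs ha) (hs hb) t

lemma act_e_of_mem_elem {s : Finset ι} {k : symplecticGroup ι R} (hk : k ∈ elem R s) {c : ι ⊕ ι}
    (hc : ix c ∉ s) : act k (e c) = e c := by
  rw [elem] at hk
  induction hk using Subgroup.closure_induction'' with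
  | one => simp
  | mem x hx =>
    obtain ⟨a, b, t, hab, ha, hb, rfl⟩ := hx
    exact act_T_of_ne hab (by grind) (by grind) t
  | inv_mem x hx =>
    obtain ⟨a, b, t, hab, ha, hb, rfl⟩ := hx
    rw [← T_neg hab]
    exact act_T_of_ne hab (by grind) (by grind) _
  | mul x y _ _ hx hy => rw [act_mul, hy, hx]

/-- Clearing all coordinates but two, with a unit pivot. -/
lemma exists_clear {s : Finset ι} {a : ι ⊕ ι} (ha : ix a ∈ s) {v : ι ⊕ ι → R}
    (hv : ∀ c, ix c ∉ s → v c = 0) (hu : IsUnit (v a.swap)) (D : Finset (ι ⊕ ι)) :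
    ∃ k ∈ elem R s, act k (e a) = e a ∧ act k v a.swap = v a.swap ∧
      (∀ c ∈ D, ix c ≠ ix a → act k v c = 0) ∧ ∀ c ∉ D, c ≠ a → act k v c = v c := by
  induction D using Finset.induction_on with
  | empty => exact ⟨1, one_mem _, by simp⟩
  | insert c D hc ih =>
    obtain ⟨k, hk, h1, h2, h3, h4⟩ := ih
    by_cases hca : ix c = ix a
    · refine ⟨k, hk, h1, h2, ?_, fun d hd => h4 d (by grind)⟩
      intro d hd hda
      exact h3 d (by grind) hda
    by_cases hcs : ix c ∈ s
    · obtain ⟨u, hu'⟩ := hu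
      have hac : c ≠ a.swap := ne_swap_of_ix hca
      refine ⟨T a c (-(ep a * ((u⁻¹ : Rˣ) : R) * act k v c)) * k,
        mul_mem (T_mem_elem hac ha hcs _) hk, ?_, ?_, ?_, ?_⟩
      · rw [act_mul, h1, act_T_of_ne hac (by grind) (by grind)]
      · have hac' : a.swap ≠ c := fun h => hac h.symm
        simp [act_mul, act_T hac, e_apply, hac', swap_ne, h2]
      · intro d hd hda
        have hda' : d ≠ a := ne_of_ix hda
        by_cases hdc : d = c
        · subst hdc
          simp only [act_mul, act_T hac, e_apply, hda', h2, ← hu', Pi.add_apply, Pi.smul_apply,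
            if_true, if_false, smul_eq_mul, mul_zero, add_zero, mul_one]
          have := Units.inv_mul u
          linear_combination (-act k v d * (((u⁻¹ : Rˣ) : R) * u)) * ep_mul_self (R := R) a -
            act k v d * this
        · simp [act_mul, act_T hac, e_apply, hda', hdc, h3 d (by grind) hda]
      · intro d hd hda
        have hdc : d ≠ c := by grind
        simp [act_mul, act_T hac, e_apply, hda, hdc, h4 d (by grind) hda]
    · refine ⟨k, hk, h1, h2, ?_, fun d hd => h4 d (by grind)⟩
      intro d hd hda
      by_cases hdc : d = c
      · subst hdc
        rw [h4 d hc (ne_of_ix hda), hv d hcs]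
      · exact h3 d (by grind) hda

variable [Invertible (2 : R)]

lemma exists_clear_eq {s : Finset ι} {a : ι ⊕ ι} (ha : ix a ∈ s) {v : ι ⊕ ι → R}
    (hv : ∀ c, ix c ∉ s → v c = 0) (hu : IsUnit (v a.swap)) (r : R) :
    ∃ k ∈ elem R s, act k (e a) = e a ∧ act k v = v a.swap • e a.swap + r • e a := by
  obtain ⟨k, hk, h1, h2, h3, -⟩ := exists_clear ha hv hu Finset.univ
  obtain ⟨u, hu'⟩ := hu
  refine ⟨T a a (⅟2 * ep a * ((u⁻¹ : Rˣ) : R) * (r - act k v a)) * k,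
    mul_mem (T_mem_elem (swap_ne a).symm ha ha _) hk, ?_, ?_⟩
  · rw [act_mul, h1, act_T_of_ne (swap_ne a).symm (by grind) (by grind)]
  · ext c
    rw [act_mul, act_T (swap_ne a).symm, h2, ← hu']
    have hsw := swap_ne a
    simp only [e_apply, Pi.add_apply, Pi.smul_apply, smul_eq_mul]
    by_cases hca : c = a
    · subst hca
      have h4 := Units.inv_mul u
      simp only [if_true, if_neg hsw.symm, mul_one, mul_zero, zero_add]
      linear_combination ((r - act k v c) * (2 * ⅟2) * (((u⁻¹ : Rˣ) : R) * u)) *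
        ep_mul_self (R := R) c + (r - act k v c) * (2 * ⅟2) * h4 +
        (r - act k v c) * mul_invOf_self (2 : R)
    · by_cases hca' : c = a.swap
      · subst hca'
        simp [h2, hsw, hu']
      · have : ix c ≠ ix a := by
          intro h5
          rcases ix_eq_iff.1 h5 with h6 | h6 <;> contradiction
        simp [h3 c (Finset.mem_univ _) this, hca, hca']

/-- The coordinate opposite to `a` can be made a unit. -/
lemma exists_pivot {s : Finset ι} {a b : ι ⊕ ι} (ha : ix a ∈ s) (hb : ix b ∈ s) {v : ι ⊕ ι → R}
    (hu : IsUnit (v b)) : ∃ k ∈ elem R s, IsUnit (act k v a.swap) := by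
  by_cases hba' : b = a.swap
  · exact ⟨1, one_mem _, by simpa [← hba'] using hu⟩
  obtain ⟨u, hu'⟩ := hu
  have h4 := Units.inv_mul u
  by_cases hba : b = a
  · subst hba
    refine ⟨T b.swap b.swap (-⅟2 * ep b * ((u⁻¹ : Rˣ) : R) * (1 - v b.swap)),
      T_mem_elem (by grind) (by simpa) (by simpa) _, ?_⟩
    convert isUnit_one
    rw [act_T (by grind)]
    simp only [e_apply, Pi.add_apply, Pi.smul_apply, smul_eq_mul, if_true, Sum.swap_swap, ← hu',
      ep_swap]
    linear_combination ((1 - v b.swap) * (2 * ⅟2) * (((u⁻¹ : Rˣ) : R) * u)) *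
        ep_mul_self (R := R) b + (1 - v b.swap) * (2 * ⅟2) * h4 +
        (1 - v b.swap) * mul_invOf_self (2 : R)
  · have hab : b.swap ≠ a.swap := fun h => hba (by rw [← b.swap_swap, h, Sum.swap_swap])
    refine ⟨T a.swap b.swap (-ep b * ((u⁻¹ : Rˣ) : R) * (1 - v a.swap)),
      T_mem_elem (by grind) (by simpa) (by simpa) _, ?_⟩
    convert isUnit_one
    rw [act_T (by grind)]
    simp only [e_apply, Pi.add_apply, Pi.smul_apply, smul_eq_mul, if_true, Sum.swap_swap, ← hu',
      ep_swap, if_neg hab.symm]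
    linear_combination ((1 - v a.swap) * (((u⁻¹ : Rˣ) : R) * u)) *
        ep_mul_self (R := R) b + (1 - v a.swap) * h4

lemma exists_act_eq_e {s : Finset ι} {a b : ι ⊕ ι} (ha : ix a ∈ s) (hb : ix b ∈ s)
    {v : ι ⊕ ι → R} (hu : IsUnit (v b)) (hv : ∀ c, ix c ∉ s → v c = 0) :
    ∃ k ∈ elem R s, act k v = e a := by
  obtain ⟨k, hk, hku⟩ := exists_pivot ha hb hu
  have hv' : ∀ c, ix c ∉ s → act k v c = 0 := by
    intro c hc
    have h1 := om_act k v (e c.swap)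
    rw [act_e_of_mem_elem hk (by simpa), om_e_right, om_e_right, Sum.swap_swap, hv c hc] at h1
    have h2 := congrArg (fun x => ep c.swap * x) h1
    simpa [← mul_assoc, ep_mul_self] using h2
  obtain ⟨k', hk', -, hk''⟩ := exists_clear_eq ha hv' hku 1
  set r := act k v a.swap
  refine ⟨T a.swap a.swap (⅟2 * ep a * r) * k' * k, mul_mem (mul_mem (T_mem_elem (by grind)
    (by simpa) (by simpa) _) hk') hk, ?_⟩
  rw [act_mul, act_mul, hk'', act_add, act_smul, act_smul, act_T_of_ne (by grind) (by grind)
    (by grind)]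
  have h3 := act_T_long a.swap (⅟2 * ep a * r)
  rw [Sum.swap_swap] at h3
  rw [h3, one_smul, add_left_comm, ← add_smul, ep_swap]
  have h4 : r + 2 * (⅟2 * ep a * r) * -ep a = 0 := by
    linear_combination (-2 * ⅟2 * r) * ep_mul_self (R := R) a - r * mul_invOf_self (2 : R)
  rw [h4, zero_smul, add_zero]

variable [IsLocalRing R]

lemma exists_isUnit_act (g : symplecticGroup ι R) (a : ι ⊕ ι) : ∃ b, IsUnit (act g (e a) b) := by
  by_contra! hc
  have h1 := om_act g (e a.swap) (e a)
  rw [om_swap_self, om_eq] at h1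
  have h2 : (ep a : R) ∈ IsLocalRing.maximalIdeal R := by
    rw [← h1]
    exact Ideal.sum_mem _ fun i _ => Ideal.sub_mem _ (Ideal.mul_mem_left _ _ (hc _))
      (Ideal.mul_mem_left _ _ (hc _))
  have h3 : IsUnit (ep a : R) := .of_mul_eq_one _ (ep_mul_self a)
  exact h2 h3

/-- The symplectic group of a local ring is generated by root elements. -/
lemma mem_elem (s : Finset ι) (g : symplecticGroup ι R)
    (hg : ∀ c, ix c ∉ s → act g (e c) = e c) : g ∈ elem R s := by
  induction s using Finset.induction_on generalizing g with
  | empty =>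
    have : g = 1 := ext_act fun c => by rw [hg c (by simp), act_one]
    rw [this]
    exact one_mem _
  | insert i s his ih =>
    have hsupp : ∀ (g : symplecticGroup ι R) (a : ι ⊕ ι), ix a ∈ insert i s →
        (∀ c, ix c ∉ insert i s → act g (e c) = e c) →
        ∀ c, ix c ∉ insert i s → act g (e a) c = 0 := by
      intro g a ha hg c hc
      have h1 := om_act g (e a) (e c.swap)
      have h2 : a ≠ c := fun h => hc (h ▸ ha)
      rw [hg c.swap (by simpa using hc), om_e_right, om_e_right, Sum.swap_swap, e_apply,
        if_neg h2.symm, mul_zero] at h1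
      have h2 := congrArg (fun x => ep c.swap * x) h1
      simpa [← mul_assoc, ep_mul_self] using h2
    have hi : ix (Sum.inl i : ι ⊕ ι) ∈ insert i s := by simp
    obtain ⟨b, hb⟩ := exists_isUnit_act g (Sum.inl i)
    have hb' : ix b ∈ insert i s := by
      by_contra hc
      rw [hsupp g _ hi hg b hc] at hb
      exact not_isUnit_zero hb
    obtain ⟨k, hk, hk1⟩ := exists_act_eq_e hi hb' hb (hsupp g _ hi hg)
    rw [← act_mul] at hk1
    have hkg : ∀ c, ix c ∉ insert i s → act (k * g) (e c) = e c := fun c hc => by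
      rw [act_mul, hg c hc, act_e_of_mem_elem hk hc]
    have hw : act (k * g) (e (Sum.inl i : ι ⊕ ι).swap) (Sum.inl i : ι ⊕ ι).swap = 1 := by
      have h1 := om_act (k * g) (e (Sum.inl i : ι ⊕ ι).swap) (e (Sum.inl i))
      rw [hk1, om_e_right, om_swap_self] at h1
      simpa using h1
    obtain ⟨k', hk', h1, h2⟩ := exists_clear_eq hi (hsupp (k * g) (Sum.inl i : ι ⊕ ι).swap hi hkg)
      (by rw [hw]; exact isUnit_one) 0
    rw [hw, one_smul, zero_smul, add_zero, ← act_mul] at h2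
    have h3 : k' * (k * g) ∈ elem R s := by
      refine ih _ fun c hc => ?_
      by_cases hci : ix c = i
      · rcases ix_eq_iff.1 (hci.trans (ix_inl i).symm) with rfl | rfl
        · rw [act_mul, hk1, h1]
        · exact h2
      · have hc' : ix c ∉ insert i s := by simp [hci, hc]
        rw [act_mul, hkg c hc', act_e_of_mem_elem hk' hc']
    have h4 := elem_mono (Finset.subset_insert i s) h3
    exact ((elem R _).mul_mem_cancel_left hk).1 (((elem R _).mul_mem_cancel_left hk').1 h4)

lemma elem_univ_eq_top : elem R (Finset.univ : Finset ι) = ⊤ :=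
  top_unique fun g _ => mem_elem _ g fun _ hc => absurd (Finset.mem_univ _) hc

end Generation

section Split

/-- Every central extension of exponent `l` splits, for odd `l`. -/
def AllSplit.{u} (G : Type*) [Group G] : Prop :=
  ∀ (l : ℕ) (E : Type u) [Group E] (π : E →* G), IsOddCentralExt l π →
    ∃ σ : G →* E, ∀ x, π (σ x) = x

theorem allSplit_symplecticGroup.{u} {g : ℕ} (hg : 2 < g) {R : Type*} [CommRing R] [IsCyclicRing R]
    [Invertible (2 : R)] [IsCyclic Rˣ] [HasNonsquareSum R] [IsLocalRing R] :
    AllSplit.{u} (symplecticGroup (Fin g) R) := by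
  intro l E _ π h
  have : Fact (2 < Fintype.card (Fin g)) := ⟨by simpa⟩
  let ρ : splitting h (ht : Fin g ⊕ Fin g → ℤ) →* symplecticGroup (Fin g) R :=
    π.comp (Subgroup.subtype _)
  have hinj : Function.Injective ρ := (injective_iff_map_eq_one ρ).2 fun x hx =>
    Subtype.ext (splitting_inf_ker h height_ht sidonHeight_fht x.2 hx)
  have hsurj : Function.Surjective ρ := by
    rw [← MonoidHom.range_eq_top, ← top_le_iff, ← elem_univ_eq_top, elem, Subgroup.closure_le]
    rintro _ ⟨a, b, t, hab, -, -, rfl⟩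
    exact ⟨⟨X h a b t, X_mem_splitting h hab t⟩, pi_X h hab t⟩
  let ρ' := MulEquiv.ofBijective ρ ⟨hinj, hsurj⟩
  refine ⟨(Subgroup.subtype _).comp ρ'.symm.toMonoidHom, fun x => ?_⟩
  exact ρ'.apply_symm_apply x

end Split

section Perfect

/-- Every homomorphism with commuting values of odd exponent is trivial. -/
def OddPerfect.{u} (G : Type*) [Group G] : Prop :=
  ∀ (l : ℕ) (E : Type u) [Group E] (f : G →* E), Odd l → (∀ x y, f x * f y = f y * f x) →
    (∀ x, f x ^ l = 1) → ∀ x, f x = 1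

lemma eq_one_of_eq_inv {E : Type*} [Group E] {l : ℕ} (hl : Odd l) {x : E} (hx : x ^ l = 1)
    (hx' : x = x⁻¹) : x = 1 := by
  obtain ⟨k, rfl⟩ := hl
  have h2 : x ^ 2 = 1 := by rw [pow_two, mul_eq_one_iff_eq_inv]; exact hx'
  rwa [pow_succ, pow_mul, h2, one_pow, one_mul] at hx

theorem oddPerfect_symplecticGroup.{u} {g : ℕ} (hg : 2 < g) {R : Type*} [CommRing R]
    [Invertible (2 : R)] [IsLocalRing R] :
    OddPerfect.{u} (symplecticGroup (Fin g) R) := by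
  intro l E _ f hl hcomm hpow
  have : Fact (2 < Fintype.card (Fin g)) := ⟨by simpa⟩
  have hconj : ∀ x y, f (x * y * x⁻¹) = f y := fun x y => by
    rw [map_mul, map_mul, hcomm x y, mul_assoc, ← map_mul, mul_inv_cancel, map_one, mul_one]
  have hshort : ∀ (a b : Fin g ⊕ Fin g) (t : R), ix a ≠ ix b → f (T a b t) = 1 := by
    intro a b t hab
    refine eq_one_of_eq_inv hl (hpow _) ?_
    rw [← map_inv, ← dd_inv_T hab, hconj]
  have hlong : ∀ (b : Fin g ⊕ Fin g) (t : R), f (T b b t) = 1 := by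
    intro b t
    obtain ⟨a, hba, -⟩ := exists_third b b
    have hab := hba.symm
    have h1 : T a b t * T a.swap b (ep a) * (T a b t)⁻¹ = T a.swap b (ep a) * T b b t := by
      have hab' : b ≠ a.swap := ne_swap_of_ix hba
      have hab'' : b ≠ a.swap.swap := by simpa using ne_of_ix hba
      rw [conj_T, act_T_swap' hab, act_T_of_ne hab' (by grind) (by grind), smul_add, smul_smul,
        mul_left_comm, ep_mul_self, mul_one, T, T, tau_symm, tau_symm (_ • e a.swap),
        tau_symm (t • e b), tau_mul_tau]
      · rw [om_smul_right, om_e_zero (by grind), mul_zero]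
      · rw [om_smul_right, om_e_zero (by grind), mul_zero]
      · rw [om_smul_right, om_smul_left, om_e_zero hab'', mul_zero, mul_zero]
    have h2 := congrArg f h1
    rw [hconj, map_mul, left_eq_mul] at h2
    exact h2
  have hker : (⊤ : Subgroup (symplecticGroup (Fin g) R)) ≤ f.ker := by
    rw [← elem_univ_eq_top, elem, Subgroup.closure_le]
    rintro _ ⟨a, b, t, hab, -, -, rfl⟩
    rcases eq_or_short hab with rfl | hab'
    exacts [hlong _ _, hshort _ _ _ hab']
  exact fun x => hker (Subgroup.mem_top x)

/-- Groups without odd abelian quotients whose odd central extensions split. -/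
def Good.{u} (G : Type*) [Group G] : Prop := AllSplit.{u} G ∧ OddPerfect.{u} G

lemma Good.of_mulEquiv.{u} {G H : Type*} [Group G] [Group H] (i : G ≃* H) (hG : Good.{u} G) :
    Good.{u} H := by
  refine ⟨fun l E _ π hπ => ?_, fun l E _ f hl hcomm hpow x => ?_⟩
  · have hk : ∀ x, x ∈ (i.symm.toMonoidHom.comp π).ker → x ∈ π.ker := fun x hx => by
      simpa [MonoidHom.mem_ker] using hx
    obtain ⟨σ, hσ⟩ := hG.1 l E (i.symm.toMonoidHom.comp π)
      ⟨i.symm.surjective.comp hπ.surj, hπ.odd, fun a ha => hπ.comm a (hk a ha),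
        fun a ha => hπ.pow a (hk a ha)⟩
    exact ⟨σ.comp i.symm.toMonoidHom, fun x => i.symm.injective (hσ (i.symm x))⟩
  · have := hG.2 l E (f.comp i.toMonoidHom) hl (fun _ _ => hcomm _ _) (fun _ => hpow _) (i.symm x)
    simpa using this

/-- Splitting of the restriction of a central extension to a subgroup. -/
lemma AllSplit.exists_lift.{u} {G H : Type*} [Group G] [Group H] (hG : AllSplit.{u} G) {l : ℕ}
    {E : Type u} [Group E] {π : E →* H} (hπ : IsOddCentralExt l π) (j : G →* H)
    (hj : Function.Injective j) : ∃ σ : G →* E, ∀ x, π (σ x) = j x := by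
  let i := MonoidHom.ofInjective hj
  let π' : j.range.comap π →* j.range := π.subgroupComap j.range
  have hmem : ∀ x : j.range.comap π, π' x = 1 → (x : E) ∈ π.ker := fun x hx =>
    congrArg Subtype.val hx
  obtain ⟨σ, hσ⟩ := hG l (j.range.comap π) (i.symm.toMonoidHom.comp π')
    { surj := by
        refine i.symm.surjective.comp ?_
        rintro ⟨y, hy⟩
        obtain ⟨x, rfl⟩ := hπ.surj y
        exact ⟨⟨x, hy⟩, rfl⟩
      odd := hπ.odd
      comm := fun a ha x => Subtype.ext (hπ.comm _ (hmem a (by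
        simpa [MonoidHom.mem_ker] using ha)) _)
      pow := fun a ha => Subtype.ext (hπ.pow _ (hmem a (by
        simpa [MonoidHom.mem_ker] using ha))) }
  refine ⟨(Subgroup.subtype _).comp σ, fun x => ?_⟩
  have h1 := congrArg i (hσ x)
  have h2 : π' (σ x) = i x := by simpa using h1
  exact congrArg Subtype.val h2

lemma Good.prod.{u} {G H : Type*} [Group G] [Group H] (hG : Good.{u} G) (hH : Good.{u} H) :
    Good.{u} (G × H) := by
  refine ⟨fun l E _ π hπ => ?_, fun l E _ f hl hcomm hpow x => ?_⟩
  · obtain ⟨σ, hσ⟩ := hG.1.exists_lift hπ (MonoidHom.inl G H) fun _ _ h1 => congrArg Prod.fst h1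
    obtain ⟨τ, hτ⟩ := hH.1.exists_lift hπ (MonoidHom.inr G H) fun _ _ h1 => congrArg Prod.snd h1
    have hker : ∀ x y, σ x * τ y * (σ x)⁻¹ * (τ y)⁻¹ ∈ π.ker := fun x y => by
      simp [MonoidHom.mem_ker, hσ, hτ]
    have hcomm : ∀ x y, Commute (σ x) (τ y) := by
      intro x y
      rw [commute_iff_eq]
      let f : G →* E :=
        { toFun := fun x => σ x * τ y * (σ x)⁻¹ * (τ y)⁻¹
          map_one' := by simp
          map_mul' := fun x x' => by
            have h1 := hπ.comm _ (hker x' y) (σ x)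
            calc σ (x * x') * τ y * (σ (x * x'))⁻¹ * (τ y)⁻¹
                = σ x * (σ x' * τ y * (σ x')⁻¹ * (τ y)⁻¹) * τ y * (σ x)⁻¹ * (τ y)⁻¹ := by
                  rw [map_mul]; group
              _ = (σ x' * τ y * (σ x')⁻¹ * (τ y)⁻¹) * (σ x * τ y * (σ x)⁻¹ * (τ y)⁻¹) := by
                  rw [← h1]; group
              _ = _ := hπ.comm _ (hker x' y) _ }
      have h1 : f x = 1 := hG.2 l E f hπ.odd (fun _ _ => hπ.comm _ (hker _ y) _)
        (fun _ => hπ.pow _ (hker _ y)) x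
      have h2 : σ x * τ y * (σ x)⁻¹ * (τ y)⁻¹ = 1 := h1
      rwa [mul_inv_eq_one, mul_inv_eq_iff_eq_mul] at h2
    refine ⟨MonoidHom.noncommCoprod σ τ hcomm, fun x => ?_⟩
    rw [MonoidHom.noncommCoprod_apply, map_mul, hσ, hτ]
    simp
  · have h1 := hG.2 l E (f.comp (MonoidHom.inl G H)) hl (fun _ _ => hcomm _ _) (fun _ => hpow _) x.1
    have h2 := hH.2 l E (f.comp (MonoidHom.inr G H)) hl (fun _ _ => hcomm _ _) (fun _ => hpow _) x.2
    have h3 : x = MonoidHom.inl G H x.1 * MonoidHom.inr G H x.2 := by simp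
    rw [h3, map_mul]
    exact (congrArg₂ (· * ·) h1 h2).trans (one_mul 1)

lemma Good.of_subsingleton.{u} {G : Type*} [Group G] [Subsingleton G] : Good.{u} G :=
  ⟨fun _ _ _ _ _ => ⟨1, fun _ => Subsingleton.elim _ _⟩,
    fun _ _ _ f _ _ _ x => by rw [Subsingleton.elim x 1, map_one]⟩

end Perfect

section CRT

variable {ι R S : Type*} [Fintype ι] [DecidableEq ι] [CommRing R] [CommRing S]

lemma map_J (f : R →+* S) : (J ι R).map f = J ι S := by
  ext i j
  rcases i with i | i <;> rcases j with j | j <;>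
    simp [J, Matrix.one_apply, apply_ite f]

/-- Functoriality of the symplectic group. -/
def mapSp (f : R →+* S) : symplecticGroup ι R →* symplecticGroup ι S where
  toFun M := ⟨(M : Matrix _ _ R).map f, by
    have h1 := congrArg (fun A => A.map f) (SymplecticGroup.mem_iff.1 M.2)
    rw [SymplecticGroup.mem_iff]
    simpa only [Matrix.map_mul, map_J, Matrix.transpose_map] using h1⟩
  map_one' := Subtype.ext (by simp)
  map_mul' M N := Subtype.ext (by simp [Matrix.map_mul])

/-- The symplectic group of a product. -/
noncomputable def prodSp {S' : Type*} [CommRing S'] (i : R ≃+* S × S') :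
    symplecticGroup ι R ≃* symplecticGroup ι S × symplecticGroup ι S' := by
  refine MulEquiv.ofBijective
    ((mapSp ((RingHom.fst S S').comp (i : R →+* S × S'))).prod
      (mapSp ((RingHom.snd S S').comp (i : R →+* S × S')))) ⟨?_, ?_⟩
  · intro M N hMN
    refine Subtype.ext (Matrix.ext fun c d => i.injective (Prod.ext ?_ ?_))
    · exact congrFun (congrFun (congrArg (fun A => (A.1 : Matrix _ _ S)) hMN) c) d
    · exact congrFun (congrFun (congrArg (fun A => (A.2 : Matrix _ _ S')) hMN) c) d
  · rintro ⟨A, B⟩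
    let M : Matrix (ι ⊕ ι) (ι ⊕ ι) R := fun c d => i.symm ((A : Matrix _ _ S) c d,
      (B : Matrix _ _ S') c d)
    have hA : M.map ((RingHom.fst S S').comp (i : R →+* S × S')) = A := by
      refine Matrix.ext fun c d => ?_
      exact congrArg Prod.fst (i.apply_symm_apply _)
    have hB : M.map ((RingHom.snd S S').comp (i : R →+* S × S')) = B := by
      refine Matrix.ext fun c d => ?_
      exact congrArg Prod.snd (i.apply_symm_apply _)
    have hM : M ∈ symplecticGroup ι R := by
      rw [SymplecticGroup.mem_iff]
      refine Matrix.ext fun c d => i.injective (Prod.ext ?_ ?_)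
      · have h1 : (M * J ι R * Mᵀ).map ((RingHom.fst S S').comp (i : R →+* S × S')) =
            (J ι R).map ((RingHom.fst S S').comp (i : R →+* S × S')) := by
          rw [Matrix.map_mul, Matrix.map_mul, map_J, Matrix.transpose_map, hA]
          exact SymplecticGroup.mem_iff.1 A.2
        exact congrFun (congrFun h1 c) d
      · have h1 : (M * J ι R * Mᵀ).map ((RingHom.snd S S').comp (i : R →+* S × S')) =
            (J ι R).map ((RingHom.snd S S').comp (i : R →+* S × S')) := by
          rw [Matrix.map_mul, Matrix.map_mul, map_J, Matrix.transpose_map, hB]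
          exact SymplecticGroup.mem_iff.1 B.2
        exact congrFun (congrFun h1 c) d
    exact ⟨⟨M, hM⟩, Prod.ext (Subtype.ext hA) (Subtype.ext hB)⟩

end CRT

section PrimePow

variable {p k : ℕ}

/-- Reduction modulo `p`. -/
def red (p : ℕ) {k : ℕ} (hk : k ≠ 0) : ZMod (p ^ k) →+* ZMod p :=
  ZMod.castHom (dvd_pow_self p hk) (ZMod p)

lemma isUnit_iff_red (hp : p.Prime) (hk : k ≠ 0) (x : ZMod (p ^ k)) :
    IsUnit x ↔ red p hk x ≠ 0 := by
  have : NeZero (p ^ k) := ⟨pow_ne_zero k hp.ne_zero⟩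
  obtain ⟨n, rfl⟩ := ZMod.natCast_zmod_surjective x
  rw [ZMod.isUnit_iff_coprime, map_natCast, Ne, ZMod.natCast_eq_zero_iff,
    Nat.coprime_pow_right_iff (Nat.pos_of_ne_zero hk), Nat.coprime_comm, hp.coprime_iff_not_dvd]

lemma isLocalRing_zmod (hp : p.Prime) (hk : k ≠ 0) : IsLocalRing (ZMod (p ^ k)) := by
  have : Fact (1 < p ^ k) := ⟨Nat.one_lt_pow hk hp.one_lt⟩
  refine IsLocalRing.of_nonunits_add fun a b ha hb => ?_
  simp only [mem_nonunits_iff, isUnit_iff_red hp hk, not_not] at ha hb ⊢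
  rw [map_add, ha, hb, add_zero]

lemma isCyclicRing_zmod {n : ℕ} (hn : n ≠ 0) : IsCyclicRing (ZMod n) :=
  have : NeZero n := ⟨hn⟩
  ⟨ZMod.natCast_zmod_surjective⟩

lemma hasNonsquareSum_zmod (hp : p.Prime) (hp2 : p ≠ 2) (hk : k ≠ 0) :
    HasNonsquareSum (ZMod (p ^ k)) := by
  have : Fact p.Prime := ⟨hp⟩
  have hex : ∃ n : ℕ, ¬ IsSquare (n : ZMod p) := by
    obtain ⟨a, ha⟩ := FiniteField.exists_nonsquare (F := ZMod p) (by rwa [ZMod.ringChar_zmod_n])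
    obtain ⟨n, rfl⟩ := ZMod.natCast_zmod_surjective a
    exact ⟨n, ha⟩
  classical
  obtain ⟨m, hm⟩ : ∃ m, Nat.find hex = m + 1 := Nat.exists_eq_succ_of_ne_zero fun h0 => by
    have := Nat.find_spec hex
    simp [h0] at this
  have h1 : ¬ IsSquare ((m : ZMod p) + 1) := by
    have := Nat.find_spec hex
    rw [hm] at this
    exact_mod_cast this
  obtain ⟨s₀, hs₀⟩ : IsSquare (m : ZMod p) := not_not.1 (Nat.find_min hex (by omega))
  have hs0 : s₀ ≠ 0 := by
    rintro rfl
    exact h1 ⟨1, by rw [hs₀]; ring⟩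
  obtain ⟨s, rfl⟩ := ZMod.castHom_surjective (dvd_pow_self p hk) s₀
  obtain ⟨s, rfl⟩ := (isUnit_iff_red hp hk s).2 hs0
  have hz : red p hk ((s : ZMod (p ^ k)) ^ 2 + 1) = (m : ZMod p) + 1 := by
    rw [map_add, map_pow, map_one, hs₀, pow_two]
    rfl
  have hz0 : IsUnit ((s : ZMod (p ^ k)) ^ 2 + 1) := by
    rw [isUnit_iff_red hp hk, hz]
    intro h0
    exact h1 ⟨0, by rw [h0]; ring⟩
  obtain ⟨z, hz'⟩ := hz0
  refine ⟨z, s, hz'.symm, fun u => ?_⟩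
  have := ZMod.isCyclic_units_of_prime_pow p hp hp2 k
  obtain ⟨γ, hγ⟩ := IsCyclic.exists_generator (α := (ZMod (p ^ k))ˣ)
  obtain ⟨i, rfl⟩ := hγ u
  obtain ⟨j, rfl⟩ := hγ z
  rcases Int.even_or_odd' i with ⟨i', rfl | rfl⟩
  · exact Or.inl ⟨γ ^ i', by simp only; rw [mul_comm, _root_.zpow_mul]; rfl⟩
  · rcases Int.even_or_odd' j with ⟨j', rfl | rfl⟩
    · refine absurd ⟨red p hk ((γ ^ j' : (ZMod (p ^ k))ˣ) : ZMod (p ^ k)), ?_⟩ h1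
      rw [← hz, ← hz', ← map_mul, ← Units.val_mul, ← _root_.zpow_add, two_mul]
    · refine Or.inr ⟨γ ^ (i' - j'), ?_⟩
      simp only
      rw [← _root_.zpow_natCast, ← _root_.zpow_mul, ← _root_.zpow_add]
      congr 1
      push_cast
      ring

theorem good_zmod.{u} {g : ℕ} (hg : 2 < g) (N : ℕ) (hN : Odd N) :
    Good.{u} (symplecticGroup (Fin g) (ZMod N)) := by
  induction N using Nat.recOnPosPrimePosCoprime with
  | prime_pow p k hp hk =>
    have hp2 : p ≠ 2 := by
      rintro rfl
      exact absurd hN (Nat.not_odd_iff_even.2 (Nat.even_pow.2 ⟨even_two, hk.ne'⟩))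
    have := isLocalRing_zmod hp hk.ne'
    have := isCyclicRing_zmod (pow_ne_zero k hp.ne_zero)
    have := hasNonsquareSum_zmod hp hp2 hk.ne'
    have := ZMod.isCyclic_units_of_prime_pow p hp hp2 k
    have h2 : IsUnit (2 : ZMod (p ^ k)) := by
      have := (ZMod.isUnit_iff_coprime 2 (p ^ k)).2 (Nat.coprime_two_left.2 hN)
      exact_mod_cast this
    let := h2.invertible
    exact ⟨allSplit_symplecticGroup hg, oddPerfect_symplecticGroup hg⟩
  | zero => simp at hN
  | one =>
    have : Subsingleton (symplecticGroup (Fin g) (ZMod 1)) :=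
      ⟨fun a b => Subtype.ext (Subsingleton.elim _ _)⟩
    exact Good.of_subsingleton
  | coprime a b ha hb hab iha ihb =>
    rw [Nat.odd_mul] at hN
    exact ((iha hN.1).prod (ihb hN.2)).of_mulEquiv (prodSp (ZMod.chineseRemainder hab)).symm

end PrimePow

section Extension

variable {G : Type} [Group G] {l : ℕ}

/-- A function of two variables satisfying the (trivial-coefficient) 2-cocycle identity. -/
def IsTwoCocycle {A : Type*} [AddCommGroup A] (c : G → G → A) : Prop :=
  ∀ x y z, c y z + c x (y * z) = c (x * y) z + c x y

/-- The central extension of `G` attached to a 2-cocycle. -/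
@[ext]
structure CocycleExt {A : Type} [AddCommGroup A] (c : G → G → A) where
  /-- The central coordinate. -/
  fib : A
  /-- The base coordinate. -/
  base : G

variable {A : Type} [AddCommGroup A] {c : G → G → A}

lemma IsTwoCocycle.one_left (hc : IsTwoCocycle c) (x : G) : c 1 x = c 1 1 := by
  have := hc 1 1 x
  simp only [one_mul] at this
  simpa using this

lemma IsTwoCocycle.one_right (hc : IsTwoCocycle c) (x : G) : c x 1 = c 1 1 := by
  have := hc x 1 1
  simp only [mul_one] at this
  simpa using this.symm

/-- The group law defined by a 2-cocycle. -/
abbrev CocycleExt.group (hc : IsTwoCocycle c) : Group (CocycleExt c) where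
  mul a b := ⟨a.fib + b.fib + c a.base b.base, a.base * b.base⟩
  one := ⟨-c 1 1, 1⟩
  inv a := ⟨-a.fib - c a.base⁻¹ a.base - c 1 1, a.base⁻¹⟩
  mul_assoc x y z := CocycleExt.ext (by
    have := hc x.base y.base z.base
    change (x.fib + y.fib + c x.base y.base) + z.fib + c (x.base * y.base) z.base =
      x.fib + (y.fib + z.fib + c y.base z.base) + c x.base (y.base * z.base)
    calc _ = x.fib + y.fib + z.fib + (c (x.base * y.base) z.base + c x.base y.base) := by abel
      _ = _ := by rw [← this]; abel) (mul_assoc _ _ _)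
  one_mul x := CocycleExt.ext (by
    change -c 1 1 + x.fib + c 1 x.base = x.fib
    rw [hc.one_left x.base]; abel) (one_mul _)
  mul_one x := CocycleExt.ext (by
    change x.fib + -c 1 1 + c x.base 1 = x.fib
    rw [hc.one_right x.base]; abel) (mul_one _)
  inv_mul_cancel x := CocycleExt.ext (by
    change -x.fib - c x.base⁻¹ x.base - c 1 1 + x.fib + c x.base⁻¹ x.base = -c 1 1
    abel) (inv_mul_cancel _)

/-- If every odd-exponent central extension splits, every 2-cocycle modulo an odd number is a
coboundary. -/
lemma AllSplit.exists_coboundary (hG : AllSplit.{0} G) (hl : Odd l) {c : G → G → ZMod l}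
    (hc : IsTwoCocycle c) : ∃ b : G → ZMod l, ∀ x y, c x y = b y - b (x * y) + b x := by
  let := CocycleExt.group hc
  let p : CocycleExt c →* G :=
    { toFun := CocycleExt.base
      map_one' := rfl
      map_mul' := fun _ _ => rfl }
  have hmul : ∀ a b : CocycleExt c, a * b = ⟨a.fib + b.fib + c a.base b.base, a.base * b.base⟩ :=
    fun _ _ => rfl
  have hpow : ∀ (a : CocycleExt c), a.base = 1 → ∀ n : ℕ,
      a ^ n = ⟨n • (a.fib + c 1 1) - c 1 1, 1⟩ := by
    intro a ha n
    induction n with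
    | zero => rw [pow_zero, zero_smul, zero_sub]; rfl
    | succ n ih =>
      rw [pow_succ, ih, hmul, ha]
      refine CocycleExt.ext ?_ (one_mul 1)
      simp only [add_smul, one_smul]
      abel
  obtain ⟨σ, hσ⟩ := hG l (CocycleExt c) p
    { surj := fun x => ⟨⟨0, x⟩, rfl⟩
      odd := hl
      comm := fun a ha x => by
        have ha' : a.base = 1 := ha
        rw [hmul, hmul, ha', hc.one_left x.base, hc.one_right x.base]
        exact CocycleExt.ext (by simp only; abel) (by simp)
      pow := fun a ha => by
        rw [hpow a ha]
        refine CocycleExt.ext ?_ rfl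
        change l • (a.fib + c 1 1) - c 1 1 = - c 1 1
        simp }
  refine ⟨fun x => -(σ x).fib, fun x y => ?_⟩
  have h1 := congrArg CocycleExt.fib (map_mul σ x y)
  rw [hmul] at h1
  have h2 : ∀ x, (σ x).base = x := hσ
  simp only [h2] at h1
  simp only [h1]
  abel

end Extension

section Cohomology

variable {G : Type} [Group G]

open groupCohomology CategoryTheory

/-- Classes of cocycles vanish exactly when the cocycle is a coboundary. -/
lemma π_eq_zero_iff (A : Rep.{0} ℤ G) (n : ℕ) (y : cocycles A (n + 1)) :
    groupCohomology.π A (n + 1) y = 0 ↔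
      ∃ h : (Fin n → G) → A, inhomogeneousCochains.d A n h = iCocycles A (n + 1) y := by
  have hex := ShortComplex.exact_of_g_is_cokernel (ShortComplex.mk _ _
    ((groupCohomology.inhomogeneousCochains A).toCycles_comp_homologyπ n (n + 1)))
    ((groupCohomology.inhomogeneousCochains A).homologyIsCokernel n (n + 1) (by simp))
  rw [ShortComplex.moduleCat_exact_iff] at hex
  have hd : ∀ h : (Fin n → G) → A, iCocycles A (n + 1) (toCocycles A n (n + 1) h) =
      inhomogeneousCochains.d A n h := fun h => by
    rw [← inhomogeneousCochains.d_def, ← HomologicalComplex.toCycles_i]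
    rfl
  constructor
  · intro h0
    obtain ⟨h, hh⟩ := hex y h0
    exact ⟨h, by rw [← hd]; exact congrArg _ hh⟩
  · rintro ⟨h, hh⟩
    have hi : toCocycles A n (n + 1) h = y := by
      apply (ModuleCat.mono_iff_injective (iCocycles A (n + 1))).1 inferInstance
      rw [hd, hh]
    rw [← hi]
    have := (groupCohomology.inhomogeneousCochains A).toCycles_comp_homologyπ n (n + 1)
    exact congrArg (fun f => f.hom h) this

lemma d_one_apply (b : (Fin 1 → G) → ℤ) (v : Fin 2 → G) :
    inhomogeneousCochains.d (Rep.trivial ℤ G ℤ) 1 b v =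
      b ![v 1] - b ![v 0 * v 1] + b ![v 0] := by
  have h0 : (fun i : Fin 1 => v i.succ) = ![v 1] := by ext i; fin_cases i; rfl
  have h1 : Fin.contractNth 0 (· * ·) v = ![v 0 * v 1] := by ext i; fin_cases i; rfl
  have h2 : Fin.contractNth 1 (· * ·) v = ![v 0] := by ext i; fin_cases i; rfl
  rw [inhomogeneousCochains.d_hom_apply, Fin.sum_univ_two, h0, h1, h2]
  simp
  ring

lemma d_two_apply (h : (Fin 2 → G) → ℤ) (v : Fin 3 → G) :
    inhomogeneousCochains.d (Rep.trivial ℤ G ℤ) 2 h v =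
      h ![v 1, v 2] - h ![v 0 * v 1, v 2] + h ![v 0, v 1 * v 2] - h ![v 0, v 1] := by
  have h0 : (fun i : Fin 2 => v i.succ) = ![v 1, v 2] := by ext i; fin_cases i <;> rfl
  have h1 : Fin.contractNth 0 (· * ·) v = ![v 0 * v 1, v 2] := by ext i; fin_cases i <;> rfl
  have h2 : Fin.contractNth 1 (· * ·) v = ![v 0, v 1 * v 2] := by ext i; fin_cases i <;> rfl
  have h3 : Fin.contractNth 2 (· * ·) v = ![v 0, v 1] := by ext i; fin_cases i <;> rfl
  rw [inhomogeneousCochains.d_hom_apply, Fin.sum_univ_three, h0, h1, h2, h3]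
  simp
  ring

/-- If all odd-exponent central extensions of `G` split, then `H³(G, ℤ)` has no odd torsion. -/
theorem AllSplit.h3_torsion_free (hG : AllSplit.{0} G) {l : ℕ} (hl : Odd l)
    (x : groupCohomology (Rep.trivial ℤ G ℤ) 3) (hx : l • x = 0) : x = 0 := by
  induction x using groupCohomology_induction_on with
  | h y =>
  set f : (Fin 3 → G) → ℤ := iCocycles (Rep.trivial ℤ G ℤ) 3 y with hf
  rw [← map_nsmul, π_eq_zero_iff] at hx
  obtain ⟨h, hh⟩ := hx
  rw [map_nsmul] at hh
  have hd : ∀ v, inhomogeneousCochains.d (Rep.trivial ℤ G ℤ) 2 h v = l * f v := fun v => by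
    rw [hh]
    exact nsmul_eq_mul l (f v)
  obtain ⟨b, hb⟩ := hG.exists_coboundary hl (c := fun x y => ((h ![x, y] : ℤ) : ZMod l)) (by
    intro x y z
    have h1 := hd ![x, y, z]
    rw [d_two_apply] at h1
    have h2 := congrArg (Int.cast : ℤ → ZMod l) h1
    push_cast at h2
    rw [ZMod.natCast_self, zero_mul] at h2
    rw [← sub_eq_zero, ← h2]
    simp
    ring)
  choose b' hb' using fun x => ZMod.intCast_surjective (b x)
  let β : (Fin 1 → G) → ℤ := fun v => b' (v 0)
  have hk : ∀ v : Fin 2 → G, ∃ k : ℤ,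
      h v - inhomogeneousCochains.d (Rep.trivial ℤ G ℤ) 1 β v = l * k := fun v => by
    have hv : v = ![v 0, v 1] := by ext i; fin_cases i <;> rfl
    rw [d_one_apply]
    refine (ZMod.intCast_zmod_eq_zero_iff_dvd _ l).1 ?_
    have h1 := hb (v 0) (v 1)
    rw [← hv] at h1
    push_cast
    simp [h1, β, hb']
  choose k hk using hk
  have hkd : h = inhomogeneousCochains.d (Rep.trivial ℤ G ℤ) 1 β + (l : ℤ) • k := by
    funext v
    rw [Pi.add_apply, Pi.smul_apply, smul_eq_mul, ← hk v]
    ring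
  rw [π_eq_zero_iff]
  refine ⟨k, ?_⟩
  have hdd : inhomogeneousCochains.d (Rep.trivial ℤ G ℤ) 2
      (inhomogeneousCochains.d (Rep.trivial ℤ G ℤ) 1 β) = 0 :=
    congrArg (fun f => f.hom β) (inhomogeneousCochains.d_comp_d 1 (Rep.trivial ℤ G ℤ))
  funext v
  have h1 := hd v
  rw [hkd, map_add, map_smul, hdd, zero_add] at h1
  exact mul_left_cancel₀ (Nat.cast_ne_zero.2 hl.pos.ne') h1

end Cohomology

end SpLift

/-- For every `g ≥ 3`, every odd `N ≥ 1` and every odd prime `l`, the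
`l`-torsion of `H³(Sp_{2g}(ℤ/Nℤ), ℤ)` (trivial coefficients) vanishes. -/
theorem h3_symplecticGroup_odd_torsion_free (g N l : ℕ) (hg : 3 ≤ g) (hN : 1 ≤ N)
    (hNodd : Odd N) (hl : l.Prime) (hlodd : Odd l)
    (x : groupCohomology (Rep.trivial ℤ ↥(Matrix.symplecticGroup (Fin g) (ZMod N)) ℤ) 3)
    (hx : l • x = 0) :
    x = 0 := by
  exact (SpLift.good_zmod hg N hNodd).1.h3_torsion_free hlodd x hx
end

section
/- Let g ≥ 3 and let N ≥ 1 be odd. If X is a 2g×2g matrix over ℤ/Nℤ lying in sp_{2g}(ℤ/Nℤ) (i.e. ᵀX·J + J·X = 0) and X is invariant under the adjoint action, i.e. u·X·u⁻¹ = X for every u ∈ Sp_{2g}(ℤ/Nℤ), then X = 0. -/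
open Matrix

/-- The Lie algebra `sp_{2g}(R)`: the `R`-module of matrices `X` with `ᵀX·J + J·X = 0`. -/
def spLie (l R : Type*) [DecidableEq l] [Fintype l] [CommRing R] :
    Submodule R (Matrix (l ⊕ l) (l ⊕ l) R) where
  carrier := {X | Xᵀ * paperJ l R + paperJ l R * X = 0}
  add_mem' := by
    intro a b ha hb
    simp only [Set.mem_setOf_eq] at *
    rw [Matrix.transpose_add, Matrix.add_mul, Matrix.mul_add]
    calc aᵀ * paperJ l R + bᵀ * paperJ l R + (paperJ l R * a + paperJ l R * b)
        = (aᵀ * paperJ l R + paperJ l R * a) + (bᵀ * paperJ l R + paperJ l R * b) := by abel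
      _ = 0 := by rw [ha, hb, add_zero]
  zero_mem' := by simp
  smul_mem' := by
    intro c x hx
    simp only [Set.mem_setOf_eq] at *
    rw [Matrix.transpose_smul, Matrix.smul_mul, Matrix.mul_smul, ← smul_add, hx, smul_zero]

/-- The upper unipotent block matrix attached to a symmetric matrix is symplectic. -/
theorem fromBlocks_one_symm_mem {l R : Type*} [DecidableEq l] [Fintype l] [CommRing R]
    {S : Matrix l l R} (hS : Sᵀ = S) :
    fromBlocks 1 S 0 1 ∈ Matrix.symplecticGroup l R := by
  rw [SymplecticGroup.mem_iff, J, fromBlocks_transpose, fromBlocks_multiply, fromBlocks_multiply]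
  simp [hS]

/-- A matrix fixed by conjugation by a symplectic matrix commutes with it. -/
theorem commute_of_conj_eq {l R : Type*} [DecidableEq l] [Fintype l] [CommRing R]
    {u X : Matrix (l ⊕ l) (l ⊕ l) R} (hu : u ∈ Matrix.symplecticGroup l R)
    (h : u * X * u⁻¹ = X) : u * X = X * u := by
  rw [← nonsing_inv_mul_cancel_right u (u * X) (SymplecticGroup.symplectic_det hu), h]

/-- Over a commutative ring in which `2` is not a zero divisor, the adjoint representation of the
symplectic group has no nonzero invariants. -/
theorem eq_zero_of_mem_spLie_of_forall_conj_eq {l R : Type*} [DecidableEq l] [Fintype l]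
    [CommRing R] (h2 : ∀ a : R, a + a = 0 → a = 0) {X : Matrix (l ⊕ l) (l ⊕ l) R}
    (hX : X ∈ spLie l R)
    (hinv : ∀ u ∈ Matrix.symplecticGroup l R, u * X * u⁻¹ = X) : X = 0 := by
  obtain ⟨A, B, C, D, rfl⟩ : ∃ A B C D, X = fromBlocks A B C D :=
    ⟨_, _, _, _, (fromBlocks_toBlocks X).symm⟩
  have hupper (S : Matrix l l R) (hS : Sᵀ = S) : S * C = 0 ∧ S * D = A * S := by
    have hu := fromBlocks_one_symm_mem hS
    have h := commute_of_conj_eq hu (hinv _ hu)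
    rw [fromBlocks_multiply, fromBlocks_multiply, fromBlocks_inj] at h
    obtain ⟨h₁, h₂, -, -⟩ := h
    simp only [Matrix.one_mul, Matrix.mul_one, Matrix.mul_zero, add_zero] at h₁ h₂
    exact ⟨by simpa using h₁, add_left_cancel (h₂.trans (add_comm _ _))⟩
  have hJ := commute_of_conj_eq (SymplecticGroup.J_mem l R) (hinv _ (SymplecticGroup.J_mem l R))
  rw [J, fromBlocks_multiply, fromBlocks_multiply, fromBlocks_inj] at hJ
  have hC : C = 0 := by simpa using (hupper 1 transpose_one).1
  have hB : B = 0 := by simpa [hC, eq_comm] using hJ.1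
  have hD : D = A := by simpa using (hupper 1 transpose_one).2
  have hskew : Aᵀ + A = 0 := by
    have h : (fromBlocks A B C D)ᵀ * paperJ l R + paperJ l R * fromBlocks A B C D = 0 := hX
    rw [paperJ, fromBlocks_transpose, fromBlocks_multiply, fromBlocks_multiply, fromBlocks_add,
      ← fromBlocks_zero, fromBlocks_inj] at h
    simpa [hD] using h.2.1
  have hA : A = 0 := by
    ext i j
    by_cases hij : i = j
    · subst hij
      exact h2 _ (by simpa using congrFun (congrFun hskew i) i)
    · have h := congrFun (congrFun (hupper (single i i 1) (by simp)).2 i) j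
      rw [hD] at h
      simpa [Ne.symm hij, hij] using h
  rw [hD, hA, hB, hC, fromBlocks_zero]

/-- Let `g ≥ 3` and `N ≥ 1` odd.  If `X ∈ sp_{2g}(ℤ/Nℤ)` is invariant under
the adjoint action, i.e. `u·X·u⁻¹ = X` for every `u ∈ Sp_{2g}(ℤ/Nℤ)`, then `X = 0`. -/
theorem adjoint_invariant_eq_zero (g N : ℕ) (hg : 3 ≤ g) (hN : 1 ≤ N) (hNodd : Odd N)
    (X : Matrix (Fin g ⊕ Fin g) (Fin g ⊕ Fin g) (ZMod N))
    (hX : X ∈ spLie (Fin g) (ZMod N))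
    (hinv : ∀ u ∈ Matrix.symplecticGroup (Fin g) (ZMod N), u * X * u⁻¹ = X) :
    X = 0 := by
  refine eq_zero_of_mem_spLie_of_forall_conj_eq (fun a ha => ?_) hX hinv
  have h2 : IsUnit ((2 : ℕ) : ZMod N) :=
    (ZMod.isUnit_iff_coprime 2 N).2 (Nat.coprime_two_left.2 hNodd)
  rw [← two_mul] at ha
  exact h2.mul_right_eq_zero.1 (by exact_mod_cast ha)
end
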